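/- arXiv:1407.3705 — 9 statements merged into one kernel-verified Lean document; each statement's English description precedes it below -/
import Mathlib

section
/- Let Γ be a group, ρ: Γ → GL(V) an irreducible representation of Γ on a finite-dimensional complex vector space V with dim_ℂ V > 1, and φ: Γ → ℤ a group homomorphism. Make V[ℤ] := ℂ[t, t⁻¹] ⊗_ℂ V into a Γ-module by γ·(p ⊗ v) = t^{φ(γ)} p ⊗ ρ(γ)v. Then the module of coinvariants H₀(Γ; V[ℤ]) = V[ℤ] / span{γ·w − w : γ ∈ Γ, w ∈ V[ℤ]} is zero. (In the language of the paper: the twisted Alexander polynomial Δ₀^ρ is a unit.) -/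
open scoped TensorProduct

/-- A finite-dimensional irreducible complex representation by pairwise commuting operators has
dimension at most one. -/
theorem finrank_le_one_of_irreducible_of_commute
    {Γ V : Type*} [Group Γ] [AddCommGroup V] [Module ℂ V] [FiniteDimensional ℂ V]
    (ρ : Representation ℂ Γ V)
    (hirr : ∀ W : Submodule ℂ V, (∀ γ : Γ, ∀ v ∈ W, ρ γ v ∈ W) → W = ⊥ ∨ W = ⊤)
    (hcomm : ∀ a b : Γ, Commute (ρ a) (ρ b)) :
    Module.finrank ℂ V ≤ 1 := by
  rcases subsingleton_or_nontrivial V with _ | _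
  · simp [Module.finrank_zero_of_subsingleton]
  have hscalar : ∀ γ : Γ, ∃ c : ℂ, ∀ v : V, ρ γ v = c • v := by
    intro γ
    obtain ⟨c, hc⟩ := Module.End.exists_eigenvalue (ρ γ)
    refine ⟨c, fun v => ?_⟩
    have htop : Module.End.eigenspace (ρ γ) c = ⊤ := by
      refine (hirr _ fun δ w hw => ?_).resolve_left hc
      rw [Module.End.mem_eigenspace_iff] at hw ⊢
      rw [← Module.End.mul_apply, (hcomm γ δ).eq, Module.End.mul_apply, hw, map_smul]
    exact Module.End.mem_eigenspace_iff.mp (htop ▸ Submodule.mem_top)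
  obtain ⟨v, hv⟩ := exists_ne (0 : V)
  have hspan : Submodule.span ℂ {v} = ⊤ := by
    refine (hirr _ fun γ w hw => ?_).resolve_left (by simpa using hv)
    obtain ⟨c, hc⟩ := hscalar γ
    exact hc w ▸ Submodule.smul_mem _ c hw
  rw [← finrank_top, ← hspan, finrank_span_singleton hv]

/-- The vectors `ρ k v - v`, with `k` in a normal subgroup, span an invariant subspace. -/
theorem map_mem_span_sub_of_normal
    {Γ V : Type*} [Group Γ] [AddCommGroup V] [Module ℂ V]
    (ρ : Representation ℂ Γ V) (K : Subgroup Γ) [hK : K.Normal] (γ : Γ) {v : V}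
    (hv : v ∈ Submodule.span ℂ {x : V | ∃ k ∈ K, ∃ w, x = ρ k w - w}) :
    ρ γ v ∈ Submodule.span ℂ {x : V | ∃ k ∈ K, ∃ w, x = ρ k w - w} := by
  induction hv using Submodule.span_induction with
  | mem x hx =>
    obtain ⟨k, hk, w, rfl⟩ := hx
    refine Submodule.subset_span ⟨γ * k * γ⁻¹, hK.conj_mem k hk γ, ρ γ w, ?_⟩
    simp [map_mul]
  | zero => simp
  | add x y _ _ hx hy => rw [map_add]; exact add_mem hx hy
  | smul c x _ hx => rw [map_smul]; exact Submodule.smul_mem _ c hx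

/-- **Equation (4) in the proof of Lemma 2.7.** Let `ρ : Γ → GL(V)` be an irreducible
representation on a finite-dimensional complex vector space with `dim V > 1`, and let
`φ : Γ → ℤ` be a group homomorphism.  Give `V[ℤ] = ℂ[t,t⁻¹] ⊗ V` the `Γ`-action
`γ · (p ⊗ v) = t^{φ(γ)} p ⊗ ρ(γ) v`.  Then the coinvariants `H₀(Γ; V[ℤ])` vanish,
i.e. the subspace spanned by the elements `γ·w - w` is everything. -/
theorem coinvariants_of_irreducible_tensor_laurent_eq_top
    {Γ V : Type*} [Group Γ] [AddCommGroup V] [Module ℂ V] [FiniteDimensional ℂ V]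
    (hdim : 1 < Module.finrank ℂ V)
    (ρ : Representation ℂ Γ V)
    (hirr : ∀ W : Submodule ℂ V, (∀ γ : Γ, ∀ v ∈ W, ρ γ v ∈ W) → W = ⊥ ∨ W = ⊤)
    (φ : Γ → ℤ) (hφ : ∀ a b : Γ, φ (a * b) = φ a + φ b) :
    Submodule.span ℂ
      {x : LaurentPolynomial ℂ ⊗[ℂ] V | ∃ (γ : Γ) (w : LaurentPolynomial ℂ ⊗[ℂ] V),
        x = TensorProduct.map
              (LinearMap.mulLeft ℂ (LaurentPolynomial.T (φ γ))) (ρ γ) w - w} = ⊤ := by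
  let φ' : Γ →* Multiplicative ℤ :=
    MonoidHom.mk' (fun γ => Multiplicative.ofAdd (φ γ)) fun a b => by simp [hφ]
  have hker : ∀ k, k ∈ φ'.ker ↔ φ k = 0 := fun k => by simp [φ', MonoidHom.mem_ker]
  rcases hirr _ (fun γ _ hv => map_mem_span_sub_of_normal ρ φ'.ker γ hv) with hbot | htop
  · refine absurd (finrank_le_one_of_irreducible_of_commute ρ hirr fun a b => ?_) hdim.not_ge
    have hK : ∀ k ∈ φ'.ker, ρ k = 1 := by
      intro k hk
      ext w
      have := Submodule.span_eq_bot.mp hbot _ ⟨k, hk, w, rfl⟩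
      simpa [sub_eq_zero] using this
    have hab : a * b * (b * a)⁻¹ ∈ φ'.ker := by
      rw [MonoidHom.mem_ker, map_mul, map_inv, map_mul, map_mul, mul_comm (φ' b), mul_inv_cancel]
    calc ρ a * ρ b = ρ (a * b * (b * a)⁻¹ * (b * a)) := by rw [inv_mul_cancel_right, map_mul]
      _ = ρ b * ρ a := by rw [map_mul, hK _ hab, one_mul, map_mul]
  · rw [eq_top_iff, ← TensorProduct.span_tmul_eq_top, Submodule.span_le]
    rintro _ ⟨p, v, rfl⟩
    have hv : v ∈ Submodule.span ℂ {x : V | ∃ k ∈ φ'.ker, ∃ w, x = ρ k w - w} :=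
      htop ▸ Submodule.mem_top
    induction hv using Submodule.span_induction with
    | mem x hx =>
      obtain ⟨k, hk, w, rfl⟩ := hx
      refine Submodule.subset_span ⟨k, p ⊗ₜ w, ?_⟩
      simp [(hker k).mp hk, TensorProduct.tmul_sub]
    | zero => simp
    | add x y _ _ hx hy => rw [TensorProduct.tmul_add]; exact add_mem hx hy
    | smul c x _ hx => rw [TensorProduct.tmul_smul]; exact Submodule.smul_mem _ c hx
end

section
/- Let n ≥ 1 and let G be a subgroup of GL_n(ℂ) acting irreducibly on ℂⁿ (i.e., the only subspaces of ℂⁿ invariant under every element of G are 0 and ℂⁿ). If N is a normal subgroup of G all of whose elements are unipotent (i.e., (g − 1)ⁿ = 0 in M_n(ℂ) for every g ∈ N), then N is the trivial subgroup. -/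
/-- **Burnside's theorem**: over an algebraically closed field, an algebra acting irreducibly on a
finite-dimensional space `V` surjects onto `End V`. -/
theorem IsSimpleModule.lsmul_surjective_of_isAlgClosed
    {k A V : Type*} [Field k] [IsAlgClosed k] [Ring A] [Algebra k A] [AddCommGroup V]
    [Module k V] [Module A V] [IsScalarTower k A V] [IsSimpleModule A V] [FiniteDimensional k V] :
    Function.Surjective (Algebra.lsmul k k V : A →ₐ[k] Module.End k V) := by
  intro f
  let F : Module.End (Module.End A V) V :=
    { f with
      map_smul' := fun e v ↦ by
        obtain ⟨c, rfl⟩ := (IsSimpleModule.algebraMap_end_bijective_of_isAlgClosed k).2 e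
        simp }
  obtain ⟨s, hs⟩ := Module.Finite.fg_top (R := k) (M := V)
  obtain ⟨a, ha⟩ := jacobson_density (R := A) F s
  exact ⟨a, LinearMap.ext_on hs fun v hv ↦ (ha v hv).symm⟩

/-- A monoid of unipotent operators acts trivially on a simple module over its linear span. -/
theorem IsSimpleModule.smul_eq_self_of_unipotent
    {k A V : Type*} [Field k] [IsAlgClosed k] [Ring A] [Algebra k A] [AddCommGroup V]
    [Module k V] [Module A V] [IsScalarTower k A V] [IsSimpleModule A V] [FiniteDimensional k V]
    (S : Submonoid A) (hS : Algebra.adjoin k (S : Set A) = ⊤)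
    (hunip : ∀ s ∈ S, IsNilpotent (Algebra.lsmul k k V (s - 1)))
    {s : A} (hs : s ∈ S) (v : V) : s • v = v := by
  have htrace (t : A) (ht : t ∈ S) :
      LinearMap.trace k V (Algebra.lsmul k k V t) = LinearMap.trace k V 1 := by
    rw [← sub_eq_zero, ← map_one (Algebra.lsmul k k V : A →ₐ[k] Module.End k V), ← map_sub, ← map_sub]
    exact (LinearMap.isNilpotent_trace_of_isNilpotent (hunip t ht)).eq_zero
  have hspan : Submodule.span k (S : Set A) = ⊤ := by
    rw [← Algebra.top_toSubmodule, ← hS, Algebra.adjoin_eq_span, Submonoid.closure_eq]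
  have horth (a : A) : LinearMap.trace k V (Algebra.lsmul k k V ((s - 1) * a)) = 0 := by
    have ha : a ∈ Submodule.span k (S : Set A) := hspan ▸ Submodule.mem_top
    induction ha using Submodule.span_induction with
    | mem t ht =>
      rw [sub_mul, one_mul, map_sub, map_sub, htrace _ (S.mul_mem hs ht), htrace t ht, sub_self]
    | zero => simp
    | add x y _ _ hx hy => rw [mul_add, map_add, map_add, hx, hy, add_zero]
    | smul c x _ hx => rw [mul_smul_comm, map_smul, map_smul, hx, smul_zero]
  by_contra hne
  have hw : (s - 1) • v ≠ 0 := by rwa [sub_smul, one_smul, sub_ne_zero]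
  obtain ⟨φ, hφ⟩ : ∃ φ : Module.Dual k V, φ ((s - 1) • v) ≠ 0 := by
    by_contra! h
    exact hw ((Module.forall_dual_apply_eq_zero_iff k _).mp h)
  obtain ⟨a, ha⟩ := IsSimpleModule.lsmul_surjective_of_isAlgClosed (A := A) (φ.smulRight v)
  refine hφ ?_
  rw [← horth a, map_mul, ha, ← LinearMap.trace_smulRight]
  congr 1
  ext w
  exact (map_smul (Algebra.lsmul k k V (s - 1)) (φ w) v).symm

/-- **Kolchin's theorem**: a monoid of unipotent operators on a nonzero finite-dimensional space
over an algebraically closed field fixes a nonzero vector. -/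
theorem Submonoid.exists_ne_zero_forall_apply_eq_self_of_unipotent
    {k V : Type*} [Field k] [IsAlgClosed k] [AddCommGroup V] [Module k V] [FiniteDimensional k V]
    [Nontrivial V] (S : Submonoid (Module.End k V)) (hunip : ∀ s ∈ S, IsNilpotent (s - 1)) :
    ∃ v : V, v ≠ 0 ∧ ∀ s ∈ S, s v = v := by
  let A := Algebra.adjoin k (S : Set (Module.End k V))
  have : IsArtinian A V := isArtinian_of_tower k inferInstance
  obtain ⟨W, hW⟩ : ∃ W : Submodule A V, IsSimpleModule A W := by
    simpa only [isSimpleModule_iff_isAtom] using IsAtomic.exists_atom (Submodule A V)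
  have : FiniteDimensional k W := FiniteDimensional.finiteDimensional_submodule (W.restrictScalars k)
  have := IsSimpleModule.nontrivial A W
  obtain ⟨w, hw⟩ := exists_ne (0 : W)
  refine ⟨w, by simpa using hw, fun s hs ↦ ?_⟩
  have key := IsSimpleModule.smul_eq_self_of_unipotent (k := k) (V := W)
    (S.comap A.val) (Algebra.adjoin_adjoin_coe_preimage (s := (S : Set (Module.End k V)))) ?_
    (s := ⟨s, Algebra.subset_adjoin hs⟩) hs w
  · exact congr_arg Subtype.val key
  · intro t ht
    obtain ⟨m, hm⟩ := hunip t ht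
    have ht' : (t - 1) ^ m = 0 := Subtype.ext (by simpa using hm)
    exact ⟨m, by rw [← map_pow, ht', map_zero]⟩

/-- **Lemma 4.3.** Let `G ⊆ GL_n(ℂ)` act irreducibly on `ℂⁿ`.  Then any normal subgroup
`N` of `G` consisting of unipotent elements is trivial. -/
theorem normal_unipotent_subgroup_of_irreducible_eq_bot
    (n : ℕ) (hn : 1 ≤ n)
    (G : Subgroup (GL (Fin n) ℂ))
    (hirr : ∀ W : Submodule ℂ (Fin n → ℂ),
      (∀ g ∈ G, ∀ v ∈ W, ((g : GL (Fin n) ℂ) : Matrix (Fin n) (Fin n) ℂ).mulVec v ∈ W) →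
      W = ⊥ ∨ W = ⊤)
    (N : Subgroup (GL (Fin n) ℂ)) (hNG : N ≤ G)
    (hnormal : ∀ g ∈ G, ∀ x ∈ N, g * x * g⁻¹ ∈ N)
    (hunip : ∀ x ∈ N, ((x : Matrix (Fin n) (Fin n) ℂ) - 1) ^ n = 0) :
    N = ⊥ := by
  have : Nonempty (Fin n) := ⟨⟨0, hn⟩⟩
  let ρ : GL (Fin n) ℂ →* Module.End ℂ (Fin n → ℂ) :=
    (Matrix.toLinAlgEquiv' : Matrix (Fin n) (Fin n) ℂ ≃ₐ[ℂ] _).toAlgHom.toMonoidHom.comp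
      (Units.coeHom _)
  have hρ : ∀ s ∈ N.toSubmonoid.map ρ, IsNilpotent (s - 1) := by
    rintro _ ⟨x, hx, rfl⟩
    refine ⟨n, ?_⟩
    have := congr_arg (Matrix.toLinAlgEquiv' : Matrix (Fin n) (Fin n) ℂ ≃ₐ[ℂ] _) (hunip x hx)
    rwa [map_pow, map_sub, map_one, map_zero] at this
  obtain ⟨v, hv0, hv⟩ := Submonoid.exists_ne_zero_forall_apply_eq_self_of_unipotent _ hρ
  let W : Submodule ℂ (Fin n → ℂ) := ⨅ x ∈ N, LinearMap.eqLocus (ρ x) LinearMap.id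
  have mem_W (w : Fin n → ℂ) : w ∈ W ↔ ∀ x ∈ N, ρ x w = w := by simp [W]
  have hWtop : W = ⊤ := by
    refine (hirr W fun g hg w hw ↦ ?_).resolve_left fun h ↦ hv0 ?_
    · change ρ g w ∈ W
      rw [mem_W] at hw ⊢
      intro x hx
      have hconj := hw _ (by simpa using hnormal g⁻¹ (G.inv_mem hg) x hx)
      calc ρ x (ρ g w) = ρ g (ρ (g⁻¹ * x * g) w) := by
            rw [← Module.End.mul_apply, ← Module.End.mul_apply, ← map_mul, ← map_mul]
            group
        _ = ρ g w := by rw [hconj]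
    · rw [← Submodule.mem_bot ℂ, ← h, mem_W]
      exact fun x hx ↦ hv _ ⟨x, hx, rfl⟩
  refine (Subgroup.eq_bot_iff_forall N).mpr fun x hx ↦ Units.ext ?_
  refine (Matrix.toLinAlgEquiv' : Matrix (Fin n) (Fin n) ℂ ≃ₐ[ℂ] _).injective ?_
  rw [Units.val_one, map_one]
  exact LinearMap.ext fun w ↦ (mem_W w).mp (hWtop ▸ Submodule.mem_top) x hx
end

section
/- Let Γ be a group, let α: Γ → GL(V) and β: Γ → GL(W) be irreducible representations of Γ on finite-dimensional complex vector spaces, let φ: Γ → ℤ be a group homomorphism and λ ∈ ℂ \ {0}. Then the representation of Γ on Hom_ℂ(W, V) defined by γ·f = λ^{φ(γ)} · (α(γ) ∘ f ∘ β(γ)⁻¹) is completely reducible; that is, Hom_ℂ(W, V) is a semisimple module over the group algebra ℂ[Γ] (a direct sum of irreducible subrepresentations). -/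
section Auxiliary

open Matrix Filter Topology
open scoped ComplexOrder Kronecker

/-- The squared Euclidean norm of a complex vector. -/
noncomputable def vecNormSq {J : Type*} [Fintype J] (v : J → ℂ) : ℝ := ∑ j, ‖v j‖ ^ 2

/-- The diagonal matrix with entries `exp (s * a r)`. -/
noncomputable def expDiag {n : Type*} [DecidableEq n] (a : n → ℝ) (s : ℝ) : Matrix n n ℂ :=
  diagonal fun r => ((Real.exp (s * a r) : ℝ) : ℂ)

lemma expDiag_zero {n : Type*} [DecidableEq n] (a : n → ℝ) : expDiag a 0 = 1 := by
  simp [expDiag]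

lemma conjTranspose_expDiag {n : Type*} [DecidableEq n] (a : n → ℝ) (s : ℝ) :
    (expDiag a s)ᴴ = expDiag a s := by
  rw [expDiag, diagonal_conjTranspose]
  congr 1
  ext r
  exact Complex.conj_ofReal _

section VecNormSq

variable {J : Type*} [Fintype J]

lemma vecNormSq_nonneg (v : J → ℂ) : 0 ≤ vecNormSq v :=
  Finset.sum_nonneg fun _ _ => by positivity

lemma norm_sq_le_vecNormSq (v : J → ℂ) (j : J) : ‖v j‖ ^ 2 ≤ vecNormSq v :=
  Finset.single_le_sum (f := fun j => ‖v j‖ ^ 2) (fun _ _ => by positivity) (Finset.mem_univ j)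

lemma vecNormSq_eq_zero {v : J → ℂ} : vecNormSq v = 0 ↔ v = 0 := by
  unfold vecNormSq
  rw [Finset.sum_eq_zero_iff_of_nonneg (fun _ _ => by positivity)]
  simp [funext_iff]

lemma vecNormSq_smul (c : ℂ) (v : J → ℂ) : vecNormSq (c • v) = ‖c‖ ^ 2 * vecNormSq v := by
  simp [vecNormSq, Finset.mul_sum, mul_pow]

lemma star_dotProduct_self (v : J → ℂ) : star v ⬝ᵥ v = (vecNormSq v : ℂ) := by
  simp [vecNormSq, dotProduct, Complex.conj_mul']

lemma vecNormSq_unitary_mulVec [DecidableEq J] {U : Matrix J J ℂ} (hU : Uᴴ * U = 1) (v : J → ℂ) :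
    vecNormSq (U *ᵥ v) = vecNormSq v := by
  have h : star (U *ᵥ v) ⬝ᵥ (U *ᵥ v) = star v ⬝ᵥ v := by
    rw [star_mulVec, ← dotProduct_mulVec, mulVec_mulVec, hU, one_mulVec]
  rw [star_dotProduct_self, star_dotProduct_self] at h
  exact_mod_cast h

lemma norm_dotProduct_sq_le (v w : J → ℂ) : ‖v ⬝ᵥ w‖ ^ 2 ≤ vecNormSq v * vecNormSq w := by
  calc ‖v ⬝ᵥ w‖ ^ 2 ≤ (∑ j, ‖v j‖ * ‖w j‖) ^ 2 := by
        gcongr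
        exact (norm_sum_le _ _).trans_eq (by simp)
    _ ≤ _ := Finset.sum_mul_sq_le_sq_mul_sq _ _ _

lemma vecNormSq_expDiag_mulVec [DecidableEq J] (a : J → ℝ) (s : ℝ) (v : J → ℂ) :
    vecNormSq (expDiag a s *ᵥ v) = ∑ j, Real.exp (s * (2 * a j)) * ‖v j‖ ^ 2 := by
  refine Finset.sum_congr rfl fun j _ => ?_
  rw [expDiag, mulVec_diagonal, norm_mul, mul_pow, Complex.norm_real, Real.norm_eq_abs,
    abs_of_pos (Real.exp_pos _), ← Real.exp_nat_mul]
  congr 2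
  push_cast
  ring

lemma continuous_vecNormSq : Continuous (vecNormSq : (J → ℂ) → ℝ) := by
  unfold vecNormSq
  fun_prop

end VecNormSq

section Frobenius

variable {n : Type*} [Fintype n]

/-- The squared Frobenius norm of a complex matrix. -/
noncomputable def frobSq (M : Matrix n n ℂ) : ℝ := ∑ r, vecNormSq (M.row r)

lemma frobSq_nonneg (M : Matrix n n ℂ) : 0 ≤ frobSq M :=
  Finset.sum_nonneg fun _ _ => vecNormSq_nonneg _

lemma frobSq_eq_sum_col (M : Matrix n n ℂ) : frobSq M = ∑ c, vecNormSq (fun r => M r c) :=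
  Finset.sum_comm

lemma vecNormSq_row_le_frobSq (M : Matrix n n ℂ) (r : n) : vecNormSq (M.row r) ≤ frobSq M :=
  Finset.single_le_sum (f := fun r => vecNormSq (M.row r)) (fun _ _ => vecNormSq_nonneg _)
    (Finset.mem_univ r)

lemma frobSq_unitary_mul [DecidableEq n] {U : Matrix n n ℂ} (hU : Uᴴ * U = 1)
    (M : Matrix n n ℂ) : frobSq (U * M) = frobSq M := by
  rw [frobSq_eq_sum_col, frobSq_eq_sum_col]
  exact Finset.sum_congr rfl fun c _ => vecNormSq_unitary_mulVec hU fun r => M r c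

lemma frobSq_eq_zero {M : Matrix n n ℂ} : frobSq M = 0 ↔ M = 0 := by
  unfold frobSq
  rw [Finset.sum_eq_zero_iff_of_nonneg (fun _ _ => vecNormSq_nonneg _)]
  simp only [Finset.mem_univ, vecNormSq_eq_zero, forall_const]
  exact ⟨fun h => by ext r c; exact congrFun (h r) c, fun h r => by rw [h]; rfl⟩

lemma frobSq_smul (c : ℂ) (M : Matrix n n ℂ) : frobSq (c • M) = ‖c‖ ^ 2 * frobSq M := by
  rw [frobSq, frobSq, Finset.mul_sum]
  exact Finset.sum_congr rfl fun r _ => vecNormSq_smul c (M.row r)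

lemma vecNormSq_mul_row_le (M N : Matrix n n ℂ) (r : n) :
    vecNormSq ((M * N).row r) ≤ frobSq N * vecNormSq (M.row r) := by
  rw [frobSq_eq_sum_col, Finset.sum_mul]
  refine Finset.sum_le_sum fun c _ => ?_
  rw [mul_comm]
  exact norm_dotProduct_sq_le (M.row r) fun r => N r c

lemma frobSq_mul_le (M N : Matrix n n ℂ) : frobSq (M * N) ≤ frobSq N * frobSq M := by
  rw [frobSq, frobSq.eq_def M, Finset.mul_sum]
  exact Finset.sum_le_sum fun r _ => vecNormSq_mul_row_le M N r

lemma expDiag_mul_row_normSq [DecidableEq n] (a : n → ℝ) (s : ℝ) (M : Matrix n n ℂ) (r : n) :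
    vecNormSq ((expDiag a s * M).row r) = Real.exp (s * (2 * a r)) * vecNormSq (M.row r) := by
  have h : (expDiag a s * M).row r = ((Real.exp (s * a r) : ℝ) : ℂ) • M.row r := by
    ext c
    simp [expDiag, diagonal_mul]
  rw [h, vecNormSq_smul, Complex.norm_real, Real.norm_eq_abs, abs_of_pos (Real.exp_pos _),
    ← Real.exp_nat_mul]
  congr 2
  push_cast
  ring

lemma continuous_frobSq : Continuous (frobSq : Matrix n n ℂ → ℝ) := by
  unfold frobSq
  exact continuous_finsetSum _ fun r _ => continuous_vecNormSq.comp
    (continuous_pi fun c => continuous_id.matrix_elem r c)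

lemma det_expDiag [DecidableEq n] (a : n → ℝ) (s : ℝ) :
    (expDiag a s).det = ((Real.exp (s * ∑ r, a r) : ℝ) : ℂ) := by
  rw [expDiag, det_diagonal, ← Complex.ofReal_prod, Finset.mul_sum, Real.exp_sum]

lemma norm_det_of_unitary [DecidableEq n] {U : Matrix n n ℂ} (hU : Uᴴ * U = 1) :
    ‖U.det‖ = 1 := by
  have h := congrArg (fun M => ‖det M‖) hU
  simp only [det_mul, det_conjTranspose, norm_mul, norm_star, det_one, norm_one] at h
  nlinarith [norm_nonneg U.det]

/-- A singular value decomposition of an invertible matrix, up to unitary conjugation. -/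
lemma exists_unitary_conj_eq_unitary_mul_expDiag [DecidableEq n] (M : Matrix n n ℂ)
    (hM : M.det ≠ 0) : ∃ (k U : Matrix n n ℂ) (a : n → ℝ), kᴴ * k = 1 ∧ Uᴴ * U = 1 ∧
      k * M = U * expDiag a 1 * k := by
  have hpd : (Mᴴ * M).PosDef := by
    apply Matrix.PosDef.conjTranspose_mul_self
    exact mulVec_injective_of_isUnit ((isUnit_iff_isUnit_det M).2 (isUnit_iff_ne_zero.2 hM))
  have hH := hpd.isHermitian
  set u : Matrix n n ℂ := (hH.eigenvectorUnitary : Matrix n n ℂ) with hu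
  have h1 : uᴴ * u = 1 := Unitary.coe_star_mul_self hH.eigenvectorUnitary
  have h2 : u * uᴴ = 1 := Unitary.coe_mul_star_self hH.eigenvectorUnitary
  set a : n → ℝ := fun r => Real.log (hH.eigenvalues r) / 2 with ha
  have hsp : Mᴴ * M = u * expDiag a 2 * uᴴ := by
    conv_lhs => rw [hH.spectral_theorem]
    rw [Unitary.conjStarAlgAut_apply]
    congr 3
    ext r
    simp only [Function.comp, ha]
    rw [mul_div_cancel₀ _ two_ne_zero, Real.exp_log (hpd.eigenvalues_pos r)]
    rfl
  have hD : expDiag a (-1) * expDiag a 1 = 1 := by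
    simp [expDiag, diagonal_mul_diagonal, ← Complex.exp_add]
  have hD2 : expDiag a (-1) * expDiag a 2 * expDiag a (-1) = 1 := by
    simp only [expDiag, diagonal_mul_diagonal, ← Complex.ofReal_mul, ← Real.exp_add]
    rw [← diagonal_one]
    congr 1
    ext r
    rw [show -1 * a r + 2 * a r + -1 * a r = 0 by ring]
    simp
  refine ⟨uᴴ, uᴴ * M * u * expDiag a (-1), a, by simpa using h2, ?_, ?_⟩
  · simp only [conjTranspose_mul, conjTranspose_conjTranspose, conjTranspose_expDiag]
    calc _ = expDiag a (-1) * (uᴴ * (Mᴴ * ((u * uᴴ) * M)) * u) * expDiag a (-1) := by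
          simp only [Matrix.mul_assoc]
      _ = expDiag a (-1) * ((uᴴ * u) * expDiag a 2 * (uᴴ * u)) * expDiag a (-1) := by
          rw [h2, Matrix.one_mul, hsp]
          simp only [Matrix.mul_assoc]
      _ = 1 := by rw [h1, Matrix.one_mul, Matrix.mul_one, hD2]
  · calc uᴴ * M = uᴴ * M * (u * uᴴ) := by rw [h2, Matrix.mul_one]
      _ = uᴴ * M * u * (expDiag a (-1) * expDiag a 1) * uᴴ := by
          rw [hD, Matrix.mul_one]
          simp only [Matrix.mul_assoc]
      _ = _ := by simp only [Matrix.mul_assoc]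

end Frobenius

lemma hasDerivAt_exp_sum {I : Type*} [Fintype I] (c z : I → ℝ) (s : ℝ) :
    HasDerivAt (fun s => ∑ i, Real.exp (s * c i) * z i)
      (∑ i, c i * Real.exp (s * c i) * z i) s := by
  refine HasDerivAt.fun_sum fun i _ => ?_
  have := (((hasDerivAt_id s).mul_const (c i)).exp).mul_const (z i)
  refine this.congr_deriv ?_
  simp only [id, one_mul]
  ring

/-- First order conditions for the sum of two exponential sums sharing one summand, at two
different times. -/
lemma exp_sum_stationarity {J K : Type*} [Fintype J] [Fintype K] (l U : J → ℝ) (b x y : K → ℝ)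
    (p : ℝ)
    (h0 : ∀ s : ℝ, ∑ j, U j + ∑ k, x k ≤
      ∑ j, Real.exp (s * l j) * U j + ∑ k, Real.exp (s * b k) * x k)
    (h1 : ∀ s : ℝ, p * ∑ j, Real.exp (l j) * U j + ∑ k, Real.exp (b k) * y k ≤
      p * ∑ j, Real.exp (s * l j) * U j + ∑ k, Real.exp (s * b k) * y k) :
    p * ∑ j, l j * (Real.exp (l j) - 1) * U j + ∑ k, b k * Real.exp (b k) * y k =
      p * ∑ k, b k * x k := by
  have e0 := IsLocalMin.hasDerivAt_eq_zero (f := fun s => ∑ j, Real.exp (s * l j) * U j +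
      ∑ k, Real.exp (s * b k) * x k) (a := 0)
    (Filter.Eventually.of_forall fun s => by simpa using h0 s) ((hasDerivAt_exp_sum l U 0).add (hasDerivAt_exp_sum b x 0))
  have e1 := IsLocalMin.hasDerivAt_eq_zero (f := fun s => p * ∑ j, Real.exp (s * l j) * U j +
      ∑ k, Real.exp (s * b k) * y k) (a := 1)
    (Filter.Eventually.of_forall fun s => by simpa using h1 s)
    (((hasDerivAt_exp_sum l U 1).const_mul p).add (hasDerivAt_exp_sum b y 1))
  simp only [zero_mul, one_mul, Real.exp_zero, mul_one] at e0 e1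
  simp only [mul_sub, sub_mul, Finset.sum_sub_distrib, mul_one]
  linear_combination e1 - p * e0

/-- A multiplicative, conjugation-compatible action of tuples of matrices on `ℂ^J` sending the
one-parameter diagonal tuples to one-parameter diagonal matrices, such as the tensor product. -/
structure TensorAction {ι : Type*} (n : ι → Type*) [∀ i, Fintype (n i)] [∀ i, DecidableEq (n i)]
    (J : Type*) [Fintype J] [DecidableEq J] where
  /-- The underlying monoid homomorphism. -/
  hom : (∀ i, Matrix (n i) (n i) ℂ) →* Matrix J J ℂ
  map_conjTranspose : ∀ g, hom (fun i => (g i)ᴴ) = (hom g)ᴴ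
  continuous_hom : Continuous hom
  map_expDiag : ∀ a : ∀ i, n i → ℝ, ∃ l : J → ℝ, ∀ s, hom (fun i => expDiag (a i) s) = expDiag l s

namespace TensorAction

variable {ι : Type*} [Fintype ι] {n : ι → Type*} [∀ i, Fintype (n i)] [∀ i, DecidableEq (n i)]
  {J : Type*} [Fintype J] [DecidableEq J] (τ : TensorAction n J) (t : J → ℂ)

/-- The squared norm of the translate of `t` by `g`, plus `ε` times the squared norm of `g`. -/
noncomputable def energy (ε : ℝ) (g : ∀ i, Matrix (n i) (n i) ℂ) : ℝ :=
  vecNormSq (τ.hom g *ᵥ t) + ε * ∑ i, frobSq (g i)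

/-- `g` minimizes the energy among tuples with determinants of absolute value one. -/
def IsEnergyMin (ε : ℝ) (g : ∀ i, Matrix (n i) (n i) ℂ) : Prop :=
  (∀ i, ‖(g i).det‖ = 1) ∧ ∀ h : ∀ i, Matrix (n i) (n i) ℂ, (∀ i, ‖(h i).det‖ = 1) →
    τ.energy t ε g ≤ τ.energy t ε h

variable {τ t}

omit [Fintype ι] in
lemma hom_unitary {U : ∀ i, Matrix (n i) (n i) ℂ} (hU : ∀ i, (U i)ᴴ * U i = 1) :
    (τ.hom U)ᴴ * τ.hom U = 1 := by
  rw [← τ.map_conjTranspose, ← map_mul, ← map_one τ.hom]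
  exact congrArg _ (funext hU)

lemma energy_unitary_mul {U : ∀ i, Matrix (n i) (n i) ℂ} (hU : ∀ i, (U i)ᴴ * U i = 1) (ε : ℝ)
    (g : ∀ i, Matrix (n i) (n i) ℂ) : τ.energy t ε (U * g) = τ.energy t ε g := by
  rw [energy, energy, map_mul, ← mulVec_mulVec, vecNormSq_unitary_mulVec (hom_unitary hU)]
  congr 2
  exact Finset.sum_congr rfl fun i _ => frobSq_unitary_mul (hU i) (g i)

omit [Fintype ι] in
lemma hom_inv_mulVec {γ : ∀ i, Matrix (n i) (n i) ℂ} (hγ : ∀ i, ‖(γ i).det‖ = 1) {c : ℂ}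
    (hc : c ≠ 0) (ht : τ.hom γ *ᵥ t = c • t) :
    τ.hom (fun i => (γ i)⁻¹) *ᵥ t = c⁻¹ • t := by
  have h : (fun i => (γ i)⁻¹) * γ = 1 := by
    funext i
    refine nonsing_inv_mul _ (isUnit_iff_ne_zero.2 fun h => ?_)
    simpa [h] using hγ i
  have h2 : τ.hom (fun i => (γ i)⁻¹) *ᵥ (c • t) = t := by
    rw [← ht, mulVec_mulVec, ← map_mul, h, map_one, one_mulVec]
  rw [mulVec_smul] at h2
  rw [eq_inv_smul_iff₀ hc, h2]

lemma energy_expDiag_mul {a : ∀ i, n i → ℝ} {l : J → ℝ}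
    (hl : ∀ s, τ.hom (fun i => expDiag (a i) s) = expDiag l s) (ε s : ℝ)
    (h : ∀ i, Matrix (n i) (n i) ℂ) :
    τ.energy t ε ((fun i => expDiag (a i) s) * h) =
      ∑ j, Real.exp (s * (2 * l j)) * ‖(τ.hom h *ᵥ t) j‖ ^ 2 +
      ∑ k : Σ i, n i, Real.exp (s * (2 * a k.1 k.2)) * (ε * vecNormSq ((h k.1).row k.2)) := by
  rw [energy, map_mul, ← mulVec_mulVec, hl, vecNormSq_expDiag_mulVec, Fintype.sum_sigma,
    Finset.mul_sum]
  congr 1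
  refine Finset.sum_congr rfl fun i _ => ?_
  rw [frobSq, Finset.mul_sum]
  refine Finset.sum_congr rfl fun r _ => ?_
  rw [Pi.mul_apply, expDiag_mul_row_normSq]
  ring

/-- Comparing an energy minimizer `g` with its translate `g * γ`, after diagonalizing their
relative position. -/
lemma IsEnergyMin.exists_normal_form {ε : ℝ} {g : ∀ i, Matrix (n i) (n i) ℂ}
    (hg : τ.IsEnergyMin t ε g) {γ : ∀ i, Matrix (n i) (n i) ℂ} (hγ : ∀ i, ‖(γ i).det‖ = 1)
    {c : ℂ} (hc : c ≠ 0) (ht : τ.hom γ *ᵥ t = c • t) :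
    ∃ (k U : ∀ i, Matrix (n i) (n i) ℂ) (a : ∀ i, n i → ℝ) (l : J → ℝ),
      (∀ i, (k i)ᴴ * k i = 1) ∧ (∀ i, (U i)ᴴ * U i = 1) ∧
      (∀ i, k i * g i * γ i = U i * (expDiag (a i) 1 * (k i * g i))) ∧
      τ.hom (fun i => expDiag (a i) 1) = expDiag l 1 ∧
      (‖c‖ ^ 2)⁻¹ * ∑ j, 2 * l j * (Real.exp (2 * l j) - 1) * ‖(τ.hom (k * g) *ᵥ t) j‖ ^ 2 +
        ∑ x : Σ i, n i, 2 * a x.1 x.2 * Real.exp (2 * a x.1 x.2) *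
          (ε * vecNormSq ((k x.1 * g x.1 * (γ x.1)⁻¹).row x.2)) =
        (‖c‖ ^ 2)⁻¹ * ∑ x : Σ i, n i, 2 * a x.1 x.2 *
          (ε * vecNormSq ((k x.1 * g x.1).row x.2)) := by
  have hne : ∀ {g : ∀ i, Matrix (n i) (n i) ℂ}, (∀ i, ‖(g i).det‖ = 1) → ∀ i, IsUnit (g i).det := by
    intro g hg i
    refine isUnit_iff_ne_zero.2 fun h => ?_
    simpa [h] using hg i
  have hdet := hg.1
  have hinv : ∀ {g : ∀ i, Matrix (n i) (n i) ℂ}, (∀ i, ‖(g i).det‖ = 1) →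
      ∀ i, ‖((g i)⁻¹).det‖ = 1 := by
    intro g hg i
    rw [det_nonsing_inv, Ring.inverse_eq_inv', norm_inv, hg i, inv_one]
  have hM : ∀ i, ‖(g i * γ i * (g i)⁻¹).det‖ = 1 := fun i => by
    rw [det_mul, det_mul, norm_mul, norm_mul, hdet, hγ, hinv hdet, one_mul, one_mul]
  choose k U a hk hU hkU using fun i =>
    exists_unitary_conj_eq_unitary_mul_expDiag (g i * γ i * (g i)⁻¹) (hne hM i).ne_zero
  obtain ⟨l, hl⟩ := τ.map_expDiag a
  have hrel : ∀ i, k i * g i * γ i = U i * (expDiag (a i) 1 * (k i * g i)) := fun i => by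
    have h := congrArg (· * g i) (hkU i)
    simp only [Matrix.mul_assoc, nonsing_inv_mul _ (hne hdet i), Matrix.mul_one] at h
    simpa only [Matrix.mul_assoc] using h
  have hdet_exp : ∀ i s, ‖(expDiag (a i) s).det‖ = 1 := fun i s => by
    have h := congrArg (fun M => ‖det M‖) (hkU i)
    simp only [det_mul (k i), det_mul _ (k i), det_mul (U i), norm_mul, hM,
      norm_det_of_unitary (hk i), norm_det_of_unitary (hU i), one_mul, mul_one] at h
    rw [det_expDiag, Complex.norm_real, Real.norm_eq_abs, Real.abs_exp, one_mul, eq_comm,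
      Real.exp_eq_one_iff] at h
    rw [det_expDiag, h]
    simp
  have hkg : ∀ i, ‖((k * g) i).det‖ = 1 := fun i => by
    rw [Pi.mul_apply, det_mul, norm_mul, norm_det_of_unitary (hk i), hdet, one_mul]
  have hmin : ∀ h : ∀ i, Matrix (n i) (n i) ℂ, (∀ i, ‖(h i).det‖ = 1) →
      τ.energy t ε (k * g) ≤ τ.energy t ε h := fun h hh =>
    (energy_unitary_mul hk ε g).trans_le (hg.2 h hh)
  refine ⟨k, U, a, l, hk, hU, hrel, hl 1, ?_⟩
  have henergy : ∀ s, τ.energy t ε ((fun i => expDiag (a i) s) * (k * g * fun i => (γ i)⁻¹)) =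
      (‖c‖ ^ 2)⁻¹ * ∑ j, Real.exp (s * (2 * l j)) * ‖(τ.hom (k * g) *ᵥ t) j‖ ^ 2 +
      ∑ x : Σ i, n i, Real.exp (s * (2 * a x.1 x.2)) *
        (ε * vecNormSq ((k x.1 * g x.1 * (γ x.1)⁻¹).row x.2)) := fun s => by
    rw [energy_expDiag_mul hl, map_mul τ.hom (k * g), ← mulVec_mulVec, hom_inv_mulVec hγ hc ht,
      mulVec_smul, Finset.mul_sum]
    congr 1
    refine Finset.sum_congr rfl fun j _ => ?_
    rw [Pi.smul_apply, norm_smul, mul_pow, norm_inv, inv_pow]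
    ring
  refine exp_sum_stationarity (fun j => 2 * l j) _ (fun x : Σ i, n i => 2 * a x.1 x.2) _ _ _ ?_ ?_
  · intro s
    have h := hmin ((fun i => expDiag (a i) s) * (k * g)) fun i => by
      rw [Pi.mul_apply, det_mul, norm_mul, hdet_exp, hkg, one_mul]
    have h0 : (k * g) = (fun i => expDiag (a i) 0) * (k * g) := by
      funext i
      simp [expDiag_zero]
    nth_rewrite 1 [h0] at h
    rw [energy_expDiag_mul hl, energy_expDiag_mul hl] at h
    simpa using h
  · intro s
    have h := hmin ((fun i => expDiag (a i) s) * (k * g * fun i => (γ i)⁻¹)) fun i => by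
      rw [Pi.mul_apply, Pi.mul_apply (k * g), det_mul, det_mul, norm_mul, norm_mul, hdet_exp, hkg,
        hinv hγ, one_mul, one_mul]
    have h1 : U * ((fun i => expDiag (a i) 1) * (k * g * fun i => (γ i)⁻¹)) = k * g := by
      funext i
      have h := congrArg (· * (γ i)⁻¹) (hrel i)
      simp only [Matrix.mul_assoc, mul_nonsing_inv _ (hne hγ i), Matrix.mul_one] at h
      simp only [Pi.mul_apply, Matrix.mul_assoc]
      exact h.symm
    nth_rewrite 1 [← h1] at h
    rw [energy_unitary_mul hU, henergy, henergy] at h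
    simpa using h

end TensorAction

lemma mul_exp_mul_le_of_sum_le {K : Type*} [Fintype K] {b x y : K → ℝ} {p : ℝ} (hp : 0 ≤ p)
    (hx : ∀ k, 0 ≤ x k) (hy : ∀ k, 0 ≤ y k)
    (h : ∑ k, b k * Real.exp (b k) * y k ≤ p * ∑ k, b k * x k) (k : K) :
    b k * Real.exp (b k) * y k ≤ p * ∑ k, Real.exp (b k) * x k + ∑ k, y k := by
  have h1 : ∀ k, 0 ≤ b k * Real.exp (b k) * y k + y k := fun k => by
    have e : (-b k) * Real.exp (b k) ≤ 1 := by
      calc (-b k) * Real.exp (b k) ≤ Real.exp (-b k) * Real.exp (b k) := by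
            gcongr
            linarith [Real.add_one_le_exp (-b k)]
        _ = 1 := by rw [← Real.exp_add]; simp
    nlinarith [hy k]
  have h2 := Finset.single_le_sum (fun k _ => h1 k) (Finset.mem_univ k)
  have h3 : p * ∑ k, b k * x k ≤ p * ∑ k, Real.exp (b k) * x k := by
    gcongr with k
    · exact hx k
    · linarith [Real.add_one_le_exp (b k)]
  rw [Finset.sum_add_distrib] at h2
  linarith [hy k]

namespace TensorAction

variable {ι : Type*} [Fintype ι] {n : ι → Type*} [∀ i, Fintype (n i)] [∀ i, DecidableEq (n i)]
  {J : Type*} [Fintype J] [DecidableEq J] {τ : TensorAction n J} {t : J → ℂ}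

/-- Translating a minimizer of the penalized energy by an element fixing the line of `t` distorts
small vectors in a controlled way. -/
lemma exists_vecNormSq_mul_mulVec_le {γ : ∀ i, Matrix (n i) (n i) ℂ} (hγ : ∀ i, ‖(γ i).det‖ = 1)
    {c : ℂ} (hc : c ≠ 0) (ht : τ.hom γ *ᵥ t = c • t) (i : ι) :
    ∃ C : ℝ, ∀ ε > 0, ∀ g, τ.IsEnergyMin t ε g → ∀ v : n i → ℂ, ∀ L > 0,
      vecNormSq ((g i * γ i) *ᵥ v) ≤ Real.exp L * vecNormSq (g i *ᵥ v) +
        C / L * (∑ i, frobSq (g i)) * vecNormSq v := by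
  set p : ℝ := (‖c‖ ^ 2)⁻¹ with hp
  set A : ℝ := ∑ i, frobSq (γ i) with hA
  set B : ℝ := ∑ i, frobSq (γ i)⁻¹ with hB
  have hA0 : 0 ≤ A := Finset.sum_nonneg fun _ _ => frobSq_nonneg _
  have hAi : ∀ i, frobSq (γ i) ≤ A := fun i =>
    Finset.single_le_sum (f := fun i => frobSq (γ i)) (fun _ _ => frobSq_nonneg _)
      (Finset.mem_univ i)
  have hBi : ∀ i, frobSq (γ i)⁻¹ ≤ B := fun i =>
    Finset.single_le_sum (f := fun i => frobSq (γ i)⁻¹) (fun _ _ => frobSq_nonneg _)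
      (Finset.mem_univ i)
  refine ⟨Fintype.card (n i) * (A * (p * A + B)), fun ε hε g hg v L hL => ?_⟩
  obtain ⟨k, U, a, l, hk, hU, hrel, -, hstat⟩ := hg.exists_normal_form hγ hc ht
  rw [← hp] at hstat
  have hp0 : 0 < p := by positivity
  set R : ℝ := ∑ i, frobSq (g i) with hR
  have hR0 : 0 ≤ R := Finset.sum_nonneg fun _ _ => frobSq_nonneg _
  set x : (Σ i, n i) → ℝ := fun s => vecNormSq ((k s.1 * g s.1).row s.2) with hx
  set y : (Σ i, n i) → ℝ := fun s => vecNormSq ((k s.1 * g s.1 * (γ s.1)⁻¹).row s.2) with hy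
  set b : (Σ i, n i) → ℝ := fun s => 2 * a s.1 s.2 with hb
  have hRk : ∑ i, frobSq (k i * g i) = R :=
    Finset.sum_congr rfl fun i _ => frobSq_unitary_mul (hk i) _
  have hysum : ∑ s, y s ≤ B * R := by
    calc ∑ s, y s = ∑ i, frobSq (k i * g i * (γ i)⁻¹) := Fintype.sum_sigma _
      _ ≤ ∑ i, B * frobSq (k i * g i) := Finset.sum_le_sum fun i _ =>
        (frobSq_mul_le _ _).trans (mul_le_mul_of_nonneg_right (hBi i) (frobSq_nonneg _))
      _ = B * R := by rw [← Finset.mul_sum, hRk]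
  have hxsum : ∑ s, Real.exp (b s) * x s ≤ A * R := by
    rw [Fintype.sum_sigma, ← hRk, Finset.mul_sum]
    refine Finset.sum_le_sum fun i _ => ?_
    calc ∑ r, Real.exp (b ⟨i, r⟩) * x ⟨i, r⟩ = frobSq (expDiag (a i) 1 * (k i * g i)) := by
          refine Finset.sum_congr rfl fun r _ => ?_
          rw [expDiag_mul_row_normSq, one_mul]
      _ = frobSq (k i * g i * γ i) := by rw [hrel, frobSq_unitary_mul (hU i)]
      _ ≤ _ := (frobSq_mul_le _ _).trans (mul_le_mul_of_nonneg_right (hAi i) (frobSq_nonneg _))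
  have hxy : ∀ s, x s ≤ A * y s := fun s => by
    have h : k s.1 * g s.1 = k s.1 * g s.1 * (γ s.1)⁻¹ * γ s.1 := by
      rw [Matrix.mul_assoc _ (γ s.1)⁻¹, nonsing_inv_mul, Matrix.mul_one]
      refine isUnit_iff_ne_zero.2 fun h => ?_
      simpa [h] using hγ s.1
    have := vecNormSq_mul_row_le (k s.1 * g s.1 * (γ s.1)⁻¹) (γ s.1) s.2
    rw [← h] at this
    exact this.trans (mul_le_mul_of_nonneg_right (hAi _) (vecNormSq_nonneg _))
  have hkey : ∑ s, b s * Real.exp (b s) * y s ≤ p * ∑ s, b s * x s := by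
    have h0 : 0 ≤ p * ∑ j, 2 * l j * (Real.exp (2 * l j) - 1) *
        ‖(τ.hom (k * g) *ᵥ t) j‖ ^ 2 := by
      refine mul_nonneg hp0.le (Finset.sum_nonneg fun j _ => mul_nonneg ?_ (by positivity))
      rcases le_total 0 (2 * l j) with h | h
      · exact mul_nonneg h (sub_nonneg.2 (Real.one_le_exp h))
      · exact mul_nonneg_of_nonpos_of_nonpos h (sub_nonpos.2 (Real.exp_le_one_iff.2 h))
    have h1 : ε * ∑ s, b s * Real.exp (b s) * y s ≤ ε * (p * ∑ s, b s * x s) := by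
      calc _ = ∑ s, b s * Real.exp (b s) * (ε * y s) := by
            rw [Finset.mul_sum]
            exact Finset.sum_congr rfl fun s _ => by ring
        _ ≤ p * ∑ s, b s * (ε * x s) := by linarith
        _ = _ := by
            simp only [Finset.mul_sum]
            exact Finset.sum_congr rfl fun s _ => by ring
    exact le_of_mul_le_mul_left h1 hε
  have hbxy := mul_exp_mul_le_of_sum_le hp0.le (fun s => vecNormSq_nonneg _)
    (fun s => vecNormSq_nonneg _) hkey
  have hterm : ∀ s, 0 ≤ b s → b s * Real.exp (b s) * x s ≤ A * (p * A + B) * R := fun s hs => by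
    calc b s * Real.exp (b s) * x s ≤ b s * Real.exp (b s) * (A * y s) := by
          gcongr
          exact hxy s
      _ = A * (b s * Real.exp (b s) * y s) := by ring
      _ ≤ A * (p * (A * R) + B * R) := by
          gcongr
          exact (hbxy s).trans (by gcongr)
      _ = _ := by ring
  have hrow : ∀ r, Real.exp (b ⟨i, r⟩) * ‖((k i * g i) *ᵥ v) r‖ ^ 2 ≤
      Real.exp L * ‖((k i * g i) *ᵥ v) r‖ ^ 2 + A * (p * A + B) * R / L * vecNormSq v := by
    intro r
    have hB0 : 0 ≤ B := Finset.sum_nonneg fun _ _ => frobSq_nonneg _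
    have hv := vecNormSq_nonneg v
    rcases le_or_gt (b ⟨i, r⟩) L with h | h
    · have : Real.exp (b ⟨i, r⟩) * ‖((k i * g i) *ᵥ v) r‖ ^ 2 ≤
          Real.exp L * ‖((k i * g i) *ᵥ v) r‖ ^ 2 := by gcongr
      have : 0 ≤ A * (p * A + B) * R / L * vecNormSq v := by positivity
      linarith
    · have h1 : Real.exp (b ⟨i, r⟩) * x ⟨i, r⟩ ≤ A * (p * A + B) * R / L := by
        rw [le_div_iff₀ hL]
        have hx0 : 0 ≤ x ⟨i, r⟩ := vecNormSq_nonneg _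
        calc Real.exp (b ⟨i, r⟩) * x ⟨i, r⟩ * L ≤
            Real.exp (b ⟨i, r⟩) * x ⟨i, r⟩ * b ⟨i, r⟩ := by gcongr
          _ = b ⟨i, r⟩ * Real.exp (b ⟨i, r⟩) * x ⟨i, r⟩ := by ring
          _ ≤ _ := hterm _ (hL.trans h).le
      have h2 : ‖((k i * g i) *ᵥ v) r‖ ^ 2 ≤ x ⟨i, r⟩ * vecNormSq v := norm_dotProduct_sq_le _ _
      calc Real.exp (b ⟨i, r⟩) * ‖((k i * g i) *ᵥ v) r‖ ^ 2 ≤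
          Real.exp (b ⟨i, r⟩) * (x ⟨i, r⟩ * vecNormSq v) := by gcongr
        _ = Real.exp (b ⟨i, r⟩) * x ⟨i, r⟩ * vecNormSq v := by ring
        _ ≤ A * (p * A + B) * R / L * vecNormSq v := by gcongr
        _ ≤ _ := le_add_of_nonneg_left (by positivity)
  calc vecNormSq ((g i * γ i) *ᵥ v) = vecNormSq ((k i * g i * γ i) *ᵥ v) := by
        rw [Matrix.mul_assoc, ← mulVec_mulVec v (k i), vecNormSq_unitary_mulVec (hk i)]
    _ = vecNormSq (expDiag (a i) 1 *ᵥ ((k i * g i) *ᵥ v)) := by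
        rw [hrel, ← mulVec_mulVec, vecNormSq_unitary_mulVec (hU i), ← mulVec_mulVec]
    _ = ∑ r, Real.exp (b ⟨i, r⟩) * ‖((k i * g i) *ᵥ v) r‖ ^ 2 := by
        simp only [vecNormSq_expDiag_mulVec, one_mul, hb]
    _ ≤ _ := Finset.sum_le_sum fun r _ => hrow r
    _ = Real.exp L * vecNormSq ((k i * g i) *ᵥ v) +
        Fintype.card (n i) * (A * (p * A + B)) / L * R * vecNormSq v := by
        rw [Finset.sum_add_distrib, ← Finset.mul_sum, Finset.sum_const, Finset.card_univ,
          nsmul_eq_mul, vecNormSq.eq_def ((k i * g i) *ᵥ v)]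
        ring
    _ = _ := by rw [← mulVec_mulVec, vecNormSq_unitary_mulVec (hk i)]

/-- At a minimizer of the unpenalized energy, the moment-type vector `gᴴ g t` is semi-invariant
under adjoints. -/
lemma IsEnergyMin.conjTranspose_mulVec {g : ∀ i, Matrix (n i) (n i) ℂ}
    (hg : τ.IsEnergyMin t 0 g) {γ : ∀ i, Matrix (n i) (n i) ℂ} (hγ : ∀ i, ‖(γ i).det‖ = 1)
    {c : ℂ} (hc : c ≠ 0) (ht : τ.hom γ *ᵥ t = c • t) :
    (τ.hom γ)ᴴ *ᵥ ((τ.hom g)ᴴ *ᵥ (τ.hom g *ᵥ t)) =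
      c⁻¹ • ((τ.hom g)ᴴ *ᵥ (τ.hom g *ᵥ t)) := by
  obtain ⟨k, U, a, l, hk, hU, hrel, hl, hstat⟩ := hg.exists_normal_form hγ hc ht
  set u := τ.hom (k * g) *ᵥ t with hu
  simp only [zero_mul, mul_zero, Finset.sum_const_zero, add_zero] at hstat
  have hsum := (mul_eq_zero.1 hstat).resolve_left (by positivity)
  have hfix : expDiag l 1 *ᵥ u = u := by
    have hnn : ∀ j ∈ Finset.univ, 0 ≤ 2 * l j * (Real.exp (2 * l j) - 1) * ‖u j‖ ^ 2 := by
      refine fun j _ => mul_nonneg ?_ (by positivity)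
      rcases le_total 0 (2 * l j) with h | h
      · exact mul_nonneg h (sub_nonneg.2 (Real.one_le_exp h))
      · exact mul_nonneg_of_nonpos_of_nonpos h (sub_nonpos.2 (Real.exp_le_one_iff.2 h))
    rw [Finset.sum_eq_zero_iff_of_nonneg hnn] at hsum
    ext j
    rw [expDiag, mulVec_diagonal]
    have h := hsum j (Finset.mem_univ j)
    rcases mul_eq_zero.1 h with h | h
    · have : l j = 0 := by
        rcases mul_eq_zero.1 h with h | h
        · linarith
        · have := (Real.exp_eq_one_iff _).1 (sub_eq_zero.1 h)
          linarith
      simp [this]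
    · have : u j = 0 := by simpa using h
      simp [this]
  have hkk : (τ.hom g)ᴴ *ᵥ (τ.hom g *ᵥ t) = (τ.hom (k * g))ᴴ *ᵥ u := by
    rw [hu, map_mul, conjTranspose_mul, mulVec_mulVec, mulVec_mulVec, Matrix.mul_assoc,
      ← Matrix.mul_assoc (τ.hom k)ᴴ, hom_unitary hk, Matrix.one_mul]
  have hrel' : τ.hom (k * g) * τ.hom γ = τ.hom U * (expDiag l 1 * τ.hom (k * g)) := by
    rw [← hl, ← map_mul, ← map_mul, ← map_mul]
    exact congrArg _ (funext hrel)
  have hUu : τ.hom U *ᵥ u = c • u := by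
    have h := congrArg (· *ᵥ t) hrel'
    simp only [← mulVec_mulVec, ht, mulVec_smul] at h
    rw [← hu, hfix] at h
    exact h.symm
  have hUu' : (τ.hom U)ᴴ *ᵥ u = c⁻¹ • u := by
    rw [eq_inv_smul_iff₀ hc, ← mulVec_smul, ← hUu, mulVec_mulVec, hom_unitary hU, one_mulVec]
  rw [hkk, mulVec_mulVec, ← conjTranspose_mul, hrel', conjTranspose_mul, conjTranspose_mul,
    conjTranspose_expDiag, ← mulVec_mulVec, ← mulVec_mulVec, hUu', mulVec_smul, mulVec_smul, hfix]

end TensorAction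

namespace TensorAction

section Compactness

variable {ι : Type*} [Fintype ι] {n : ι → Type*} [∀ i, Fintype (n i)]

lemma continuous_sum_frobSq :
    Continuous fun g : ∀ i, Matrix (n i) (n i) ℂ => ∑ i, frobSq (g i) :=
  continuous_finsetSum _ fun i _ => continuous_frobSq.comp (continuous_apply i)

lemma isCompact_sum_frobSq_le (C : ℝ) :
    IsCompact {g : ∀ i, Matrix (n i) (n i) ℂ | ∑ i, frobSq (g i) ≤ C} := by
  have hbox : IsCompact (Set.univ.pi fun i => Set.univ.pi fun _ : n i => Set.univ.pi
      fun _ : n i => Metric.closedBall (0 : ℂ) (1 + C)) :=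
    isCompact_univ_pi fun i => isCompact_univ_pi fun _ => isCompact_univ_pi fun _ =>
      isCompact_closedBall _ _
  refine hbox.of_isClosed_subset (isClosed_le continuous_sum_frobSq continuous_const) ?_
  intro g hg i _ r _ c _
  have h : ‖g i r c‖ ^ 2 ≤ C :=
    ((norm_sq_le_vecNormSq (Matrix.row (g i) r) c).trans (vecNormSq_row_le_frobSq (g i) r)).trans
      ((Finset.single_le_sum (f := fun i => frobSq (g i)) (fun _ _ => frobSq_nonneg _)
        (Finset.mem_univ i)).trans hg)
  rw [mem_closedBall_zero_iff]
  nlinarith [sq_nonneg (‖g i r c‖ - 1)]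

/-- Tuples that are bounded along an ultrafilter converge along it. -/
lemma exists_tendsto_of_sum_frobSq_le {X : Type*} {𝒰 : Ultrafilter X}
    {g : X → ∀ i, Matrix (n i) (n i) ℂ} {C : ℝ} (h : ∀ᶠ m in 𝒰, ∑ i, frobSq (g m i) ≤ C) :
    ∃ q, Tendsto g 𝒰 (𝓝 q) := by
  obtain ⟨q, -, hq⟩ := (isCompact_sum_frobSq_le C).ultrafilter_le_nhds (𝒰.map g)
    (le_principal_iff.2 h)
  exact ⟨q, hq⟩

end Compactness

variable {ι : Type*} [Fintype ι] {n : ι → Type*} [∀ i, Fintype (n i)] [∀ i, DecidableEq (n i)]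
  {J : Type*} [Fintype J] [DecidableEq J] {τ : TensorAction n J} {t : J → ℂ}

variable (τ t) in
lemma continuous_energy (ε : ℝ) : Continuous (τ.energy t ε) := by
  refine (continuous_vecNormSq.comp ?_).add (continuous_const.mul continuous_sum_frobSq)
  exact τ.continuous_hom.matrix_mulVec continuous_const

variable (τ t) in
lemma exists_isEnergyMin {ε : ℝ} (hε : 0 < ε) : ∃ g, τ.IsEnergyMin t ε g := by
  have hK : IsCompact ({g : ∀ i, Matrix (n i) (n i) ℂ | ∑ i, frobSq (g i) ≤ τ.energy t ε 1 / ε} ∩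
      {g | ∀ i, ‖(g i).det‖ = 1}) := by
    refine (isCompact_sum_frobSq_le _).inter_right ?_
    simp only [Set.ofPred_forall]
    exact isClosed_iInter fun i =>
      isClosed_eq ((continuous_apply i).matrix_det.norm) continuous_const
  have hle : ∀ g, ε * ∑ i, frobSq (g i) ≤ τ.energy t ε g := fun g =>
    le_add_of_nonneg_left (vecNormSq_nonneg _)
  have h1 : (1 : ∀ i, Matrix (n i) (n i) ℂ) ∈
      ({g : ∀ i, Matrix (n i) (n i) ℂ | ∑ i, frobSq (g i) ≤ τ.energy t ε 1 / ε} ∩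
      {g | ∀ i, ‖(g i).det‖ = 1}) := by
    refine ⟨?_, fun i => by simp⟩
    rw [Set.mem_ofPred_eq, le_div_iff₀' hε]
    exact hle 1
  obtain ⟨g, hg, hmin⟩ := hK.exists_isMinOn ⟨1, h1⟩ (continuous_energy τ t ε).continuousOn
  refine ⟨g, hg.2, fun h hh => ?_⟩
  by_cases hR : ∑ i, frobSq (h i) ≤ τ.energy t ε 1 / ε
  · exact hmin ⟨hR, hh⟩
  · rw [le_div_iff₀' hε, not_le] at hR
    exact (hmin h1).trans (hR.le.trans (hle h))

/-- If the penalized minimizers stay bounded, the unpenalized energy has a minimizer. -/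
lemma exists_isEnergyMin_zero_of_bounded {X : Type*} {𝒰 : Ultrafilter X} {ε : X → ℝ}
    (hε : Tendsto ε 𝒰 (𝓝 0)) (hpos : ∀ m, 0 < ε m) {g : X → ∀ i, Matrix (n i) (n i) ℂ}
    (hg : ∀ m, τ.IsEnergyMin t (ε m) (g m)) {C : ℝ}
    (h : ∀ᶠ m in 𝒰, ∑ i, frobSq (g m i) ≤ C) : ∃ q, τ.IsEnergyMin t 0 q := by
  obtain ⟨q, hq⟩ := exists_tendsto_of_sum_frobSq_le h
  refine ⟨q, fun i => ?_, fun x hx => ?_⟩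
  · have hd : Continuous fun g : ∀ i, Matrix (n i) (n i) ℂ => ‖(g i).det‖ :=
      (continuous_apply i).matrix_det.norm
    refine tendsto_nhds_unique ((hd.tendsto q).comp hq) ?_
    exact tendsto_const_nhds.congr fun m => ((hg m).1 i).symm
  · have h2 : Tendsto (fun m => τ.energy t 0 x + ε m * ∑ i, frobSq (x i)) 𝒰
        (𝓝 (τ.energy t 0 x + 0 * ∑ i, frobSq (x i))) :=
      tendsto_const_nhds.add (hε.mul_const _)
    rw [zero_mul, add_zero] at h2
    refine le_of_tendsto_of_tendsto' (((continuous_energy τ t 0).tendsto q).comp hq) h2 fun m => ?_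
    have h3 := (hg m).2 x hx
    have h4 : 0 ≤ ε m * ∑ i, frobSq (g m i) :=
      mul_nonneg (hpos m).le (Finset.sum_nonneg fun _ _ => frobSq_nonneg _)
    simp only [energy, Function.comp_apply] at h3 ⊢
    linarith

/-- If the penalized minimizers are unbounded, one of the tensor factors has a proper nonzero
subspace invariant under the stabilizer of the line of `t`. -/
lemma exists_invariant_submodule_of_unbounded {Γ X : Type*} {γ : Γ → ∀ i, Matrix (n i) (n i) ℂ}
    (hγ : ∀ x i, ‖(γ x i).det‖ = 1) {c : Γ → ℂ} (hc : ∀ x, c x ≠ 0)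
    (ht : ∀ x, τ.hom (γ x) *ᵥ t = c x • t) {𝒰 : Ultrafilter X} {ε : X → ℝ}
    (hpos : ∀ m, 0 < ε m) {g : X → ∀ i, Matrix (n i) (n i) ℂ}
    (hg : ∀ m, τ.IsEnergyMin t (ε m) (g m))
    (h : Tendsto (fun m => ∑ i, frobSq (g m i)) 𝒰 atTop) :
    ∃ (i : ι) (U : Submodule ℂ (n i → ℂ)), (∀ x, ∀ v ∈ U, γ x i *ᵥ v ∈ U) ∧ U ≠ ⊥ ∧ U ≠ ⊤ := by
  set R : X → ℝ := fun m => ∑ i, frobSq (g m i) with hR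
  have hRpos : ∀ᶠ m in 𝒰, 0 < R m := h.eventually_gt_atTop 0
  set s : X → ℝ := fun m => (√(R m))⁻¹ with hs
  have hs0 : Tendsto s 𝒰 (𝓝 0) := (Real.tendsto_sqrt_atTop.comp h).inv_tendsto_atTop
  have hsR : ∀ᶠ m in 𝒰, ‖(s m : ℂ)‖ ^ 2 * R m = 1 := hRpos.mono fun m hm => by
    rw [Complex.norm_real, Real.norm_eq_abs, sq_abs, inv_pow, Real.sq_sqrt hm.le,
      inv_mul_cancel₀ hm.ne']
  have hsum : ∀ᶠ m in 𝒰, ∑ i, frobSq (((s m : ℂ) • g m) i) = 1 := hsR.mono fun m hm => by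
    simp only [Pi.smul_apply, frobSq_smul, ← Finset.mul_sum]
    exact hm
  obtain ⟨q, hq⟩ := exists_tendsto_of_sum_frobSq_le (hsum.mono fun m hm => hm.le)
  have hqsum : ∑ i, frobSq (q i) = 1 :=
    tendsto_nhds_unique ((continuous_sum_frobSq.tendsto q).comp hq)
      (tendsto_const_nhds.congr' (hsum.mono fun m hm => hm.symm))
  obtain ⟨i, -, hi⟩ := Finset.exists_ne_zero_of_sum_ne_zero (hqsum.trans_ne one_ne_zero)
  have hqi : q i ≠ 0 := fun h0 => hi (frobSq_eq_zero.2 h0)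
  have hqt : Tendsto (fun m => (s m : ℂ) • g m i) 𝒰 (𝓝 (q i)) :=
    ((continuous_apply i).tendsto q).comp hq
  have hne : Nonempty (n i) := by
    by_contra hemp
    rw [not_nonempty_iff] at hemp
    exact hqi (Subsingleton.elim _ _)
  have hdet : (q i).det = 0 := by
    rw [← norm_eq_zero]
    refine tendsto_nhds_unique (((continuous_id.matrix_det.norm).tendsto (q i)).comp hqt) ?_
    have h1 := (hs0.norm.pow (Fintype.card (n i)))
    rw [norm_zero, zero_pow Fintype.card_ne_zero] at h1
    refine h1.congr fun m => ?_
    simp [(hg m).1 i]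
  refine ⟨i, LinearMap.ker (q i).mulVecLin, fun x v hv => ?_, fun hbot => ?_, fun htop => ?_⟩
  · rw [LinearMap.mem_ker, mulVecLin_apply] at hv ⊢
    obtain ⟨C, hC⟩ := exists_vecNormSq_mul_mulVec_le (hγ x) (hc x) (ht x) i
    have hlim : ∀ L > 0, vecNormSq (q i *ᵥ (γ x i *ᵥ v)) ≤ C / L * vecNormSq v := fun L hL => by
      have hcont : ∀ w : n i → ℂ, Tendsto (fun m => vecNormSq (((s m : ℂ) • g m i) *ᵥ w)) 𝒰
          (𝓝 (vecNormSq (q i *ᵥ w))) := fun w =>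
        ((continuous_vecNormSq.comp (continuous_id.matrix_mulVec continuous_const)).tendsto
          (q i)).comp hqt
      have h2 := ((hcont v).const_mul (Real.exp L)).add_const (C / L * vecNormSq v)
      rw [hv, vecNormSq_eq_zero.2 rfl, mul_zero, zero_add] at h2
      refine le_of_tendsto_of_tendsto (hcont _) h2 (hsR.mono fun m hm => ?_)
      have h3 := mul_le_mul_of_nonneg_left (hC (ε m) (hpos m) (g m) (hg m) v L hL)
        (sq_nonneg ‖(s m : ℂ)‖)
      beta_reduce
      rw [mulVec_mulVec, smul_mul_assoc, smul_mulVec, smul_mulVec, vecNormSq_smul, vecNormSq_smul]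
      refine h3.trans_eq ?_
      linear_combination (C / L * vecNormSq v) * hm
    have h0 : Tendsto (fun L : ℝ => C / L * vecNormSq v) atTop (𝓝 (0 * vecNormSq v)) :=
      (tendsto_const_nhds.div_atTop tendsto_id).mul_const _
    rw [zero_mul] at h0
    refine vecNormSq_eq_zero.1 (le_antisymm ?_ (vecNormSq_nonneg _))
    exact ge_of_tendsto h0 ((eventually_gt_atTop 0).mono hlim)
  · obtain ⟨v, hv, hv0⟩ := exists_mulVec_eq_zero_iff.2 hdet
    exact hv ((Submodule.eq_bot_iff _).1 hbot v hv0)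
  · apply hqi
    rw [LinearMap.ker_eq_top] at htop
    exact ext_of_mulVec_single fun j =>
      (LinearMap.congr_fun htop (Pi.single j 1)).trans (zero_mulVec _).symm

variable (τ) in
/-- A nonzero vector spanning a line stable under a set of tuples, each of whose components acts
irreducibly, pairs nontrivially with an adjoint-semi-invariant vector. -/
theorem exists_dual_semiinvariant {Γ : Type*} {γ : Γ → ∀ i, Matrix (n i) (n i) ℂ}
    (hγ : ∀ x i, ‖(γ x i).det‖ = 1)
    (hirr : ∀ i, ∀ U : Submodule ℂ (n i → ℂ), (∀ x, ∀ v ∈ U, γ x i *ᵥ v ∈ U) → U = ⊥ ∨ U = ⊤)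
    {c : Γ → ℂ} (hc : ∀ x, c x ≠ 0) (ht0 : t ≠ 0) (ht : ∀ x, τ.hom (γ x) *ᵥ t = c x • t) :
    ∃ s : J → ℂ, star t ⬝ᵥ s ≠ 0 ∧ ∀ x, (τ.hom (γ x))ᴴ *ᵥ s = (c x)⁻¹ • s := by
  have hpos : ∀ m : ℕ, (0 : ℝ) < 1 / ((m : ℝ) + 1) := fun m => by positivity
  choose g hg using fun m => exists_isEnergyMin τ t (hpos m)
  obtain ⟨q, hq⟩ : ∃ q, τ.IsEnergyMin t 0 q := by
    by_cases hb : ∃ C, ∀ᶠ m in (hyperfilter ℕ : Filter ℕ), ∑ i, frobSq (g m i) ≤ C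
    · obtain ⟨C, hC⟩ := hb
      exact exists_isEnergyMin_zero_of_bounded
        (tendsto_one_div_add_atTop_nhds_zero_nat.mono_left Nat.hyperfilter_le_atTop) hpos hg hC
    · push Not at hb
      have hR : Tendsto (fun m => ∑ i, frobSq (g m i)) (hyperfilter ℕ) atTop :=
        tendsto_atTop.2 fun C =>
          (hb C).mono fun m hm => hm.le
      obtain ⟨i, U, hU, hbot, htop⟩ := exists_invariant_submodule_of_unbounded hγ hc ht hpos hg hR
      exact ((hirr i U hU).elim hbot htop).elim
  refine ⟨(τ.hom q)ᴴ *ᵥ (τ.hom q *ᵥ t), ?_, fun x => hq.conjTranspose_mulVec (hγ x) (hc x) (ht x)⟩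
  rw [dotProduct_mulVec, ← star_mulVec, star_dotProduct_self, Complex.ofReal_ne_zero, Ne,
    vecNormSq_eq_zero]
  intro h0
  have hinv : (fun i => (q i)⁻¹) * q = 1 := by
    funext i
    refine nonsing_inv_mul _ (isUnit_iff_ne_zero.2 fun h => ?_)
    simpa [h] using hq.1 i
  apply ht0
  rw [← one_mulVec t, ← map_one τ.hom, ← hinv, map_mul, ← mulVec_mulVec, h0, mulVec_zero]

end TensorAction

section Kronecker

variable {n : Fin 3 → Type*} [∀ i, Fintype (n i)] [∀ i, DecidableEq (n i)]

/-- The action of triples of matrices on a triple tensor product of coordinate spaces. -/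
noncomputable def tripleKronecker (n : Fin 3 → Type*) [∀ i, Fintype (n i)]
    [∀ i, DecidableEq (n i)] : TensorAction n ((n 0 × n 1) × n 2) where
  hom :=
    { toFun := fun g => g 0 ⊗ₖ g 1 ⊗ₖ g 2
      map_one' := by simp
      map_mul' := fun g h => by simp [mul_kronecker_mul] }
  map_conjTranspose g := by simp [conjTranspose_kronecker]
  continuous_hom := by
    refine continuous_matrix fun i j => ?_
    exact (((continuous_apply 0).matrix_elem _ _).mul ((continuous_apply 1).matrix_elem _ _)).mul
      ((continuous_apply 2).matrix_elem _ _)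
  map_expDiag a := by
    refine ⟨fun j => a 0 j.1.1 + a 1 j.1.2 + a 2 j.2, fun s => ?_⟩
    simp [expDiag, diagonal_kronecker_diagonal, mul_add, Complex.exp_add]

lemma tripleKronecker_hom (g : ∀ i, Matrix (n i) (n i) ℂ) :
    (tripleKronecker n).hom g = g 0 ⊗ₖ g 1 ⊗ₖ g 2 := rfl

lemma exists_smul_det_eq_one {m : Type*} [Fintype m] [DecidableEq m] {M : Matrix m m ℂ}
    (hM : M.det ≠ 0) : ∃ r : ℂ, r ≠ 0 ∧ (r • M).det = 1 := by
  cases isEmpty_or_nonempty m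
  · exact ⟨1, one_ne_zero, det_isEmpty⟩
  · obtain ⟨r, hr⟩ := IsAlgClosed.exists_pow_nat_eq (M.det)⁻¹ (Fintype.card_pos (α := m))
    refine ⟨r, fun h0 => ?_, by rw [det_smul, hr, inv_mul_cancel₀ hM]⟩
    rw [h0, zero_pow Fintype.card_ne_zero] at hr
    exact inv_ne_zero hM hr.symm

/-- A nonzero invariant of a triple tensor product of irreducible matrix groups is detected by an
invariant linear functional. -/
theorem exists_invariant_dual_tripleKronecker {Γ : Type*} {γ : Γ → ∀ i, Matrix (n i) (n i) ℂ}
    (hγ : ∀ x i, (γ x i).det ≠ 0)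
    (hirr : ∀ i, ∀ U : Submodule ℂ (n i → ℂ), (∀ x, ∀ v ∈ U, γ x i *ᵥ v ∈ U) → U = ⊥ ∨ U = ⊤)
    {t : (n 0 × n 1) × n 2 → ℂ} (ht0 : t ≠ 0)
    (ht : ∀ x, (γ x 0 ⊗ₖ γ x 1 ⊗ₖ γ x 2) *ᵥ t = t) :
    ∃ s : (n 0 × n 1) × n 2 → ℂ, s ⬝ᵥ t ≠ 0 ∧
      ∀ x z, s ⬝ᵥ ((γ x 0 ⊗ₖ γ x 1 ⊗ₖ γ x 2) *ᵥ z) = s ⬝ᵥ z := by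
  choose r hr hdet using fun x i => exists_smul_det_eq_one (hγ x i)
  set c : Γ → ℂ := fun x => r x 2 * (r x 1 * r x 0) with hcdef
  have hc : ∀ x, c x ≠ 0 := fun x => mul_ne_zero (hr x 2) (mul_ne_zero (hr x 1) (hr x 0))
  have hhom : ∀ x, (tripleKronecker n).hom (fun i => r x i • γ x i) =
      c x • (γ x 0 ⊗ₖ γ x 1 ⊗ₖ γ x 2) := fun x => by
    rw [tripleKronecker_hom]
    simp only [smul_kronecker, kronecker_smul, smul_smul, hcdef]
  obtain ⟨s, hst, hs⟩ := (tripleKronecker n).exists_dual_semiinvariant (t := t)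
    (γ := fun x i => r x i • γ x i) (c := c) (fun x i => by rw [hdet, norm_one])
    (fun i U hU => hirr i U fun x v hv => by
      have h := U.smul_mem (r x i)⁻¹ (hU x v hv)
      rwa [smul_mulVec, inv_smul_smul₀ (hr x i)] at h)
    hc ht0 (fun x => by rw [hhom, smul_mulVec, ht])
  have hst' : star s ⬝ᵥ t ≠ 0 := by
    rw [star_dotProduct]
    exact star_ne_zero.2 hst
  refine ⟨star s, hst', fun x => ?_⟩
  obtain ⟨μ, hμ⟩ : ∃ μ : ℂ, ∀ z, star s ⬝ᵥ ((γ x 0 ⊗ₖ γ x 1 ⊗ₖ γ x 2) *ᵥ z) =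
      μ * (star s ⬝ᵥ z) := by
    refine ⟨star ((star (c x))⁻¹ * (c x)⁻¹), fun z => ?_⟩
    have h := hs x
    rw [hhom, conjTranspose_smul, smul_mulVec, ← eq_inv_smul_iff₀ (star_ne_zero.2 (hc x)),
      smul_smul] at h
    rw [dotProduct_mulVec, ← smul_eq_mul, ← smul_dotProduct, ← star_smul, ← h, star_mulVec,
      conjTranspose_conjTranspose]
  have h1 : μ = 1 := by
    have h := hμ t
    rw [ht] at h
    exact mul_right_cancel₀ hst' (by rw [← h, one_mul])
  intro z
  rw [hμ, h1, one_mul]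

end Kronecker

section Application

/-- The three-factor form of `exists_invariant_dual_tripleKronecker`. -/
lemma exists_invariant_dual_kronecker {Γ : Type*} {a b c : ℕ} {A : Γ → Matrix (Fin a) (Fin a) ℂ}
    {B : Γ → Matrix (Fin b) (Fin b) ℂ} {C : Γ → Matrix (Fin c) (Fin c) ℂ}
    (hA : ∀ x, (A x).det ≠ 0) (hB : ∀ x, (B x).det ≠ 0) (hC : ∀ x, (C x).det ≠ 0)
    (hirrA : ∀ U : Submodule ℂ (Fin a → ℂ), (∀ x, ∀ v ∈ U, A x *ᵥ v ∈ U) → U = ⊥ ∨ U = ⊤)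
    (hirrB : ∀ U : Submodule ℂ (Fin b → ℂ), (∀ x, ∀ v ∈ U, B x *ᵥ v ∈ U) → U = ⊥ ∨ U = ⊤)
    (hirrC : ∀ U : Submodule ℂ (Fin c → ℂ), (∀ x, ∀ v ∈ U, C x *ᵥ v ∈ U) → U = ⊥ ∨ U = ⊤)
    {t : (Fin a × Fin b) × Fin c → ℂ} (ht0 : t ≠ 0) (ht : ∀ x, (A x ⊗ₖ B x ⊗ₖ C x) *ᵥ t = t) :
    ∃ s : (Fin a × Fin b) × Fin c → ℂ, s ⬝ᵥ t ≠ 0 ∧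
      ∀ x z, s ⬝ᵥ ((A x ⊗ₖ B x ⊗ₖ C x) *ᵥ z) = s ⬝ᵥ z :=
  exists_invariant_dual_tripleKronecker (n := fun i => Fin (![a, b, c] i))
    (γ := fun x i => match i with
      | 0 => A x
      | 1 => B x
      | 2 => C x)
    (fun x i => match i with
      | 0 => hA x
      | 1 => hB x
      | 2 => hC x)
    (fun i => match i with
      | 0 => hirrA
      | 1 => hirrB
      | 2 => hirrC) ht0 ht

variable {Γ E m : Type*} [AddCommGroup E] [Module ℂ E] [Fintype m] [DecidableEq m]

lemma toMatrix_irreducible (b : Module.Basis m ℂ E) (T : Γ → E →ₗ[ℂ] E)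
    (hT : ∀ U : Submodule ℂ E, (∀ x, ∀ v ∈ U, T x v ∈ U) → U = ⊥ ∨ U = ⊤)
    (U : Submodule ℂ (m → ℂ)) (hU : ∀ x, ∀ v ∈ U, LinearMap.toMatrix b b (T x) *ᵥ v ∈ U) :
    U = ⊥ ∨ U = ⊤ := by
  have hmem : ∀ v, v ∈ U.comap b.equivFun.toLinearMap ↔ b.equivFun v ∈ U := fun _ => Iff.rfl
  have hsurj : ∀ w, b.equivFun (b.equivFun.symm w) = w := b.equivFun.apply_symm_apply
  refine (hT (U.comap b.equivFun.toLinearMap) fun x v hv => ?_).imp (fun h => ?_) fun h => ?_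
  · rw [hmem] at hv ⊢
    have h := hU x _ hv
    rwa [Module.Basis.equivFun_apply, LinearMap.toMatrix_mulVec_repr] at h
  · rw [Submodule.eq_bot_iff] at h ⊢
    intro w hw
    have h1 := h (b.equivFun.symm w) ((hmem _).2 (by rwa [hsurj]))
    rwa [LinearEquiv.map_eq_zero_iff] at h1
  · rw [Submodule.eq_top_iff'] at h ⊢
    intro w
    have h1 := (hmem _).1 (h (b.equivFun.symm w))
    rwa [hsurj] at h1

lemma transpose_irreducible {M : Γ → Matrix m m ℂ}
    (hM : ∀ U : Submodule ℂ (m → ℂ), (∀ x, ∀ v ∈ U, M x *ᵥ v ∈ U) → U = ⊥ ∨ U = ⊤)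
    (U : Submodule ℂ (m → ℂ)) (hU : ∀ x, ∀ v ∈ U, (M x)ᵀ *ᵥ v ∈ U) : U = ⊥ ∨ U = ⊤ := by
  let P : Submodule ℂ (m → ℂ) :=
    { carrier := {w | ∀ u ∈ U, u ⬝ᵥ w = 0}
      add_mem' := fun {v w} hv hw u hu => by rw [dotProduct_add, hv u hu, hw u hu, add_zero]
      zero_mem' := fun u _ => dotProduct_zero u
      smul_mem' := fun r w hw u hu => by rw [dotProduct_smul, hw u hu, smul_zero] }
  rcases hM P fun x w hw u hu => by
    rw [dotProduct_mulVec, ← mulVec_transpose]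
    exact hw _ (hU x u hu) with h | h
  · right
    by_contra htop
    obtain ⟨f, hf, hfU⟩ := Submodule.exists_dual_map_eq_bot_of_lt_top (lt_top_iff_ne_top.2 htop)
      inferInstance
    have hfw : ∀ u, u ⬝ᵥ (fun i => f (Pi.single i 1)) = f u := fun u => by
      conv_rhs => rw [pi_eq_sum_univ' u, map_sum]
      simp [dotProduct]
    have hw : (fun i => f (Pi.single i 1)) ∈ P := fun u hu => by
      rw [hfw]
      exact (Submodule.eq_bot_iff _).1 hfU _ (Submodule.mem_map_of_mem hu)
    rw [h, Submodule.mem_bot] at hw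
    refine hf (LinearMap.ext fun u => ?_)
    rw [← hfw, hw, dotProduct_zero, LinearMap.zero_apply]
  · left
    rw [Submodule.eq_bot_iff]
    intro u hu
    refine dotProduct_eq_zero u fun w => ?_
    have hw : w ∈ P := h ▸ Submodule.mem_top
    exact hw u hu

end Application

section Complement

/-- If invariants of `M ⊗ C`, for `C` irreducible, are detected by invariant functionals, then every
irreducible subrepresentation has an invariant complement. -/
lemma exists_invariant_isCompl {Γ H P : Type*} [Group Γ] [AddCommGroup H] [Module ℂ H]
    [FiniteDimensional ℂ H] [Fintype P] [DecidableEq P] (ρ : Representation ℂ Γ H)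
    (M : Γ → Matrix P P ℂ) (L : H →ₗ[ℂ] (P → ℂ)) (hL : Function.Injective L)
    (hLρ : ∀ x f, L (ρ x f) = M x *ᵥ L f)
    (hdual : ∀ (c : ℕ) (C : Γ → Matrix (Fin c) (Fin c) ℂ), (∀ x, (C x).det ≠ 0) →
      (∀ U : Submodule ℂ (Fin c → ℂ), (∀ x, ∀ v ∈ U, C x *ᵥ v ∈ U) → U = ⊥ ∨ U = ⊤) →
      ∀ t : P × Fin c → ℂ, t ≠ 0 → (∀ x, (M x ⊗ₖ C x) *ᵥ t = t) →
      ∃ s : P × Fin c → ℂ, s ⬝ᵥ t ≠ 0 ∧ ∀ x z, s ⬝ᵥ ((M x ⊗ₖ C x) *ᵥ z) = s ⬝ᵥ z)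
    {X : Submodule ℂ H} (hX0 : X ≠ ⊥) (hX : ∀ x, ∀ v ∈ X, ρ x v ∈ X)
    (hmin : ∀ U ≤ X, (∀ x, ∀ v ∈ U, ρ x v ∈ U) → U = ⊥ ∨ U = X) :
    ∃ Y : Submodule ℂ H, (∀ x, ∀ v ∈ Y, ρ x v ∈ Y) ∧ IsCompl X Y := by
  set b := Module.finBasis ℂ X
  let T : Γ → X →ₗ[ℂ] X := fun x => (ρ x⁻¹).restrict (hX x⁻¹)
  have hT : ∀ x v, (T x v : H) = ρ x⁻¹ v := fun _ _ => rfl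
  have hTT : ∀ x, T x * T x⁻¹ = 1 := fun x => by
    ext v
    simp [hT]
  have hTirr : ∀ U : Submodule ℂ X, (∀ x, ∀ v ∈ U, T x v ∈ U) → U = ⊥ ∨ U = ⊤ := by
    intro U hU
    have hUX : U.map X.subtype ≤ X := Submodule.map_subtype_le X U
    refine (hmin _ hUX fun x v hv => ?_).imp (fun h => ?_) fun h => ?_
    · obtain ⟨u, hu, rfl⟩ := hv
      refine ⟨T x⁻¹ u, hU _ u hu, ?_⟩
      simp [hT]
    · exact Submodule.map_injective_of_injective X.subtype_injective (h.trans (Submodule.map_bot _).symm)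
    · refine Submodule.map_injective_of_injective X.subtype_injective ?_
      rw [h, Submodule.map_subtype_top]
  set C := fun x => (LinearMap.toMatrix b b (T x))ᵀ with hCdef
  have hC : ∀ x, (C x).det ≠ 0 := fun x h => by
    have h1 := congrArg (fun f => (LinearMap.toMatrix b b f).det) (hTT x)
    simp only [LinearMap.toMatrix_mul, det_mul, LinearMap.toMatrix_one, det_one] at h1
    rw [hCdef, det_transpose] at h
    rw [h, zero_mul] at h1
    exact zero_ne_one h1
  have hCirr := transpose_irreducible (toMatrix_irreducible b T hTirr)
  let N : Matrix (Fin (Module.finrank ℂ X)) P ℂ := of fun k => L (b k)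
  have hne : Nonempty (Fin (Module.finrank ℂ X)) := by
    rw [← Fin.pos_iff_nonempty, Module.finrank_pos_iff, Submodule.nontrivial_iff_ne_bot]
    exact hX0
  have hN0 : vec N ≠ 0 := by
    rw [Ne, vec_eq_zero_iff]
    intro h
    obtain ⟨k⟩ := hne
    have h1 : L (b k) = 0 := congrFun h k
    exact b.ne_zero k (Subtype.ext (hL (h1.trans (map_zero L).symm)))
  have hN : ∀ x, (M x ⊗ₖ C x) *ᵥ vec N = vec N := fun x => by
    rw [kronecker_mulVec_vec]
    congr 1
    ext k p
    have h1 : ∀ l, (N * (M x)ᵀ) l = L (ρ x (b l)) := fun l => by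
      rw [hLρ]
      ext p
      simp only [mul_apply, transpose_apply, mulVec, dotProduct, N, of_apply]
      exact Finset.sum_congr rfl fun _ _ => mul_comm _ _
    have h2 : ∑ l, C x k l • (b l : H) = ρ x⁻¹ (b k) := by
      have h3 := congrArg (Subtype.val) (b.sum_repr (T x (b k)))
      rw [hT, AddSubmonoidClass.coe_finsetSum] at h3
      rw [← h3]
      refine Finset.sum_congr rfl fun l _ => ?_
      have hCkl : C x k l = b.repr (T x (b k)) l := LinearMap.toMatrix_apply b b (T x) l k
      rw [hCkl]
      rfl
    calc (C x * N * (M x)ᵀ) k p = (∑ l, C x k l • L (ρ x (b l))) p := by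
          rw [Matrix.mul_assoc, mul_apply, Finset.sum_apply]
          refine Finset.sum_congr rfl fun l _ => ?_
          rw [h1, Pi.smul_apply, smul_eq_mul]
      _ = L (ρ x (∑ l, C x k l • (b l : H))) p := by simp only [map_sum, map_smul]
      _ = N k p := by simp [h2, N]
  obtain ⟨s, hsN, hs⟩ := hdual _ C hC hCirr _ hN0 hN
  obtain ⟨S, rfl⟩ := vec_bijective.surjective s
  have hpair : ∀ ξ m, vec S ⬝ᵥ vec (vecMulVec ξ m) = ξ ⬝ᵥ (S *ᵥ m) := fun ξ m => by
    simp only [dotProduct, vec, vecMulVec_apply, mulVec, Fintype.sum_prod_type_right,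
      Finset.mul_sum]
    exact Finset.sum_congr rfl fun _ _ => Finset.sum_congr rfl fun _ _ => by ring
  have hSinv : ∀ x m, S *ᵥ m = 0 → S *ᵥ (M x *ᵥ m) = 0 := fun x m hm => by
    refine dotProduct_eq_zero _ fun w => ?_
    have h := hs x (vec (vecMulVec ((C x)⁻¹ *ᵥ w) m))
    rw [kronecker_mulVec_vec, mul_vecMulVec, vecMulVec_mul, vecMul_transpose, hpair, hpair, hm,
      dotProduct_zero, mulVec_mulVec, mul_nonsing_inv _ (isUnit_iff_ne_zero.2 (hC x)),
      one_mulVec] at h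
    rw [dotProduct_comm, h]
  let Y : Submodule ℂ H := LinearMap.ker (S.mulVecLin ∘ₗ L)
  have hmemY : ∀ f, f ∈ Y ↔ S *ᵥ L f = 0 := fun f => by
    simp [Y]
  have hY : ∀ x, ∀ v ∈ Y, ρ x v ∈ Y := fun x v hv => by
    rw [hmemY] at hv ⊢
    rw [hLρ]
    exact hSinv x _ hv
  refine ⟨Y, hY, (Submodule.isCompl_iff_disjoint X Y ?_).2 ?_⟩
  · have h1 := LinearMap.finrank_range_add_finrank_ker (S.mulVecLin ∘ₗ L)
    have h2 := Submodule.finrank_le (LinearMap.range (S.mulVecLin ∘ₗ L))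
    rw [Module.finrank_fin_fun] at h2
    change _ + Module.finrank ℂ Y = _ at h1
    omega
  · rw [disjoint_iff]
    refine (hmin (X ⊓ Y) inf_le_left fun x v hv => ⟨hX x v hv.1, hY x v hv.2⟩).resolve_right ?_
    intro h
    rw [inf_eq_left] at h
    apply hsN
    simp only [dotProduct, vec, Fintype.sum_prod_type_right]
    exact Finset.sum_eq_zero fun k _ => congrFun ((hmemY _).1 (h (b k).2)) k

lemma isSemisimpleModule_of_isCompl_simple {R M : Type*} [Ring R] [AddCommGroup M] [Module R M]
    [IsArtinian R M]
    (h : ∀ X : Submodule R M, IsSimpleModule R X → ∃ Y, IsCompl X Y) : IsSemisimpleModule R M := by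
  refine IsSemisimpleModule.of_sSup_simples_eq_top (eq_top_iff.2 ?_)
  refine WellFoundedLT.induction (motive := fun N : Submodule R M => N ≤ sSup _) ⊤ fun N ih => ?_
  rcases eq_bot_or_exists_atom_le N with rfl | ⟨X, hX, hXN⟩
  · exact bot_le
  obtain ⟨Y, hY⟩ := h X (isSimpleModule_iff_isAtom.2 hX)
  have hN : N = X ⊔ N ⊓ Y := by
    rw [inf_comm, ← sup_inf_assoc_of_le Y hXN, hY.sup_eq_top, top_inf_eq]
  have hlt : N ⊓ Y < N := inf_lt_left.2 fun hNY =>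
    hX.1 (disjoint_self.1 (hY.disjoint.mono_right (hXN.trans hNY)))
  rw [hN]
  exact sup_le (le_sSup (isSimpleModule_iff_isAtom.2 hX)) (ih _ hlt)

lemma Representation.isSemisimpleModule_of_isCompl {Γ H : Type*} [Group Γ] [AddCommGroup H]
    [Module ℂ H] [FiniteDimensional ℂ H] (ρ : Representation ℂ Γ H)
    (h : ∀ X : Submodule ℂ H, X ≠ ⊥ → (∀ x, ∀ v ∈ X, ρ x v ∈ X) →
      (∀ U ≤ X, (∀ x, ∀ v ∈ U, ρ x v ∈ U) → U = ⊥ ∨ U = X) →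
      ∃ Y : Submodule ℂ H, (∀ x, ∀ v ∈ Y, ρ x v ∈ Y) ∧ IsCompl X Y) :
    IsSemisimpleModule (MonoidAlgebra ℂ Γ) ρ.asModule := by
  have : IsArtinian (MonoidAlgebra ℂ Γ) ρ.asModule := isArtinian_of_tower ℂ inferInstance
  refine isSemisimpleModule_of_isCompl_simple fun X hX => ?_
  have hat : IsAtom (ρ.mapSubmodule.symm X) :=
    (OrderIso.isAtom_iff _ _).2 (isSimpleModule_iff_isAtom.1 hX)
  obtain ⟨Y, hY, hc⟩ := h (ρ.mapSubmodule.symm X).1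
    (fun h0 => hat.1 (Subtype.ext h0)) (ρ.mem_invtSubmodule.1 (ρ.mapSubmodule.symm X).2)
    fun U hU hinv => (hat.le_iff.1 (show (⟨U, ρ.mem_invtSubmodule.2 hinv⟩ : ρ.invtSubmodule) ≤
      ρ.mapSubmodule.symm X from hU)).imp (congrArg Subtype.val) (congrArg Subtype.val)
  have hc' : IsCompl (ρ.mapSubmodule.symm X) ⟨Y, ρ.mem_invtSubmodule.2 hY⟩ := by
    rw [isCompl_iff, disjoint_iff, codisjoint_iff]
    exact ⟨Subtype.ext hc.inf_eq_bot, Subtype.ext hc.sup_eq_top⟩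
  have := (ρ.mapSubmodule.isCompl_iff).1 hc'
  rw [OrderIso.apply_symm_apply] at this
  exact ⟨_, this⟩

lemma Representation.det_toMatrix_ne_zero {Γ E m : Type*} [Group Γ] [AddCommGroup E] [Module ℂ E]
    [Fintype m] [DecidableEq m] (T : Representation ℂ Γ E) (b : Module.Basis m ℂ E) (x : Γ) :
    (LinearMap.toMatrix b b (T x)).det ≠ 0 := fun h => by
  have h1 : T x * T x⁻¹ = 1 := by rw [← map_mul, mul_inv_cancel, map_one]
  have h2 := congrArg (fun f => (LinearMap.toMatrix b b f).det) h1
  simp only [LinearMap.toMatrix_mul, Matrix.det_mul, h, zero_mul, LinearMap.toMatrix_one,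
    Matrix.det_one, zero_ne_one] at h2

end Complement

end Auxiliary

/-- **Corollary 4.6.** Let `α : Γ → GL(V)` and `β : Γ → GL(W)` be irreducible representations
on finite-dimensional complex vector spaces, `φ : Γ → ℤ` a homomorphism and `λ ≠ 0`.  Then the
representation of `Γ` on `Hom_ℂ(W, V)` given by `γ · f = λ^{φ(γ)} (α(γ) ∘ f ∘ β(γ)⁻¹)` is
completely reducible, i.e. `Hom_ℂ(W, V)` is a semisimple module over the group algebra `ℂ[Γ]`. -/
theorem homModule_of_irreducibles_isSemisimple
    {Γ V W : Type*} [Group Γ]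
    [AddCommGroup V] [Module ℂ V] [FiniteDimensional ℂ V]
    [AddCommGroup W] [Module ℂ W] [FiniteDimensional ℂ W]
    (α : Representation ℂ Γ V) (β : Representation ℂ Γ W)
    (hα : ∀ U : Submodule ℂ V, (∀ γ : Γ, ∀ v ∈ U, α γ v ∈ U) → U = ⊥ ∨ U = ⊤)
    (hβ : ∀ U : Submodule ℂ W, (∀ γ : Γ, ∀ w ∈ U, β γ w ∈ U) → U = ⊥ ∨ U = ⊤)
    (φ : Γ → ℤ) (hφ : ∀ a b : Γ, φ (a * b) = φ a + φ b)
    (lam : ℂ) (hlam : lam ≠ 0)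
    (ρ : Representation ℂ Γ (W →ₗ[ℂ] V))
    (hρ : ∀ (γ : Γ) (f : W →ₗ[ℂ] V), ρ γ f = lam ^ (φ γ) • (α γ ∘ₗ f ∘ₗ β γ⁻¹)) :
    IsSemisimpleModule (MonoidAlgebra ℂ Γ) ρ.asModule := by
  classical
  set bV := Module.finBasis ℂ V
  set bW := Module.finBasis ℂ W
  let A : Γ → (V →ₗ[ℂ] V) := fun x => lam ^ φ x • α x
  have hAirr : ∀ U : Submodule ℂ V, (∀ x, ∀ v ∈ U, A x v ∈ U) → U = ⊥ ∨ U = ⊤ :=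
    fun U hU => hα U fun x v hv =>
      (U.smul_mem_iff (zpow_ne_zero (φ x) hlam)).1 (hU x v hv)
  have hBirr : ∀ U : Submodule ℂ W, (∀ x : Γ, ∀ w ∈ U, β x⁻¹ w ∈ U) → U = ⊥ ∨ U = ⊤ :=
    fun U hU => hβ U fun x w hw => by simpa using hU x⁻¹ w hw
  have hAdet : ∀ x, (LinearMap.toMatrix bV bV (A x)).det ≠ 0 := fun x => by
    rw [map_smul, Matrix.det_smul]
    exact mul_ne_zero (pow_ne_zero _ (zpow_ne_zero _ hlam)) (α.det_toMatrix_ne_zero bV x)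
  have hBdet : ∀ x : Γ, (LinearMap.toMatrix bW bW (β x⁻¹)).transpose.det ≠ 0 := fun x => by
    rw [Matrix.det_transpose]
    exact β.det_toMatrix_ne_zero bW x⁻¹
  let L : (W →ₗ[ℂ] V) →ₗ[ℂ] (Fin (Module.finrank ℂ V) × Fin (Module.finrank ℂ W) → ℂ) :=
    { toFun := fun f => Matrix.vec (LinearMap.toMatrix bW bV f).transpose
      map_add' := fun f g => by rw [map_add, Matrix.transpose_add, Matrix.vec_add]
      map_smul' := fun r f => by
        rw [map_smul, Matrix.transpose_smul, Matrix.vec_smul, RingHom.id_apply] }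
  refine ρ.isSemisimpleModule_of_isCompl fun X hX0 hX hmin =>
    exists_invariant_isCompl ρ (fun x => Matrix.kronecker (LinearMap.toMatrix bV bV (A x))
      (LinearMap.toMatrix bW bW (β x⁻¹)).transpose) L ?_ ?_ ?_ hX0 hX hmin
  · intro f g hfg
    exact (LinearMap.toMatrix bW bV).injective
      (Matrix.transpose_injective (Matrix.vec_bijective.injective hfg))
  · intro x f
    refine Eq.trans ?_ (Matrix.kronecker_mulVec_vec _ _ _).symm
    change Matrix.vec (LinearMap.toMatrix bW bV (ρ x f)).transpose = _
    rw [hρ, ← Matrix.transpose_mul, ← Matrix.transpose_mul, ← LinearMap.toMatrix_comp bW bW bV,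
      ← LinearMap.toMatrix_comp bW bV bV, LinearMap.smul_comp]
  · intro c C hC hCirr t ht0 ht
    exact exists_invariant_dual_kronecker hAdet hBdet hC (toMatrix_irreducible bV A hAirr)
      (transpose_irreducible (toMatrix_irreducible bW (fun x : Γ => β x⁻¹) hBirr)) hCirr ht0 ht
end

section
/- Let n ≥ 1. For every group homomorphism ϱ: ℤ × ℤ → SL_n(ℂ), the first group cohomology satisfies dim_ℂ H¹(ℤ × ℤ; sl_n(ℂ)_{Ad ϱ}) ≥ 2(n − 1), where sl_n(ℂ) is the space of trace-zero n×n complex matrices with the Γ-action γ·X = ϱ(γ) X ϱ(γ)⁻¹. -/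
section Commutant

open Polynomial

theorem Matrix.finite_setOf_not_linearIndependent_map_eval {K ι m n : Type*} [Field K] [Finite ι]
    [Fintype m] [Fintype n] (F : ι → Matrix m n K[X]) (t₀ : K)
    (h : LinearIndependent K fun i => (F i).map (eval t₀)) :
    {t | ¬ LinearIndependent K fun i => (F i).map (eval t)}.Finite := by
  classical
  have := Fintype.ofFinite ι
  obtain ⟨g, hg⟩ := LinearMap.exists_leftInverse_of_injective
    (Fintype.linearCombination K fun i => (F i).map (eval t₀))
    (LinearMap.ker_eq_bot.2 (linearIndependent_iff_injective_fintypeLinearCombination.1 h))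
  let N : Matrix ι ι K[X] :=
    .of fun i j => ∑ a, ∑ b, C (g (Matrix.single a b 1) i) * F j a b
  have hN (t : K) (i j : ι) : (N i j).eval t = g ((F j).map (eval t)) i := by
    conv_rhs => rw [Matrix.matrix_eq_sum_single ((F j).map (eval t))]
    simp only [map_sum, Finset.sum_apply, N, Matrix.of_apply, eval_finsetSum, eval_mul, eval_C]
    refine Finset.sum_congr rfl fun a _ => Finset.sum_congr rfl fun b _ => ?_
    rw [show Matrix.single a b ((F j).map (eval t) a b) =
      (F j a b).eval t • Matrix.single a b (1 : K) by simp [Matrix.smul_single], map_smul]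
    simp [mul_comm]
  have hdet (t : K) : N.det.eval t = (N.map (eval t)).det := by
    rw [← coe_evalRingHom, RingHom.map_det]; rfl
  have hN₀ : N.map (eval t₀) = 1 := by
    ext i j
    have := congrFun (LinearMap.congr_fun hg (Pi.single j 1)) i
    simp only [LinearMap.comp_apply, Fintype.linearCombination_apply_single, one_smul,
      LinearMap.id_apply] at this
    rw [Matrix.map_apply, hN, this, Matrix.one_apply, Pi.single_apply]
  have hne : N.det ≠ 0 := by
    intro h0
    have := hdet t₀
    simp [hN₀, h0] at this
  refine (finite_setOfPred_isRoot hne).subset fun t ht => ?_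
  by_contra hroot
  refine ht (.of_comp g ?_)
  have hcols : (g ∘ fun i => (F i).map (eval t)) = (N.map (eval t)).col := by
    ext j i
    simp [hN]
  rw [hcols]
  exact Matrix.linearIndependent_cols_of_det_ne_zero ((hdet t).symm ▸ hroot)


theorem Polynomial.X_sub_C_pow_dvd_of_smul_eq_zero {K : Type*} [Field K] {p q : K[X]} {r s : K}
    {e : ℕ} (hr : p.IsRoot r)
    (h : ∀ x : K[X] ⧸ (K[X] ∙ p ^ e), aeval (X + C (s - r)) q • x = 0) :
    (X - C s) ^ e ∣ q := by
  have h₂ : p ^ e ∣ q.comp (X + C (s - r)) := by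
    have := h (Submodule.Quotient.mk 1)
    rwa [← Submodule.Quotient.mk_smul, Submodule.Quotient.mk_eq_zero, smul_eq_mul, mul_one,
      Ideal.submodule_span_eq, Ideal.mem_span_singleton] at this
  have h₃ : (X - C r) ^ e ∣ q.comp (X + C (s - r)) :=
    (pow_dvd_pow_of_dvd (dvd_iff_isRoot.2 hr) _).trans h₂
  have h₄ := _root_.map_dvd (compRingHom (X - C (s - r))) h₃
  simpa [comp_assoc, sub_sub] using h₄

theorem Module.End.exists_commute_finrank_le_natDegree_minpoly {K V : Type*} [Field K]
    [IsAlgClosed K] [AddCommGroup V] [Module K V] [FiniteDimensional K V] (f : Module.End K V) :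
    ∃ g : Module.End K V, Commute g f ∧ Module.finrank K V ≤ (minpoly K g).natDegree := by
  classical
  obtain ⟨ι, _, p, hp, e, ⟨E₀⟩⟩ :=
    Module.equiv_directSum_of_isTorsion (R := K[X]) (M := Module.AEval' f)
      (Module.AEval.isTorsion_of_finiteDimensional K V f)
  let E := E₀.trans (DirectSum.linearEquivFunOnFintype K[X] ι fun i => K[X] ⧸ (K[X] ∙ p i ^ e i))
  let o : V ≃ₗ[K] ∀ i, K[X] ⧸ (K[X] ∙ p i ^ e i) :=
    (Module.AEval'.of f).trans (E.restrictScalars K)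
  have ho (v : V) : o (f v) = (X : K[X]) • o v := by
    change E (Module.AEval'.of f (f v)) = _
    rw [← Module.AEval'.X_smul_of, map_smul]
    rfl
  clear_value o
  clear E E₀
  choose r hr using fun i => IsAlgClosed.exists_root (p i) (degree_pos_of_irreducible (hp i)).ne'
  have hp₁ (i) : (p i).natDegree = 1 :=
    natDegree_eq_of_degree_eq_some (degree_eq_one_of_irreducible_of_root (hp i) (hr i))
  let s : ι → K := fun i => Infinite.natEmbedding K (Fintype.equivFin ι i)
  have hs : Function.Injective s := fun i j hij => by
    simpa [s, Fin.val_inj] using hij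
  let G : Module.End K (∀ i, K[X] ⧸ (K[X] ∙ p i ^ e i)) :=
    LinearMap.pi fun i => (Algebra.lsmul K K _ (X + C (s i - r i))) ∘ₗ LinearMap.proj i
  have hG (x) (i) : G x i = (X + C (s i - r i)) • x i := rfl
  have hGq (q : K[X]) : ∀ x i, aeval G q x i = aeval (X + C (s i - r i)) q • x i := by
    induction q using Polynomial.induction_on' with
    | add a b ha hb =>
      intro x i
      simp only [map_add, LinearMap.add_apply, Pi.add_apply, ha, hb, add_smul]
    | monomial k a =>
      intro x i
      have hpow : ∀ x, (G ^ k) x i = (X + C (s i - r i)) ^ k • x i := by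
        induction k with
        | zero => simp
        | succ k ih => intro x; rw [pow_succ, Module.End.mul_apply, ih, hG, smul_smul, pow_succ]
      rw [aeval_monomial, aeval_monomial, Module.End.mul_apply, Module.algebraMap_end_apply,
        Pi.smul_apply, hpow, mul_smul, algebraMap_smul]
  have hdim : Module.finrank K V = ∑ i, e i := by
    have hfr (i) : Module.finrank K (K[X] ⧸ (K[X] ∙ p i ^ e i)) = e i := by
      refine finrank_quotient_span_eq_natDegree.trans ?_
      rw [natDegree_pow, hp₁, mul_one]
    have hfin (i) : Module.Finite K (K[X] ⧸ (K[X] ∙ p i ^ e i)) :=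
      Module.Finite.of_surjective ((LinearMap.proj i : (∀ i, K[X] ⧸ (K[X] ∙ p i ^ e i)) →ₗ[K] _) ∘ₗ
        o.toLinearMap) ((Function.surjective_eval i).comp o.surjective)
    rw [o.finrank_eq, Module.finrank_pi_fintype]
    simp_rw [hfr]
  have hmin : minpoly K (o.symm.conj G) = minpoly K G :=
    minpoly.algEquiv_eq (o.symm.conjAlgEquiv K) G
  have := Module.Finite.equiv o
  refine ⟨o.symm.conj G, ?_, ?_⟩
  · refine LinearMap.ext fun v => o.injective (funext fun i => ?_)
    simp [LinearEquiv.conj_apply, ho, hG, smul_smul, mul_comm]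
  have hdvd (i) : (X - C (s i)) ^ e i ∣ minpoly K G := by
    refine X_sub_C_pow_dvd_of_smul_eq_zero (hr i) fun x => ?_
    have h₀ := congrFun (LinearMap.congr_fun (minpoly.aeval K G) (Pi.single i x)) i
    simpa using (hGq (minpoly K G) (Pi.single i x) i).symm.trans h₀
  have hprod : ∏ i, (X - C (s i)) ^ e i ∣ minpoly K G :=
    Fintype.prod_dvd_of_coprime (fun i j hij =>
      (pairwise_coprime_X_sub_C hs hij).pow) hdvd
  calc Module.finrank K V = (∏ i, (X - C (s i)) ^ e i).natDegree := by
        rw [hdim, natDegree_prod_of_monic _ _ fun i _ => (monic_X_sub_C _).pow _]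
        simp
    _ ≤ _ := hmin ▸ natDegree_le_of_dvd hprod (minpoly.ne_zero (Algebra.IsIntegral.isIntegral G))

theorem Matrix.exists_commute_linearIndependent_pow {K : Type*} [Field K] [IsAlgClosed K] {n : ℕ}
    (B : Matrix (Fin n) (Fin n) K) :
    ∃ R : Matrix (Fin n) (Fin n) K, Commute R B ∧
      LinearIndependent K fun k : Fin n => R ^ (k : ℕ) := by
  obtain ⟨g, hgB, hg⟩ :=
    Module.End.exists_commute_finrank_le_natDegree_minpoly (Matrix.toLinAlgEquiv' B)
  refine ⟨Matrix.toLinAlgEquiv'.symm g, ?_, ?_⟩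
  · simpa using hgB.map (Matrix.toLinAlgEquiv' (R := K) (n := Fin n)).symm
  · rw [Module.finrank_fin_fun, ← minpoly.algEquiv_eq Matrix.toLinAlgEquiv'.symm] at hg
    exact (linearIndependent_pow _).comp (Fin.castLE hg) (Fin.castLE_injective hg)

theorem LinearMap.exists_linearIndependent_apply {K V W : Type*} [Field K] [AddCommGroup V]
    [Module K V] [AddCommGroup W] [Module K W] [FiniteDimensional K W] (L : V →ₗ[K] W) :
    ∃ v : Fin (Module.finrank K (LinearMap.range L)) → V, LinearIndependent K fun i => L (v i) := by
  let b := Module.finBasis K (LinearMap.range L)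
  choose v hv using fun i => (b i).2
  refine ⟨v, ?_⟩
  simp_rw [hv]
  exact b.linearIndependent.map' _ (Submodule.ker_subtype _)

/-- The matrices commuting with both `A` and `B`. -/
def Matrix.commutant₂ {K m : Type*} [Field K] [Fintype m] (A B : Matrix m m K) :
    Submodule K (Matrix m m K) where
  carrier := {Y | Commute A Y ∧ Commute B Y}
  add_mem' h h' := ⟨h.1.add_right h'.1, h.2.add_right h'.2⟩
  zero_mem' := ⟨.zero_right _, .zero_right _⟩
  smul_mem' c _ h := ⟨h.1.smul_right c, h.2.smul_right c⟩

/-- `B` commutes with some `R` whose powers `1, R, …, R ^ (n - 1)` are independent. On the line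
`A + t (R - A)` these powers stay independent for almost all `t` and lie in the commutant of the
pair, and the dimension of the commutant can only jump up at `t = 0`. -/
theorem Matrix.le_finrank_commutant₂ {K : Type*} [Field K] [IsAlgClosed K] {n : ℕ}
    {A B : Matrix (Fin n) (Fin n) K} (hAB : Commute A B) :
    n ≤ Module.finrank K (commutant₂ A B) := by
  obtain ⟨R, hRB, hR⟩ := exists_commute_linearIndependent_pow B
  let P : Matrix (Fin n) (Fin n) K[X] := A.map C + (X : K[X]) • (R - A).map C
  have hP (t : K) : P.map (eval t) = A + t • (R - A) := by
    ext i j; simp [P]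
  have hcomm (t : K) : Commute (A + t • (R - A)) B :=
    hAB.add_left ((hRB.sub_left hAB).smul_left t)
  let W : Submodule K (Matrix (Fin n) (Fin n) K) :=
    LinearMap.ker (LinearMap.mulLeft K B - LinearMap.mulRight K B)
  have hW (Y) : Y ∈ W ↔ Commute B Y := by simp [W, sub_eq_zero, Commute, SemiconjBy]
  let L (t : K) : W →ₗ[K] Matrix (Fin n) (Fin n) K :=
    (LinearMap.mulLeft K (A + t • (R - A)) - LinearMap.mulRight K (A + t • (R - A))) ∘ₗ W.subtype
  have hL (t : K) (Y : W) :
      L t Y = (A + t • (R - A)) * (Y : Matrix (Fin n) (Fin n) K) - Y * (A + t • (R - A)) := rfl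
  have hmap (t : K) (Y Z : Matrix (Fin n) (Fin n) K[X]) :
      (Y * Z).map (eval t) = Y.map (eval t) * Z.map (eval t) := Matrix.map_mul (f := evalRingHom t)
  have hpow (t : K) (k : ℕ) : (P ^ k).map (eval t) = (A + t • (R - A)) ^ k := by
    rw [← hP]
    exact map_pow (evalRingHom t).mapMatrix P k
  -- for all but finitely many `t`, the kernel of `L t` has dimension at least `n`
  have hfin₁ := finite_setOf_not_linearIndependent_map_eval (fun k : Fin n => P ^ (k : ℕ)) 1
    (by simpa [hpow] using hR)
  -- for all but finitely many `t`, the rank of `L t` is at least that of `L 0`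
  obtain ⟨Y, hY⟩ := (L 0).exists_linearIndependent_apply
  have hF (t : K) (i) : (P * (Y i : Matrix (Fin n) (Fin n) K).map C -
      (Y i : Matrix (Fin n) (Fin n) K).map C * P).map (eval t) = L t (Y i) := by
    rw [Matrix.map_sub _ (fun _ _ => eval_sub ..), hmap, hmap, hP, hL]
    simp [Matrix.map_map, Function.comp_def]
  have hfin₂ := finite_setOf_not_linearIndependent_map_eval
    (fun i => P * (Y i : Matrix (Fin n) (Fin n) K).map C -
      (Y i : Matrix (Fin n) (Fin n) K).map C * P) 0 (by
      simpa only [hF] using hY)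
  obtain ⟨t, ht⟩ := (hfin₁.union hfin₂).exists_notMem
  simp only [Set.mem_union, Set.mem_ofPred_eq, not_or, not_not, hpow, hF] at ht
  have hker : n ≤ Module.finrank K (LinearMap.ker (L t)) := by
    have hmem (k : Fin n) : (A + t • (R - A)) ^ (k : ℕ) ∈ W :=
      (hW _).2 ((hcomm t).symm.pow_right _)
    have hmem' (k : Fin n) : (⟨_, hmem k⟩ : W) ∈ LinearMap.ker (L t) := by
      rw [LinearMap.mem_ker, hL, sub_eq_zero]
      exact (Commute.refl _).pow_right _
    have hli : LinearIndependent K fun k => (⟨_, hmem' k⟩ : LinearMap.ker (L t)) :=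
      .of_comp (W.subtype ∘ₗ Submodule.subtype _) ht.1
    simpa using hli.fintype_card_le_finrank
  have hrange : Module.finrank K (LinearMap.range (L 0)) ≤
      Module.finrank K (LinearMap.range (L t)) := by
    have hli : LinearIndependent K fun i => (⟨_, LinearMap.mem_range_self (L t) (Y i)⟩ :
        LinearMap.range (L t)) := .of_comp (Submodule.subtype _) ht.2
    simpa using hli.fintype_card_le_finrank
  have hker₀ : Module.finrank K (LinearMap.ker (L 0)) ≤ Module.finrank K (commutant₂ A B) := by
    have hmem (Z : LinearMap.ker (L 0)) : (Z : Matrix (Fin n) (Fin n) K) ∈ commutant₂ A B := by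
      have hZ := LinearMap.mem_ker.1 Z.2
      rw [hL, zero_smul, add_zero, sub_eq_zero] at hZ
      exact ⟨hZ, (hW _).1 Z.1.2⟩
    exact LinearMap.finrank_le_finrank_of_injective
      (f := (W.subtype ∘ₗ Submodule.subtype _).codRestrict _ hmem)
      fun Z Z' h => by
        have h' := congrArg Subtype.val h
        exact Subtype.ext (Subtype.ext h')
  have h₀ := (L 0).finrank_range_add_finrank_ker
  have h₁ := (L t).finrank_range_add_finrank_ker
  omega

end Commutant

section FreeAbelianRankTwo

open Multiplicative groupCohomology

theorem Multiplicative.subgroup_int_prod_int_eq_top {S : Subgroup (Multiplicative (ℤ × ℤ))}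
    (h₁ : ofAdd ((1, 0) : ℤ × ℤ) ∈ S) (h₂ : ofAdd ((0, 1) : ℤ × ℤ) ∈ S) : S = ⊤ := by
  refine (Subgroup.eq_top_iff' S).2 fun g => ?_
  have : g = ofAdd ((1, 0) : ℤ × ℤ) ^ g.toAdd.1 * ofAdd ((0, 1) : ℤ × ℤ) ^ g.toAdd.2 := by
    apply toAdd.injective
    ext <;> simp
  rw [this]
  exact S.mul_mem (S.zpow_mem h₁ _) (S.zpow_mem h₂ _)

theorem Multiplicative.exists_monoidHom_int_prod_int {H : Type*} [Group H] {x y : H}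
    (h : Commute x y) : ∃ φ : Multiplicative (ℤ × ℤ) →* H,
      φ (ofAdd (1, 0)) = x ∧ φ (ofAdd (0, 1)) = y := by
  refine ⟨MonoidHom.mk' (fun g => x ^ g.toAdd.1 * y ^ g.toAdd.2) fun g g' => ?_, ?_, ?_⟩
  · simp only [toAdd_mul, Prod.fst_add, Prod.snd_add, zpow_add]
    exact (h.zpow_zpow g'.toAdd.1 g.toAdd.2).mul_mul_mul_comm _ _
  · simp
  · simp

variable {k V : Type} [Field k] [AddCommGroup V] [Module k V]
  (ρ : Representation k (Multiplicative (ℤ × ℤ)) V)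

/-- A cocycle is the translation part of a lift of `ρ` to affine automorphisms of `V`. -/
theorem groupCohomology.exists_cocycle₁_int_prod_int {u w : V}
    (h : u + ρ (ofAdd (1, 0)) w = w + ρ (ofAdd (0, 1)) u) :
    ∃ d : cocycles₁ (Rep.of ρ), d (ofAdd (1, 0)) = u ∧ d (ofAdd (0, 1)) = w := by
  let ℓ : Multiplicative (ℤ × ℤ) →* (V ≃ₗ[k] V) :=
    (LinearMap.GeneralLinearGroup.generalLinearEquiv k V).toMonoidHom.comp ρ.asGroupHom
  let τ (g) (v : V) : V ≃ᵃ[k] V := (ℓ g).toAffineEquiv.trans (AffineEquiv.constVAdd k V v)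
  have hτ (g) (v x : V) : τ g v x = v + ρ g x := rfl
  have hcomm : Commute (τ (ofAdd (1, 0)) u) (τ (ofAdd (0, 1)) w) := by
    ext x
    simp only [AffineEquiv.mul_def, AffineEquiv.trans_apply, hτ, map_add, ← Module.End.mul_apply,
      ← map_mul]
    rw [← add_assoc, ← add_assoc, h, mul_comm]
  obtain ⟨Φ, h₁, h₂⟩ := exists_monoidHom_int_prod_int hcomm
  have hlin : AffineEquiv.linearHom.comp Φ = ℓ := by
    have : (AffineEquiv.linearHom.comp Φ).eqLocus ℓ = ⊤ := by
      apply subgroup_int_prod_int_eq_top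
      · change AffineEquiv.linear (Φ _) = _
        rw [h₁]; rfl
      · change AffineEquiv.linear (Φ _) = _
        rw [h₂]; rfl
    exact MonoidHom.eq_of_eqOn_top fun g _ => this.ge (Subgroup.mem_top g)
  have hmem : (fun g => Φ g 0) ∈ cocycles₁ (Rep.of ρ) := by
    refine (mem_cocycles₁_iff _).2 fun g g' => ?_
    have h₃ := (Φ g).map_vadd 0 (Φ g' 0)
    rw [vadd_eq_add, add_zero, vadd_eq_add] at h₃
    rw [map_mul]
    refine h₃.trans (congrArg (· + _) ?_)
    exact LinearEquiv.congr_fun (DFunLike.congr_fun hlin g) _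
  exact ⟨⟨_, hmem⟩, (DFunLike.congr_fun h₁ 0).trans (by simp [hτ]),
    (DFunLike.congr_fun h₂ 0).trans (by simp [hτ])⟩

theorem groupCohomology.cocycle₁_int_prod_int_eq_zero {d : cocycles₁ (Rep.of ρ)}
    (h₁ : d (ofAdd (1, 0)) = 0) (h₂ : d (ofAdd (0, 1)) = 0) : d = 0 := by
  have hd := (mem_cocycles₁_iff _).1 d.2
  let S : Subgroup (Multiplicative (ℤ × ℤ)) :=
    { carrier := {g | d g = 0}
      one_mem' := cocycles₁_map_one d
      mul_mem' := fun {g g'} hg hg' => by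
        have hg : d g = 0 := hg
        have hg' : d g' = 0 := hg'
        simpa [hg, hg'] using hd g g'
      inv_mem' := fun {g} hg => by
        have hg : d g = 0 := hg
        have := cocycles₁_map_inv d g
        rw [hg, neg_zero] at this
        exact ((Rep.of ρ).ρ.apply_bijective g).injective (this.trans (map_zero _).symm) }
  refine cocycles₁_ext fun g => ?_
  exact (subgroup_int_prod_int_eq_top (S := S) h₁ h₂).ge (Subgroup.mem_top g)

theorem Representation.mem_invariants_int_prod_int {v : V} (h₁ : ρ (ofAdd (1, 0)) v = v)
    (h₂ : ρ (ofAdd (0, 1)) v = v) : v ∈ ρ.invariants := by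
  let S : Subgroup (Multiplicative (ℤ × ℤ)) :=
    { carrier := {g | ρ g v = v}
      one_mem' := by simp
      mul_mem' := fun {g g'} hg hg' => by
        have hg : ρ g v = v := hg
        have hg' : ρ g' v = v := hg'
        change ρ (g * g') v = v
        rw [map_mul, Module.End.mul_apply, hg', hg]
      inv_mem' := fun {g} hg => by
        have hg : ρ g v = v := hg
        refine (ρ.apply_bijective g).injective ?_
        rw [ρ.self_inv_apply, hg] }
  exact fun g => (subgroup_int_prod_int_eq_top (S := S) h₁ h₂).ge (Subgroup.mem_top g)

/-- Cocycles on `ℤ × ℤ` are the kernel of a map `V × V → V` whose image is orthogonal to the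
invariants, which makes them large enough compared to the coboundaries. -/
theorem groupCohomology.two_mul_finrank_invariants_le_finrank_H1_int_prod_int
    [FiniteDimensional k V] {B : LinearMap.BilinForm k V} (hB : B.Nondegenerate)
    (hρ : ∀ g x y, B (ρ g x) (ρ g y) = B x y) :
    2 * Module.finrank k ρ.invariants ≤ Module.finrank k (H1 (Rep.of ρ)) := by
  let D : V × V →ₗ[k] V := (ρ (ofAdd (1, 0)) - 1) ∘ₗ LinearMap.snd k V V -
    (ρ (ofAdd (0, 1)) - 1) ∘ₗ LinearMap.fst k V V
  have hD (p : V × V) :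
      D p = (ρ (ofAdd (1, 0)) p.2 - p.2) - (ρ (ofAdd (0, 1)) p.1 - p.1) := rfl
  let res : cocycles₁ (Rep.of ρ) →ₗ[k] V × V :=
    ((LinearMap.proj (ofAdd (1, 0))).prod (LinearMap.proj (ofAdd (0, 1)))) ∘ₗ
      (cocycles₁ (Rep.of ρ)).subtype
  have hres : Function.Injective res := by
    refine (injective_iff_map_eq_zero res).2 fun d hd => ?_
    exact cocycle₁_int_prod_int_eq_zero ρ (congrArg Prod.fst hd) (congrArg Prod.snd hd)
  have hker : LinearMap.ker D ≤ LinearMap.range res := by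
    intro p hp
    rw [LinearMap.mem_ker, hD, sub_eq_zero] at hp
    obtain ⟨d, h₁, h₂⟩ := exists_cocycle₁_int_prod_int ρ (u := p.1) (w := p.2) (by
      rw [← sub_eq_zero] at hp ⊢
      rw [← hp]; abel)
    exact ⟨d, Prod.ext h₁ h₂⟩
  have : Module.Finite k (cocycles₁ (Rep.of ρ)) := Module.Finite.of_injective res hres
  have hZ : Module.finrank k (LinearMap.ker D) ≤ Module.finrank k (cocycles₁ (Rep.of ρ)) :=
    (Submodule.finrank_mono hker).trans (LinearMap.finrank_range_le res)
  have hDrange : Module.finrank k ρ.invariants ≤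
      Module.finrank k V - Module.finrank k (LinearMap.range D) := by
    rw [← LinearMap.BilinForm.finrank_orthogonal hB]
    refine Submodule.finrank_mono fun y hy => ?_
    rintro _ ⟨p, rfl⟩
    have h₀ (g) (x : V) : B (ρ g x) y = B x y := by
      conv_lhs => rw [← hy g]
      exact hρ g x y
    change B (D p) y = 0
    simp [hD, h₀]
  have hDle := Submodule.finrank_le (LinearMap.range D)
  have hDsum := D.finrank_range_add_finrank_ker
  rw [Module.finrank_prod] at hDsum
  have hd₀₁ := (d₀₁ (Rep.of ρ)).hom.finrank_range_add_finrank_ker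
  rw [d₀₁_ker_eq_invariants] at hd₀₁
  let π : cocycles₁ (Rep.of ρ) →ₗ[k] H1 (Rep.of ρ) := (H1π (Rep.of ρ)).hom
  have hπ : Function.Surjective π :=
    (ModuleCat.epi_iff_surjective (H1π (Rep.of ρ))).1 inferInstance
  have hπsum := π.finrank_range_add_finrank_ker
  rw [LinearMap.range_eq_top.2 hπ, finrank_top] at hπsum
  have hfin : Module.Finite k (coboundaries₁ (Rep.of ρ)) :=
    Module.Finite.range (M := V) (d₀₁ (Rep.of ρ)).hom
  have hπker : Module.finrank k (LinearMap.ker π) ≤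
      Module.finrank k (coboundaries₁ (Rep.of ρ)) :=
    LinearMap.finrank_le_finrank_of_injective
      (f := ((cocycles₁ (Rep.of ρ)).subtype ∘ₗ Submodule.subtype _).codRestrict _
        fun z => (H1π_eq_zero_iff z.1).1 z.2)
      fun z z' h => by
        have h' := congrArg Subtype.val h
        exact Subtype.ext (Subtype.ext h')
  change Module.finrank k (coboundaries₁ (Rep.of ρ)) + Module.finrank k ρ.invariants =
    Module.finrank k V at hd₀₁
  omega

end FreeAbelianRankTwo

theorem Matrix.nondegenerate_traceForm_ker_trace {K m : Type*} [Field K] [CharZero K] [Fintype m]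
    [DecidableEq m] [Nonempty m] :
    ((LinearMap.mul K (Matrix m m K)).compr₂ (traceLinearMap m K K) |>.domRestrict₁₂
      (LinearMap.ker (traceLinearMap m K K))
      (LinearMap.ker (traceLinearMap m K K))).Nondegenerate := by
  have hcard : (Fintype.card m : K) ≠ 0 := Nat.cast_ne_zero.2 Fintype.card_ne_zero
  have key (X : LinearMap.ker (traceLinearMap m K K))
      (h : ∀ Y : LinearMap.ker (traceLinearMap m K K),
        ((Y : Matrix m m K) * (X : Matrix m m K)).trace = 0) : X = 0 := by
    refine Subtype.ext (ext_iff_trace_mul_left.2 fun Y => ?_)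
    have hX : (X : Matrix m m K).trace = 0 := X.2
    have := h ⟨Y - (Y.trace / Fintype.card m) • (1 : Matrix m m K), by
      simp [trace_sub, trace_smul, trace_one, hcard]⟩
    simpa [sub_mul, trace_sub, trace_smul, hX] using this
  refine ⟨fun X h => key X fun Y => ?_, fun X h => key X fun Y => ?_⟩
  · rw [trace_mul_comm]
    exact h Y
  · exact h Y

theorem Matrix.trace_conj_mul_conj {R m : Type*} [CommRing R] [Fintype m] [DecidableEq m]
    {g h : Matrix m m R} (hg : h * g = 1) (X Y : Matrix m m R) :
    ((g * X * h) * (g * Y * h)).trace = (X * Y).trace := by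
  rw [show (g * X * h) * (g * Y * h) = g * (X * ((h * g) * (Y * h))) by simp only [mul_assoc],
    hg, one_mul, trace_mul_comm, mul_assoc, mul_assoc, hg, mul_one]


/-- **The inequality of Lemma 3.2.** For every representation `ϱ` of `ℤ × ℤ` into `SL_n(ℂ)`,
the first group cohomology of `ℤ × ℤ` with coefficients in `sl_n(ℂ)` (the trace-zero `n × n`
complex matrices) twisted by the adjoint action `γ · X = ϱ(γ) X ϱ(γ)⁻¹` has complex dimension
at least `2(n - 1)`. -/
theorem h1_adjoint_of_Z2_ge
    (n : ℕ) (hn : 1 ≤ n)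
    (ϱ : Multiplicative (ℤ × ℤ) →* Matrix.SpecialLinearGroup (Fin n) ℂ)
    (ρ : Representation ℂ (Multiplicative (ℤ × ℤ))
      (LinearMap.ker (Matrix.traceLinearMap (Fin n) ℂ ℂ)))
    (hρ : ∀ (γ : Multiplicative (ℤ × ℤ))
        (X : LinearMap.ker (Matrix.traceLinearMap (Fin n) ℂ ℂ)),
      (ρ γ X : Matrix (Fin n) (Fin n) ℂ) =
        (ϱ γ : Matrix (Fin n) (Fin n) ℂ) * (X : Matrix (Fin n) (Fin n) ℂ) *
          (((ϱ γ)⁻¹ : Matrix.SpecialLinearGroup (Fin n) ℂ) : Matrix (Fin n) (Fin n) ℂ)) :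
    2 * (n - 1) ≤ Module.finrank ℂ
      (groupCohomology.H1 (k := ℂ) (G := Multiplicative (ℤ × ℤ)) (Rep.of ρ)) := by
  have : Nonempty (Fin n) := ⟨⟨0, hn⟩⟩
  have hρ' (γ) (X : LinearMap.ker (Matrix.traceLinearMap (Fin n) ℂ ℂ))
      (h : Commute (ϱ γ : Matrix (Fin n) (Fin n) ℂ) X) : ρ γ X = X := by
    refine Subtype.ext ?_
    rw [hρ, h.eq, mul_assoc, ← Matrix.SpecialLinearGroup.coe_mul, mul_inv_cancel,
      Matrix.SpecialLinearGroup.coe_one, mul_one]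
  let A : Matrix (Fin n) (Fin n) ℂ := ↑(ϱ (Multiplicative.ofAdd (1, 0)))
  let B : Matrix (Fin n) (Fin n) ℂ := ↑(ϱ (Multiplicative.ofAdd (0, 1)))
  have hAB : Commute A B := congrArg Subtype.val ((Commute.all
    (Multiplicative.ofAdd ((1, 0) : ℤ × ℤ)) (Multiplicative.ofAdd (0, 1))).map ϱ).eq
  have hC := Matrix.le_finrank_commutant₂ hAB
  let T := Matrix.traceLinearMap (Fin n) ℂ ℂ ∘ₗ (Matrix.commutant₂ A B).subtype
  have hT := T.finrank_range_add_finrank_ker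
  have hTrange := (LinearMap.range T).finrank_le
  rw [Module.finrank_self] at hTrange
  have hinv : Module.finrank ℂ (LinearMap.ker T) ≤ Module.finrank ℂ ρ.invariants := by
    let i : LinearMap.ker T →ₗ[ℂ] LinearMap.ker (Matrix.traceLinearMap (Fin n) ℂ ℂ) :=
      ((Matrix.commutant₂ A B).subtype ∘ₗ (LinearMap.ker T).subtype).codRestrict _ fun Y => Y.2
    refine LinearMap.finrank_le_finrank_of_injective
      (f := i.codRestrict ρ.invariants fun Y => ρ.mem_invariants_int_prod_int
        (hρ' _ _ Y.1.2.1) (hρ' _ _ Y.1.2.2)) fun Y Y' h => ?_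
    have h' := congrArg (fun Z => (Z.1.1 : Matrix (Fin n) (Fin n) ℂ)) h
    exact Subtype.ext (Subtype.ext h')
  have hH := groupCohomology.two_mul_finrank_invariants_le_finrank_H1_int_prod_int ρ
    Matrix.nondegenerate_traceForm_ker_trace fun γ X Y => by
      change ((ρ γ X : Matrix (Fin n) (Fin n) ℂ) * (ρ γ Y : Matrix (Fin n) (Fin n) ℂ)).trace =
        ((X : Matrix (Fin n) (Fin n) ℂ) * (Y : Matrix (Fin n) (Fin n) ℂ)).trace
      rw [hρ, hρ]
      refine Matrix.trace_conj_mul_conj ?_ _ _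
      rw [← Matrix.SpecialLinearGroup.coe_mul, inv_mul_cancel, Matrix.SpecialLinearGroup.coe_one]
  omega
end

section
/- In the setup below, assume α and β are irreducible and that c: Γ → M_{a×b}(ℂ) is a cocycle, so that ρ_λ^c is a group homomorphism. Then ρ_λ^c is conjugate to ρ_λ by an element of SL_n(ℂ) if and only if c is a coboundary, i.e., there exists M ∈ M_{a×b}(ℂ) with c(γ) = λ^{nφ(γ)} α(γ) M β(γ)⁻¹ − M for all γ ∈ Γ. -/
noncomputable section
open Matrix

variable {Γ : Type*} [Group Γ]

/-- The block matrix `ρ_λ^c(γ)`. -/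
def rhoLam (φ : Γ → ℤ) (a b : ℕ) (lam : ℂ)
    (α : Γ →* Matrix.SpecialLinearGroup (Fin a) ℂ)
    (β : Γ →* Matrix.SpecialLinearGroup (Fin b) ℂ)
    (c : Γ → Matrix (Fin a) (Fin b) ℂ) (γ : Γ) :
    Matrix (Fin a ⊕ Fin b) (Fin a ⊕ Fin b) ℂ :=
  Matrix.fromBlocks
    (lam ^ ((b : ℤ) * φ γ) • (α γ : Matrix (Fin a) (Fin a) ℂ))
    (c γ * (lam ^ (-(a : ℤ) * φ γ) • (β γ : Matrix (Fin b) (Fin b) ℂ)))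
    0
    (lam ^ (-(a : ℤ) * φ γ) • (β γ : Matrix (Fin b) (Fin b) ℂ))

/-- `c` is a cocycle for the action `γ · A = λ^{nφ(γ)} α(γ) A β(γ)⁻¹`. -/
def IsCocyc (φ : Γ → ℤ) (a b : ℕ) (lam : ℂ)
    (α : Γ →* Matrix.SpecialLinearGroup (Fin a) ℂ)
    (β : Γ →* Matrix.SpecialLinearGroup (Fin b) ℂ)
    (c : Γ → Matrix (Fin a) (Fin b) ℂ) : Prop :=
  ∀ γ₁ γ₂ : Γ, c (γ₁ * γ₂) = c γ₁ +
    lam ^ (((a + b : ℕ) : ℤ) * φ γ₁) •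
      ((α γ₁ : Matrix (Fin a) (Fin a) ℂ) * c γ₂ *
        (((β γ₁)⁻¹ : Matrix.SpecialLinearGroup (Fin b) ℂ) : Matrix (Fin b) (Fin b) ℂ))

/-- `c` is a coboundary. -/
def IsCobound (φ : Γ → ℤ) (a b : ℕ) (lam : ℂ)
    (α : Γ →* Matrix.SpecialLinearGroup (Fin a) ℂ)
    (β : Γ →* Matrix.SpecialLinearGroup (Fin b) ℂ)
    (c : Γ → Matrix (Fin a) (Fin b) ℂ) : Prop :=
  ∃ M : Matrix (Fin a) (Fin b) ℂ, ∀ γ : Γ, c γ =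
    lam ^ (((a + b : ℕ) : ℤ) * φ γ) •
      ((α γ : Matrix (Fin a) (Fin a) ℂ) * M *
        (((β γ)⁻¹ : Matrix.SpecialLinearGroup (Fin b) ℂ) : Matrix (Fin b) (Fin b) ℂ)) - M

theorem isCobound_iff_exists_mul_sub_mul (φ : Γ → ℤ) (a b : ℕ) {lam : ℂ} (hlam : lam ≠ 0)
    (α : Γ →* Matrix.SpecialLinearGroup (Fin a) ℂ)
    (β : Γ →* Matrix.SpecialLinearGroup (Fin b) ℂ)
    (c : Γ → Matrix (Fin a) (Fin b) ℂ) :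
    IsCobound φ a b lam α β c ↔ ∃ N : Matrix (Fin a) (Fin b) ℂ, ∀ γ : Γ,
      c γ * (lam ^ (-(a : ℤ) * φ γ) • (β γ : Matrix (Fin b) (Fin b) ℂ)) =
        N * (lam ^ (-(a : ℤ) * φ γ) • (β γ : Matrix (Fin b) (Fin b) ℂ)) -
          (lam ^ ((b : ℤ) * φ γ) • (α γ : Matrix (Fin a) (Fin a) ℂ)) * N := by
  have hββ (γ : Γ) : (β γ : Matrix (Fin b) (Fin b) ℂ) *
      (((β γ)⁻¹ : Matrix.SpecialLinearGroup (Fin b) ℂ) : Matrix (Fin b) (Fin b) ℂ) = 1 := by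
    rw [← Matrix.SpecialLinearGroup.coe_mul, mul_inv_cancel, Matrix.SpecialLinearGroup.coe_one]
  have hββ' (γ : Γ) : (((β γ)⁻¹ : Matrix.SpecialLinearGroup (Fin b) ℂ) :
      Matrix (Fin b) (Fin b) ℂ) * (β γ : Matrix (Fin b) (Fin b) ℂ) = 1 := by
    rw [← Matrix.SpecialLinearGroup.coe_mul, inv_mul_cancel, Matrix.SpecialLinearGroup.coe_one]
  have hpow (γ : Γ) : lam ^ (-(a : ℤ) * φ γ) * lam ^ (((a + b : ℕ) : ℤ) * φ γ) =
      lam ^ ((b : ℤ) * φ γ) := by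
    rw [← zpow_add₀ hlam]
    congr 1
    push_cast
    ring
  constructor
  · rintro ⟨M, hM⟩
    refine ⟨-M, fun γ => ?_⟩
    rw [hM γ, ← hpow γ]
    simp only [Matrix.sub_mul, Matrix.smul_mul, Matrix.mul_smul, Matrix.neg_mul, Matrix.mul_neg,
      Matrix.mul_assoc, hββ', Matrix.mul_one, mul_smul, smul_sub, smul_neg]
    abel
  · rintro ⟨N, hN⟩
    refine ⟨-N, fun γ => ?_⟩
    have hy : lam ^ (-(a : ℤ) * φ γ) ≠ 0 := zpow_ne_zero _ hlam
    have h := congrArg (· * (((β γ)⁻¹ : Matrix.SpecialLinearGroup (Fin b) ℂ) :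
      Matrix (Fin b) (Fin b) ℂ)) (hN γ)
    simp only [Matrix.sub_mul, Matrix.smul_mul, Matrix.mul_smul, Matrix.mul_assoc, hββ,
      Matrix.mul_one, ← hpow γ, mul_smul, ← smul_sub] at h
    rw [smul_right_injective _ hy h]
    simp only [Matrix.neg_mul, Matrix.mul_neg, smul_neg, Matrix.mul_assoc]
    abel

/-- If an intertwiner `X` of `D` and `B` lifts to an intertwiner with upper block `Y` and `X` is
invertible, then the upper right block `C` is of coboundary form. -/
theorem eq_mul_sub_mul_of_intertwiner {R l m n : Type*} [Ring R] [Fintype l] [Fintype m]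
    [Fintype n] [DecidableEq m] [DecidableEq n] {A : Matrix l l R} {B : Matrix m m R}
    {D : Matrix n n R} {C : Matrix l m R} {X : Matrix m n R} {T : Matrix n m R}
    {Y : Matrix l n R} (hXT : X * T = 1) (hTX : T * X = 1) (hX : B * X = X * D)
    (hY : A * Y + C * X = Y * D) : C = Y * T * B - A * (Y * T) := by
  have hDT : D * T = T * B := by
    calc D * T = T * X * D * T := by rw [hTX, Matrix.one_mul]
      _ = T * (X * D) * T := by simp only [Matrix.mul_assoc]
      _ = T * B * (X * T) := by rw [← hX]; simp only [Matrix.mul_assoc]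
      _ = T * B := by rw [hXT, Matrix.mul_one]
  calc C = C * X * T := by rw [Matrix.mul_assoc, hXT, Matrix.mul_one]
    _ = (Y * D - A * Y) * T := by rw [← hY, add_sub_cancel_left]
    _ = Y * T * B - A * (Y * T) := by
      rw [Matrix.sub_mul, Matrix.mul_assoc, hDT]
      simp only [Matrix.mul_assoc]

/-- A matrix intertwining nonzero multiples of an irreducible family with another family is zero or
injective. -/
theorem eq_zero_or_mulVec_injective_of_intertwiner {ι K m n : Type*} [Field K] [Fintype m]
    [Fintype n] {D : ι → Matrix n n K} {x : ι → K} {B : ι → Matrix m m K}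
    (hx : ∀ i, x i ≠ 0)
    (hirr : ∀ W : Submodule K (n → K), (∀ i, ∀ v ∈ W, (D i).mulVec v ∈ W) → W = ⊥ ∨ W = ⊤)
    {X : Matrix m n K} (hX : ∀ i, B i * X = X * (x i • D i)) :
    X = 0 ∨ Function.Injective X.mulVec := by
  have hker (i : ι) (v : n → K) (hv : v ∈ LinearMap.ker X.mulVecLin) :
      (D i).mulVec v ∈ LinearMap.ker X.mulVecLin := by
    rw [LinearMap.mem_ker, Matrix.mulVecLin_apply] at hv ⊢
    have h : x i • X.mulVec ((D i).mulVec v) = 0 := by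
      rw [Matrix.mulVec_mulVec, ← Matrix.smul_mulVec, ← Matrix.mul_smul, ← hX i,
        ← Matrix.mulVec_mulVec, hv, Matrix.mulVec_zero]
    exact (smul_eq_zero.mp h).resolve_left (hx i)
  rcases hirr _ hker with h | h
  · right
    exact LinearMap.ker_eq_bot.mp h
  · left
    classical
    refine Matrix.ext_of_mulVec_single fun i => ?_
    rw [Matrix.zero_mulVec, ← Matrix.mulVecLin_apply, LinearMap.ker_eq_top.mp h,
      LinearMap.zero_apply]

/-- **Lemma 5.5, second assertion.** Assume `α` and `β` are irreducible and `c` is a cocycle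
(so that `ρ_λ^c` is a group homomorphism).  Then `ρ_λ^c` is conjugate to `ρ_λ = ρ_λ^0` by an
element of `SL_n(ℂ)` if and only if `c` is a coboundary. -/
theorem rhoLam_conjugate_iff_isCobound
    (φ : Γ → ℤ) (hφ : ∀ g h : Γ, φ (g * h) = φ g + φ h)
    (a b : ℕ) (ha : 1 ≤ a) (hb : 1 ≤ b)
    (lam : ℂ) (hlam : lam ≠ 0)
    (α : Γ →* Matrix.SpecialLinearGroup (Fin a) ℂ)
    (β : Γ →* Matrix.SpecialLinearGroup (Fin b) ℂ)
    (hαirr : ∀ W : Submodule ℂ (Fin a → ℂ),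
      (∀ γ : Γ, ∀ v ∈ W, (α γ : Matrix (Fin a) (Fin a) ℂ).mulVec v ∈ W) → W = ⊥ ∨ W = ⊤)
    (hβirr : ∀ W : Submodule ℂ (Fin b → ℂ),
      (∀ γ : Γ, ∀ v ∈ W, (β γ : Matrix (Fin b) (Fin b) ℂ).mulVec v ∈ W) → W = ⊥ ∨ W = ⊤)
    (c : Γ → Matrix (Fin a) (Fin b) ℂ) (hc : IsCocyc φ a b lam α β c) :
    (∃ g : Matrix.SpecialLinearGroup (Fin a ⊕ Fin b) ℂ, ∀ γ : Γ,
        rhoLam φ a b lam α β c γ =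
          (g : Matrix (Fin a ⊕ Fin b) (Fin a ⊕ Fin b) ℂ) *
            rhoLam φ a b lam α β (fun _ => 0) γ *
              ((g⁻¹ : Matrix.SpecialLinearGroup (Fin a ⊕ Fin b) ℂ) :
                Matrix (Fin a ⊕ Fin b) (Fin a ⊕ Fin b) ℂ)) ↔
      IsCobound φ a b lam α β c := by
  rw [isCobound_iff_exists_mul_sub_mul φ a b hlam]
  have hconj (g : Matrix.SpecialLinearGroup (Fin a ⊕ Fin b) ℂ)
      (U V : Matrix (Fin a ⊕ Fin b) (Fin a ⊕ Fin b) ℂ) :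
      U = (g : Matrix (Fin a ⊕ Fin b) (Fin a ⊕ Fin b) ℂ) * V *
          ((g⁻¹ : Matrix.SpecialLinearGroup (Fin a ⊕ Fin b) ℂ) :
            Matrix (Fin a ⊕ Fin b) (Fin a ⊕ Fin b) ℂ) ↔
        U * (g : Matrix (Fin a ⊕ Fin b) (Fin a ⊕ Fin b) ℂ) =
          (g : Matrix (Fin a ⊕ Fin b) (Fin a ⊕ Fin b) ℂ) * V := by
    constructor
    · rintro rfl
      rw [Matrix.mul_assoc, ← Matrix.SpecialLinearGroup.coe_mul, inv_mul_cancel,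
        Matrix.SpecialLinearGroup.coe_one, Matrix.mul_one]
    · intro h
      rw [← h, Matrix.mul_assoc, ← Matrix.SpecialLinearGroup.coe_mul, mul_inv_cancel,
        Matrix.SpecialLinearGroup.coe_one, Matrix.mul_one]
  simp only [hconj]
  constructor
  · rintro ⟨g, hg⟩
    obtain ⟨P, Q, R, S, hPQRS⟩ : ∃ P Q R S,
        (g : Matrix (Fin a ⊕ Fin b) (Fin a ⊕ Fin b) ℂ) = Matrix.fromBlocks P Q R S :=
      ⟨_, _, _, _, (Matrix.fromBlocks_toBlocks _).symm⟩
    simp only [hPQRS, rhoLam, Matrix.fromBlocks_multiply, Matrix.fromBlocks_inj, Matrix.zero_mul,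
      Matrix.mul_zero, zero_add, add_zero] at hg
    rcases eq_zero_or_mulVec_injective_of_intertwiner (fun γ => zpow_ne_zero _ hlam) hβirr
      (fun γ => (hg γ).2.2.2) with hS | hS
    · obtain ⟨P', Q', R', S', hg'⟩ : ∃ P' Q' R' S',
          ((g⁻¹ : Matrix.SpecialLinearGroup (Fin a ⊕ Fin b) ℂ) :
            Matrix (Fin a ⊕ Fin b) (Fin a ⊕ Fin b) ℂ) = Matrix.fromBlocks P' Q' R' S' :=
        ⟨_, _, _, _, (Matrix.fromBlocks_toBlocks _).symm⟩
      have hRQ : R * Q' = 1 := by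
        have h : (g : Matrix (Fin a ⊕ Fin b) (Fin a ⊕ Fin b) ℂ) *
            ((g⁻¹ : Matrix.SpecialLinearGroup (Fin a ⊕ Fin b) ℂ) :
              Matrix (Fin a ⊕ Fin b) (Fin a ⊕ Fin b) ℂ) = 1 := by
          rw [← Matrix.SpecialLinearGroup.coe_mul, mul_inv_cancel,
            Matrix.SpecialLinearGroup.coe_one]
        rw [hPQRS, hg', hS, Matrix.fromBlocks_multiply, ← Matrix.fromBlocks_one,
          Matrix.fromBlocks_inj] at h
        simpa using h.2.2.2
      rcases eq_zero_or_mulVec_injective_of_intertwiner (fun γ => zpow_ne_zero _ hlam) hαirr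
        (fun γ => (hg γ).2.2.1) with hR | hR
      · have : Nonempty (Fin b) := ⟨⟨0, hb⟩⟩
        rw [hR, Matrix.zero_mul] at hRQ
        exact absurd hRQ zero_ne_one
      · have hQR : Q' * R = 1 := by
          refine Matrix.ext_of_mulVec_single fun i => hR ?_
          rw [Matrix.mulVec_mulVec, ← Matrix.mul_assoc, hRQ, Matrix.one_mul, Matrix.one_mulVec]
        exact ⟨P * Q', fun γ => eq_mul_sub_mul_of_intertwiner hRQ hQR (hg γ).2.2.1 (hg γ).1⟩
    · have hunit := (Matrix.isUnit_iff_isUnit_det S).mp (Matrix.mulVec_injective_iff_isUnit.mp hS)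
      exact ⟨Q * S⁻¹, fun γ => eq_mul_sub_mul_of_intertwiner (Matrix.mul_nonsing_inv S hunit)
        (Matrix.nonsing_inv_mul S hunit) (hg γ).2.2.2 (hg γ).2.1⟩
  · rintro ⟨N, hN⟩
    refine ⟨⟨Matrix.fromBlocks 1 N 0 1, by simp⟩, fun γ => ?_⟩
    simp only [rhoLam, Matrix.fromBlocks_multiply, hN γ]
    simp
end
end

section
/- In the setup below, assume α and β are irreducible and that c: Γ → M_{a×b}(ℂ) is a cocycle which is NOT a coboundary. Then the subspaces of ℂⁿ invariant under ρ_λ^c(γ) for all γ ∈ Γ are exactly 0, ℂ^a × {0} (the span of the first a standard basis vectors), and ℂⁿ. In particular, the unique proper nonzero invariant subspace of ρ_λ^c(Γ) is ℂ^a × {0}. -/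
noncomputable section
open Matrix

variable {Γ : Type*} [Group Γ]

theorem rhoLam_mulVec (φ : Γ → ℤ) (a b : ℕ) (lam : ℂ)
    (α : Γ →* Matrix.SpecialLinearGroup (Fin a) ℂ)
    (β : Γ →* Matrix.SpecialLinearGroup (Fin b) ℂ)
    (c : Γ → Matrix (Fin a) (Fin b) ℂ) (γ : Γ) (v : Fin a ⊕ Fin b → ℂ) :
    (rhoLam φ a b lam α β c γ).mulVec v =
      Sum.elim
        (lam ^ ((b : ℤ) * φ γ) • (α γ : Matrix (Fin a) (Fin a) ℂ).mulVec (v ∘ Sum.inl) +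
          lam ^ (-(a : ℤ) * φ γ) •
            (c γ * (β γ : Matrix (Fin b) (Fin b) ℂ)).mulVec (v ∘ Sum.inr))
        (lam ^ (-(a : ℤ) * φ γ) • (β γ : Matrix (Fin b) (Fin b) ℂ).mulVec (v ∘ Sum.inr)) := by
  simp [rhoLam, Matrix.fromBlocks_mulVec, Matrix.smul_mulVec, Matrix.mul_smul]

/-- A subspace of `Kᵐ ⊕ Kⁿ` that meets `Kᵐ` trivially and projects onto `Kⁿ` is the graph of
a matrix. -/
theorem Submodule.exists_inl_eq_mulVec_inr {K m n : Type*} [Field K] [Fintype n]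
    [DecidableEq n] (W : Submodule K (m ⊕ n → K))
    (hinj : ∀ w ∈ W, w ∘ Sum.inr = 0 → w = 0)
    (hsurj : ∀ y : n → K, ∃ w ∈ W, w ∘ Sum.inr = y) :
    ∃ M : Matrix m n K, ∀ w ∈ W, w ∘ Sum.inl = M.mulVec (w ∘ Sum.inr) := by
  let p : W →ₗ[K] (n → K) := LinearMap.funLeft K K Sum.inr ∘ₗ W.subtype
  have hp : Function.Bijective p := by
    refine ⟨(injective_iff_map_eq_zero p).2 fun w hw => Subtype.ext (hinj w w.2 hw), fun y => ?_⟩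
    obtain ⟨w, hw, rfl⟩ := hsurj y
    exact ⟨⟨w, hw⟩, rfl⟩
  let e := LinearEquiv.ofBijective p hp
  refine ⟨LinearMap.toMatrix' (LinearMap.funLeft K K Sum.inl ∘ₗ W.subtype ∘ₗ e.symm.toLinearMap),
    fun w hw => ?_⟩
  have he : e.symm (w ∘ Sum.inr) = ⟨w, hw⟩ := e.symm_apply_eq.2 rfl
  rw [LinearMap.toMatrix'_mulVec]
  simp only [LinearMap.comp_apply, LinearEquiv.coe_coe, he]
  rfl

/-- If some `ρ_λ^c(Γ)`-invariant subspace is a complement of `ℂᵃ × {0}`, then `c` is a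
coboundary. -/
theorem isCobound_of_invariant_complement (φ : Γ → ℤ) (a b : ℕ) (lam : ℂ) (hlam : lam ≠ 0)
    (α : Γ →* Matrix.SpecialLinearGroup (Fin a) ℂ)
    (β : Γ →* Matrix.SpecialLinearGroup (Fin b) ℂ)
    (c : Γ → Matrix (Fin a) (Fin b) ℂ) (W : Submodule ℂ (Fin a ⊕ Fin b → ℂ))
    (hW : ∀ γ : Γ, ∀ v ∈ W, (rhoLam φ a b lam α β c γ).mulVec v ∈ W)
    (hinj : ∀ w ∈ W, w ∘ Sum.inr = 0 → w = 0)
    (hsurj : ∀ y : Fin b → ℂ, ∃ w ∈ W, w ∘ Sum.inr = y) :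
    IsCobound φ a b lam α β c := by
  obtain ⟨M, hM⟩ := W.exists_inl_eq_mulVec_inr hinj hsurj
  refine ⟨-M, fun γ => ?_⟩
  have key : lam ^ (((a + b : ℕ) : ℤ) * φ γ) • ((α γ : Matrix (Fin a) (Fin a) ℂ) * M) +
      c γ * (β γ : Matrix (Fin b) (Fin b) ℂ) = M * (β γ : Matrix (Fin b) (Fin b) ℂ) := by
    refine Matrix.ext_of_mulVec_single fun j => ?_
    obtain ⟨w, hw, hwy⟩ := hsurj (Pi.single j 1)
    rw [← hwy]
    have h := hM _ (hW γ w hw)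
    rw [rhoLam_mulVec, Sum.elim_comp_inl, Sum.elim_comp_inr, hM w hw, Matrix.mulVec_smul] at h
    have hpow : lam ^ ((b : ℤ) * φ γ) =
        lam ^ (-(a : ℤ) * φ γ) * lam ^ (((a + b : ℕ) : ℤ) * φ γ) := by
      rw [← zpow_add₀ hlam]
      congr 1
      push_cast
      ring
    rw [hpow, mul_smul, ← smul_add] at h
    simpa [Matrix.add_mulVec, Matrix.smul_mulVec, Matrix.mulVec_mulVec] using
      smul_right_injective _ (zpow_ne_zero _ hlam) h
  have hβ : (β γ : Matrix (Fin b) (Fin b) ℂ) *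
      (((β γ)⁻¹ : Matrix.SpecialLinearGroup (Fin b) ℂ) : Matrix (Fin b) (Fin b) ℂ) = 1 := by
    rw [← Matrix.SpecialLinearGroup.coe_mul, mul_inv_cancel, Matrix.SpecialLinearGroup.coe_one]
  have h := congrArg (· * (((β γ)⁻¹ : Matrix.SpecialLinearGroup (Fin b) ℂ) :
    Matrix (Fin b) (Fin b) ℂ)) key
  simp only [Matrix.add_mul, Matrix.smul_mul, Matrix.mul_assoc, hβ, Matrix.mul_one] at h
  rw [Matrix.mul_neg, Matrix.neg_mul, smul_neg, sub_neg_eq_add, Matrix.mul_assoc]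
  exact eq_neg_add_of_add_eq h

/-- **Lemma 7.8.** Assume `α` and `β` are irreducible and `c` is a cocycle which is not a
coboundary.  Then the `ρ_λ^c(Γ)`-invariant subspaces of `ℂⁿ` are exactly `0`,
`ℂᵃ × {0}` (the kernel of the projection onto the last `b` coordinates) and `ℂⁿ`. -/
theorem rhoLam_invariant_subspaces
    (φ : Γ → ℤ) (hφ : ∀ g h : Γ, φ (g * h) = φ g + φ h)
    (a b : ℕ) (ha : 1 ≤ a) (hb : 1 ≤ b)
    (lam : ℂ) (hlam : lam ≠ 0)
    (α : Γ →* Matrix.SpecialLinearGroup (Fin a) ℂ)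
    (β : Γ →* Matrix.SpecialLinearGroup (Fin b) ℂ)
    (hαirr : ∀ W : Submodule ℂ (Fin a → ℂ),
      (∀ γ : Γ, ∀ v ∈ W, (α γ : Matrix (Fin a) (Fin a) ℂ).mulVec v ∈ W) → W = ⊥ ∨ W = ⊤)
    (hβirr : ∀ W : Submodule ℂ (Fin b → ℂ),
      (∀ γ : Γ, ∀ v ∈ W, (β γ : Matrix (Fin b) (Fin b) ℂ).mulVec v ∈ W) → W = ⊥ ∨ W = ⊤)
    (c : Γ → Matrix (Fin a) (Fin b) ℂ) (hc : IsCocyc φ a b lam α β c)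
    (hnc : ¬ IsCobound φ a b lam α β c) :
    ∀ W : Submodule ℂ (Fin a ⊕ Fin b → ℂ),
      (∀ γ : Γ, ∀ v ∈ W, (rhoLam φ a b lam α β c γ).mulVec v ∈ W) ↔
        (W = ⊥ ∨
         W = LinearMap.ker (LinearMap.funLeft ℂ ℂ (Sum.inr : Fin b → Fin a ⊕ Fin b)) ∨
         W = ⊤) := by
  intro W
  constructor
  · intro hW
    let W₁ : Submodule ℂ (Fin a → ℂ) :=
      W.comap (LinearEquiv.sumArrowLequivProdArrow (Fin a) (Fin b) ℂ ℂ).symm.toLinearMap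
        |>.comap (LinearMap.inl ℂ _ _)
    have mem₁ (x : Fin a → ℂ) : x ∈ W₁ ↔ Sum.elim x 0 ∈ W := Iff.rfl
    let W₂ : Submodule ℂ (Fin b → ℂ) := W.map (LinearMap.funLeft ℂ ℂ Sum.inr)
    have mem₂ (y : Fin b → ℂ) : y ∈ W₂ ↔ ∃ w ∈ W, w ∘ Sum.inr = y := Iff.rfl
    have elim_eq (w : Fin a ⊕ Fin b → ℂ) (hw : w ∘ Sum.inr = 0) :
        Sum.elim (w ∘ Sum.inl) 0 = w := by
      rw [← hw, Sum.elim_comp_inl_inr]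
    have h₁ : W₁ = ⊥ ∨ W₁ = ⊤ := by
      refine hαirr W₁ fun γ x hx => ?_
      have h := hW γ _ ((mem₁ x).1 hx)
      rw [rhoLam_mulVec, Sum.elim_comp_inl, Sum.elim_comp_inr, Matrix.mulVec_zero,
        Matrix.mulVec_zero, smul_zero, smul_zero, add_zero, ← mem₁] at h
      exact (W₁.smul_mem_iff (zpow_ne_zero _ hlam)).1 h
    have h₂ : W₂ = ⊥ ∨ W₂ = ⊤ := by
      refine hβirr W₂ fun γ y hy => ?_
      obtain ⟨w, hw, rfl⟩ := (mem₂ y).1 hy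
      refine (W₂.smul_mem_iff (zpow_ne_zero (-(a : ℤ) * φ γ) hlam)).1
        ((mem₂ _).2 ⟨_, hW γ w hw, ?_⟩)
      rw [rhoLam_mulVec, Sum.elim_comp_inr]
    have inr_eq_zero (h : W₂ = ⊥) (w) (hw : w ∈ W) : w ∘ Sum.inr = 0 :=
      (Submodule.mem_bot ℂ).1 (h ▸ (mem₂ _).2 ⟨w, hw, rfl⟩)
    have eq_zero (h : W₁ = ⊥) (w) (hw : w ∈ W) (hw' : w ∘ Sum.inr = 0) : w = 0 := by
      have hl : w ∘ Sum.inl ∈ W₁ := (mem₁ _).2 (by rwa [elim_eq w hw'])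
      rw [h, Submodule.mem_bot] at hl
      rw [← elim_eq w hw', hl, Sum.elim_zero_zero]
    have mem_of_inr (h : W₁ = ⊤) (w : Fin a ⊕ Fin b → ℂ) (hw : w ∘ Sum.inr = 0) : w ∈ W := by
      rw [← elim_eq w hw, ← mem₁, h]
      trivial
    rcases h₁ with h₁ | h₁ <;> rcases h₂ with h₂ | h₂
    · exact .inl ((Submodule.eq_bot_iff W).2 fun w hw => eq_zero h₁ w hw (inr_eq_zero h₂ w hw))
    · exact absurd (isCobound_of_invariant_complement φ a b lam hlam α β c W hW (eq_zero h₁)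
        fun y => (mem₂ y).1 (h₂ ▸ Submodule.mem_top)) hnc
    · exact .inr (.inl (le_antisymm (inr_eq_zero h₂) (mem_of_inr h₁)))
    · refine .inr (.inr ((Submodule.eq_top_iff').2 fun v => ?_))
      obtain ⟨w, hw, hwv⟩ := (mem₂ (v ∘ Sum.inr)).1 (h₂ ▸ Submodule.mem_top)
      refine (W.sub_mem_iff_left hw).1 (mem_of_inr h₁ (v - w) ?_)
      exact sub_eq_zero.2 hwv.symm
  · rintro (rfl | rfl | rfl) γ v hv
    · rw [(Submodule.mem_bot ℂ).1 hv, Matrix.mulVec_zero]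
      exact Submodule.zero_mem _
    · have hv' : v ∘ Sum.inr = 0 := hv
      change (rhoLam φ a b lam α β c γ).mulVec v ∘ Sum.inr = 0
      rw [rhoLam_mulVec, Sum.elim_comp_inr, hv', Matrix.mulVec_zero, smul_zero]
    · trivial
end
end

section
/- In the setup below, assume: α and β are irreducible; c: Γ → M_{a×b}(ℂ) is a cocycle which is not a coboundary; and the only matrix A ∈ M_{a×b}(ℂ) satisfying λ^{nφ(γ)} α(γ) A β(γ)⁻¹ = A for all γ ∈ Γ is A = 0. Then the only n×n complex matrix X with trace zero whose lower-left b×a block is zero and which satisfies ρ_λ^c(γ) X ρ_λ^c(γ)⁻¹ = X for all γ ∈ Γ is X = 0. (Equivalently, H⁰(Γ; 𝔭⁺) = 0 for the parabolic subalgebra 𝔭⁺ of block upper-triangular trace-zero matrices under the adjoint action of ρ⁺ = ρ_λ^c.) -/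
noncomputable section
open Matrix

variable {Γ : Type*} [Group Γ]

/-- **Schur's lemma** for matrices: a complex matrix commuting with a family of matrices which has
no nontrivial invariant subspace is scalar. -/
theorem Matrix.exists_eq_smul_one_of_commute_of_irreducible {ι : Type*} {k : ℕ} (hk : 1 ≤ k)
    (ρ : ι → Matrix (Fin k) (Fin k) ℂ)
    (hρ : ∀ W : Submodule ℂ (Fin k → ℂ), (∀ i, ∀ v ∈ W, (ρ i).mulVec v ∈ W) → W = ⊥ ∨ W = ⊤)
    (P : Matrix (Fin k) (Fin k) ℂ) (hP : ∀ i, Commute (ρ i) P) :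
    ∃ p : ℂ, P = p • (1 : Matrix (Fin k) (Fin k) ℂ) := by
  have : Nonempty (Fin k) := ⟨⟨0, hk⟩⟩
  obtain ⟨p, hp⟩ := Module.End.exists_eigenvalue (Matrix.toLin' P)
  refine ⟨p, ?_⟩
  have hinv : ∀ i, ∀ v ∈ Module.End.eigenspace (Matrix.toLin' P) p,
      (ρ i).mulVec v ∈ Module.End.eigenspace (Matrix.toLin' P) p := by
    intro i v hv
    rw [Module.End.mem_eigenspace_iff, Matrix.toLin'_apply] at hv ⊢
    rw [Matrix.mulVec_mulVec, ← (hP i).eq, ← Matrix.mulVec_mulVec, hv, Matrix.mulVec_smul]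
  have htop := (hρ _ hinv).resolve_left hp
  refine Matrix.ext_of_mulVec_single fun j => ?_
  have hmem : Pi.single j 1 ∈ Module.End.eigenspace (Matrix.toLin' P) p := htop ▸ Submodule.mem_top
  rw [Module.End.mem_eigenspace_iff, Matrix.toLin'_apply] at hmem
  rw [hmem, Matrix.smul_mulVec, Matrix.one_mulVec]

theorem det_rhoLam (φ : Γ → ℤ) (a b : ℕ) {lam : ℂ} (hlam : lam ≠ 0)
    (α : Γ →* Matrix.SpecialLinearGroup (Fin a) ℂ)
    (β : Γ →* Matrix.SpecialLinearGroup (Fin b) ℂ)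
    (c : Γ → Matrix (Fin a) (Fin b) ℂ) (γ : Γ) :
    (rhoLam φ a b lam α β c γ).det = 1 := by
  rw [rhoLam, Matrix.det_fromBlocks_zero₂₁, Matrix.det_smul, Matrix.det_smul,
    Matrix.SpecialLinearGroup.det_coe, Matrix.SpecialLinearGroup.det_coe, Fintype.card_fin,
    Fintype.card_fin, mul_one, mul_one, ← zpow_natCast, ← zpow_natCast, ← _root_.zpow_mul,
    ← _root_.zpow_mul, ← zpow_add₀ hlam]
  convert zpow_zero lam using 2
  ring

/-- **Lemma 7.1.** Assume `α` and `β` are irreducible, `c` is a cocycle which is not a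
coboundary, and the only matrix `A` with `λ^{nφ(γ)} α(γ) A β(γ)⁻¹ = A` for all `γ` is `A = 0`
(i.e. `H⁰(Γ; M⁺_{λⁿ}) = 0`).  Then the only trace-zero matrix `X` with vanishing lower-left
block satisfying `ρ_λ^c(γ) X ρ_λ^c(γ)⁻¹ = X` for all `γ` is `X = 0`; that is,
`H⁰(Γ; 𝔭⁺) = 0`. -/
theorem h0_parabolic_eq_zero
    (φ : Γ → ℤ) (hφ : ∀ g h : Γ, φ (g * h) = φ g + φ h)
    (a b : ℕ) (ha : 1 ≤ a) (hb : 1 ≤ b)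
    (lam : ℂ) (hlam : lam ≠ 0)
    (α : Γ →* Matrix.SpecialLinearGroup (Fin a) ℂ)
    (β : Γ →* Matrix.SpecialLinearGroup (Fin b) ℂ)
    (hαirr : ∀ W : Submodule ℂ (Fin a → ℂ),
      (∀ γ : Γ, ∀ v ∈ W, (α γ : Matrix (Fin a) (Fin a) ℂ).mulVec v ∈ W) → W = ⊥ ∨ W = ⊤)
    (hβirr : ∀ W : Submodule ℂ (Fin b → ℂ),
      (∀ γ : Γ, ∀ v ∈ W, (β γ : Matrix (Fin b) (Fin b) ℂ).mulVec v ∈ W) → W = ⊥ ∨ W = ⊤)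
    (c : Γ → Matrix (Fin a) (Fin b) ℂ) (hc : IsCocyc φ a b lam α β c)
    (hnc : ¬ IsCobound φ a b lam α β c)
    (hH0 : ∀ A : Matrix (Fin a) (Fin b) ℂ,
      (∀ γ : Γ, lam ^ (((a + b : ℕ) : ℤ) * φ γ) •
          ((α γ : Matrix (Fin a) (Fin a) ℂ) * A *
            (((β γ)⁻¹ : Matrix.SpecialLinearGroup (Fin b) ℂ) :
              Matrix (Fin b) (Fin b) ℂ)) = A) → A = 0) :
    ∀ X : Matrix (Fin a ⊕ Fin b) (Fin a ⊕ Fin b) ℂ,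
      X.trace = 0 → X.toBlocks₂₁ = 0 →
      (∀ γ : Γ, rhoLam φ a b lam α β c γ * X * (rhoLam φ a b lam α β c γ)⁻¹ = X) →
      X = 0 := by
  intro X htr h21 hX
  obtain ⟨P, Q, R, rfl⟩ : ∃ P Q R, X = Matrix.fromBlocks P Q 0 R :=
    ⟨_, _, _, by rw [← h21, Matrix.fromBlocks_toBlocks]⟩
  have hu (k : ℤ) : lam ^ k ≠ 0 := zpow_ne_zero _ hlam
  have hcomm (γ : Γ) : rhoLam φ a b lam α β c γ * Matrix.fromBlocks P Q 0 R =
      Matrix.fromBlocks P Q 0 R * rhoLam φ a b lam α β c γ := by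
    have hdet : IsUnit (rhoLam φ a b lam α β c γ).det := by
      rw [det_rhoLam φ a b hlam]
      exact isUnit_one
    conv_rhs => rw [← hX γ]
    rw [Matrix.nonsing_inv_mul_cancel_right _ _ hdet]
  simp only [rhoLam, Matrix.fromBlocks_multiply, Matrix.fromBlocks_inj, Matrix.mul_zero,
    Matrix.zero_mul, smul_zero, add_zero, zero_add, Matrix.smul_mul, Matrix.mul_smul] at hcomm
  obtain ⟨p, rfl⟩ := Matrix.exists_eq_smul_one_of_commute_of_irreducible ha _ hαirr P
    fun γ => smul_right_injective _ (hu _) (hcomm γ).1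
  obtain ⟨r, rfl⟩ := Matrix.exists_eq_smul_one_of_commute_of_irreducible hb _ hβirr R
    fun γ => smul_right_injective _ (hu _) (hcomm γ).2.2.2
  have hQ (γ : Γ) : lam ^ (((a + b : ℕ) : ℤ) * φ γ) •
      ((α γ : Matrix (Fin a) (Fin a) ℂ) * Q *
        (((β γ)⁻¹ : Matrix.SpecialLinearGroup (Fin b) ℂ) : Matrix (Fin b) (Fin b) ℂ)) =
      Q + (p - r) • c γ := by
    have hββ : (β γ : Matrix (Fin b) (Fin b) ℂ) *
        (((β γ)⁻¹ : Matrix.SpecialLinearGroup (Fin b) ℂ) : Matrix (Fin b) (Fin b) ℂ) = 1 := by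
      rw [← Matrix.SpecialLinearGroup.coe_mul, mul_inv_cancel, Matrix.SpecialLinearGroup.coe_one]
    have h12 := congrArg (· * (((β γ)⁻¹ : Matrix.SpecialLinearGroup (Fin b) ℂ) :
      Matrix (Fin b) (Fin b) ℂ)) (hcomm γ).2.1
    simp only [Matrix.add_mul, Matrix.smul_mul, Matrix.mul_smul, Matrix.one_mul, Matrix.mul_one,
      Matrix.mul_assoc, hββ] at h12
    have hexp : lam ^ ((b : ℤ) * φ γ) =
        lam ^ (-(a : ℤ) * φ γ) * lam ^ (((a + b : ℕ) : ℤ) * φ γ) := by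
      rw [← zpow_add₀ hlam]
      congr 1
      push_cast
      ring
    rw [hexp, mul_smul] at h12
    apply smul_right_injective _ (hu (-(a : ℤ) * φ γ))
    simp only [Matrix.mul_assoc]
    rw [eq_sub_of_add_eq h12]
    module
  have hpr : p = r := by
    by_contra hne
    have hne' : p - r ≠ 0 := sub_ne_zero.mpr hne
    refine hnc ⟨(p - r)⁻¹ • Q, fun γ => ?_⟩
    rw [Matrix.mul_smul, Matrix.smul_mul, smul_comm, hQ γ, smul_add, inv_smul_smul₀ hne',
      add_sub_cancel_left]
  subst hpr
  have hQ0 : Q = 0 := hH0 Q fun γ => by rw [hQ γ, sub_self, zero_smul, add_zero]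
  have hp : p = 0 := by
    rw [Matrix.trace, Fintype.sum_sum_type] at htr
    change Matrix.trace (p • (1 : Matrix (Fin a) (Fin a) ℂ)) +
      Matrix.trace (p • (1 : Matrix (Fin b) (Fin b) ℂ)) = 0 at htr
    rw [Matrix.trace_smul, Matrix.trace_smul, Matrix.trace_one,
      Matrix.trace_one, Fintype.card_fin, Fintype.card_fin, ← smul_add, smul_eq_mul] at htr
    refine (mul_eq_zero.mp htr).resolve_right ?_
    exact_mod_cast (by lia : a + b ≠ 0)
  rw [hQ0, hp, zero_smul, zero_smul, Matrix.fromBlocks_zero]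
end
end

section
/- Let Γ = ⟨x, y ∣ x² = y³⟩ be the trefoil knot group, and let η = e^{iπ/3} (a primitive sixth root of unity). For s ∈ ℂ define α_s: Γ → SL₂(ℂ) on the generators by α_s(x) = [[i, 0], [s, −i]] and α_s(y) = [[η, η̄ − η], [0, η̄]] (this is well defined since α_s(x)² = α_s(y)³ = −Id₂). Then every irreducible representation ρ: Γ → SL₂(ℂ) is conjugate in SL₂(ℂ) to α_s for a unique s ∈ ℂ. -/
/-- The single relator `x² y⁻³` of the trefoil knot group. -/
def trefoilRels : Set (FreeGroup Bool) := {FreeGroup.of true ^ 2 * (FreeGroup.of false ^ 3)⁻¹}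

/-- The trefoil knot group `⟨x, y ∣ x² = y³⟩`. -/
abbrev TrefoilGroup := PresentedGroup trefoilRels

/-- The generator `x`. -/
def trefX : TrefoilGroup := PresentedGroup.of true

/-- The generator `y`. -/
def trefY : TrefoilGroup := PresentedGroup.of false

/-- `η = e^{iπ/3}`, a primitive sixth root of unity. -/
noncomputable def eta : ℂ := Complex.exp (Real.pi * Complex.I / 3)

lemma eta_eq : eta = 1 / 2 + (Real.sqrt 3 / 2 : ℝ) * Complex.I := by
  have h : (Real.pi * Complex.I / 3 : ℂ) = ((Real.pi / 3 : ℝ) : ℂ) * Complex.I := by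
    push_cast; ring
  rw [eta, h, Complex.exp_mul_I, ← Complex.ofReal_cos, ← Complex.ofReal_sin,
    Real.cos_pi_div_three, Real.sin_pi_div_three]
  push_cast; ring

lemma conj_eta : (starRingEnd ℂ) eta = 1 - eta := by
  rw [eta_eq]
  push_cast
  simp only [map_add, map_mul, map_div₀, map_one, map_ofNat, Complex.conj_ofReal, Complex.conj_I]
  ring

lemma eta_sq : eta ^ 2 = eta - 1 := by
  have h : ((Real.sqrt 3 : ℝ) : ℂ) ^ 2 = 3 := by
    rw [← Complex.ofReal_pow, Real.sq_sqrt (by norm_num)]; norm_num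
  rw [eta_eq]
  push_cast
  linear_combination (1 / 4 * Complex.I ^ 2) * h + 3 / 4 * Complex.I_sq

lemma one_sub_eta_sub_eta_ne_zero : 1 - eta - eta ≠ 0 := by
  intro h
  have h3 : (1 - eta - eta) ^ 2 = -3 := by linear_combination 4 * eta_sq
  rw [h] at h3
  norm_num at h3

open Matrix in
/-- A `2 × 2` matrix over `ℂ` is annihilated by its characteristic polynomial. -/
lemma sq_eq_trace_smul_sub_det (M : Matrix (Fin 2) (Fin 2) ℂ) :
    M ^ 2 = M.trace • M - M.det • (1 : Matrix (Fin 2) (Fin 2) ℂ) := by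
  ext i j
  fin_cases i <;> fin_cases j <;>
    simp [sq, Matrix.mul_apply, Matrix.trace_fin_two, Matrix.det_fin_two, Fin.sum_univ_two] <;>
    ring

open Matrix in
lemma exists_mulVec_eq_smul (M : Matrix (Fin 2) (Fin 2) ℂ) :
    ∃ v : Fin 2 → ℂ, v ≠ 0 ∧ ∃ a : ℂ, M *ᵥ v = a • v := by
  obtain ⟨a, ha⟩ := Module.End.exists_eigenvalue (Matrix.toLin' M)
  obtain ⟨v, hv⟩ := ha.exists_hasEigenvector
  exact ⟨v, hv.2, a, by simpa using hv.apply_eq_smul⟩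

/-- Homomorphisms out of the trefoil group are determined by the images of the generators. -/
lemma trefoil_hom_ext {G : Type*} [Group G] {φ ψ : TrefoilGroup →* G}
    (hx : φ trefX = ψ trefX) (hy : φ trefY = ψ trefY) : φ = ψ := by
  apply PresentedGroup.ext
  rintro (_ | _)
  exacts [hy, hx]

lemma trefX_sq : trefX ^ 2 = trefY ^ 3 := by
  have h : PresentedGroup.mk trefoilRels
      (FreeGroup.of true ^ 2 * (FreeGroup.of false ^ 3)⁻¹) = 1 :=
    PresentedGroup.one_of_mem (Set.mem_singleton _)
  rw [map_mul, map_inv, map_pow, map_pow] at h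
  exact mul_inv_eq_one.mp h

open Matrix in
/-- The images of the generators under an irreducible representation have no common
eigenvector. -/
lemma no_common_eigenvector (ρ : TrefoilGroup →* Matrix.SpecialLinearGroup (Fin 2) ℂ)
    (hirr : ∀ W : Submodule ℂ (Fin 2 → ℂ),
      (∀ γ : TrefoilGroup, ∀ v ∈ W, (ρ γ : Matrix (Fin 2) (Fin 2) ℂ) *ᵥ v ∈ W) →
      W = ⊥ ∨ W = ⊤)
    (v : Fin 2 → ℂ) (hv : v ≠ 0) (a b : ℂ)
    (hx : (ρ trefX : Matrix (Fin 2) (Fin 2) ℂ) *ᵥ v = a • v)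
    (hy : (ρ trefY : Matrix (Fin 2) (Fin 2) ℂ) *ᵥ v = b • v) : False := by
  have key : ∀ γ : TrefoilGroup, ∃ c : ℂ, (ρ γ : Matrix (Fin 2) (Fin 2) ℂ) *ᵥ v = c • v := by
    intro γ
    have hγ : γ ∈ Subgroup.closure (Set.range (PresentedGroup.of (rels := trefoilRels))) := by
      rw [PresentedGroup.closure_range_of]; trivial
    induction hγ using Subgroup.closure_induction with
    | mem γ h =>
      obtain ⟨i, rfl⟩ := h
      cases i
      exacts [⟨b, hy⟩, ⟨a, hx⟩]
    | one => exact ⟨1, by simp⟩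
    | mul γ δ _ _ h₁ h₂ =>
      obtain ⟨c, hc⟩ := h₁
      obtain ⟨d, hd⟩ := h₂
      refine ⟨d * c, ?_⟩
      rw [map_mul, Matrix.SpecialLinearGroup.coe_mul, ← Matrix.mulVec_mulVec, hd,
        Matrix.mulVec_smul, hc, smul_smul]
    | inv γ _ h =>
      obtain ⟨c, hc⟩ := h
      have h1 : (ρ γ⁻¹ : Matrix (Fin 2) (Fin 2) ℂ) *ᵥ ((ρ γ : Matrix (Fin 2) (Fin 2) ℂ) *ᵥ v)
          = v := by
        rw [Matrix.mulVec_mulVec, ← Matrix.SpecialLinearGroup.coe_mul, ← map_mul]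
        simp
      rw [hc, Matrix.mulVec_smul] at h1
      have hc0 : c ≠ 0 := by
        rintro rfl
        exact hv (by simpa using h1.symm)
      exact ⟨c⁻¹, by rw [eq_inv_smul_iff₀ hc0, h1]⟩
  rcases hirr (Submodule.span ℂ {v}) (fun γ w hw => by
    obtain ⟨k, rfl⟩ := Submodule.mem_span_singleton.mp hw
    obtain ⟨c, hc⟩ := key γ
    rw [Matrix.mulVec_smul, hc]
    exact Submodule.smul_mem _ _ (Submodule.smul_mem _ _
      (Submodule.mem_span_singleton_self v))) with h | h
  · exact hv (by simpa using h)
  · have h1 := finrank_span_singleton (K := ℂ) hv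
    rw [h, finrank_top] at h1
    simp at h1

open Matrix in
/-- If unimodular `P`, `Q` satisfy `P² = Q³` and have no common eigenvector, then
`tr P = 0` and `tr Q = 1`. -/
lemma trace_eq_of_sq_eq_cube {P Q : Matrix (Fin 2) (Fin 2) ℂ} (hP : P.det = 1) (hQ : Q.det = 1)
    (hPQ : P ^ 2 = Q ^ 3)
    (hne : ∀ v : Fin 2 → ℂ, v ≠ 0 → ∀ a b : ℂ, P *ᵥ v = a • v → Q *ᵥ v = b • v → False) :
    P.trace = 0 ∧ Q.trace = 1 := by
  have cP := sq_eq_trace_smul_sub_det P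
  have cQ := sq_eq_trace_smul_sub_det Q
  rw [hP, one_smul] at cP
  rw [hQ, one_smul] at cQ
  have hQ3 : Q ^ 3 = (Q.trace ^ 2 - 1) • Q - Q.trace • (1 : Matrix (Fin 2) (Fin 2) ℂ) := by
    rw [pow_succ, cQ, sub_mul, smul_mul_assoc, ← sq, cQ, one_mul]
    module
  have hE : P.trace • P - 1 = (Q.trace ^ 2 - 1) • Q - Q.trace • (1 : Matrix (Fin 2) (Fin 2) ℂ) := by
    rw [← cP, hPQ, hQ3]
  have hv : ∀ v : Fin 2 → ℂ,
      P.trace • (P *ᵥ v) - v = (Q.trace ^ 2 - 1) • (Q *ᵥ v) - Q.trace • v := by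
    intro v
    have := congrArg (· *ᵥ v) hE
    simpa only [Matrix.sub_mulVec, Matrix.smul_mulVec, Matrix.one_mulVec] using this
  have ht : P.trace = 0 := by
    by_contra ht
    obtain ⟨v, hv0, b, hb⟩ := exists_mulVec_eq_smul Q
    refine hne v hv0 (P.trace⁻¹ * ((Q.trace ^ 2 - 1) * b - Q.trace + 1)) b ?_ hb
    have h := hv v
    rw [hb] at h
    rw [mul_smul, eq_inv_smul_iff₀ ht, sub_eq_iff_eq_add.mp h]
    module
  have hr : Q.trace ^ 2 - 1 = 0 := by
    by_contra hr
    obtain ⟨v, hv0, a, ha⟩ := exists_mulVec_eq_smul P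
    refine hne v hv0 a ((Q.trace ^ 2 - 1)⁻¹ * (Q.trace - 1)) ha ?_
    have h := hv v
    rw [ht, zero_smul] at h
    rw [mul_smul, eq_inv_smul_iff₀ hr, sub_eq_iff_eq_add.mp h.symm]
    module
  refine ⟨ht, ?_⟩
  have h := congrFun (congrArg (fun M : Matrix (Fin 2) (Fin 2) ℂ => M 0) hE) 0
  rw [ht, hr] at h
  simpa using h.symm

open Matrix in
/-- Simultaneous normal form of two unimodular matrices of traces `0` and `1` with no common
eigenvector. -/
lemma exists_normal_form {P Q : Matrix (Fin 2) (Fin 2) ℂ} (hP : P.det = 1) (hQ : Q.det = 1)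
    (htP : P.trace = 0) (htQ : Q.trace = 1)
    (hne : ∀ v : Fin 2 → ℂ, v ≠ 0 → ∀ a b : ℂ, P *ᵥ v = a • v → Q *ᵥ v = b • v → False) :
    ∃ (s : ℂ) (g : Matrix.SpecialLinearGroup (Fin 2) ℂ),
      P * g = g * !![Complex.I, 0; s, -Complex.I] ∧
      Q * g = g * !![eta, 1 - eta - eta; 0, 1 - eta] := by
  have hd := one_sub_eta_sub_eta_ne_zero
  have cQ := sq_eq_trace_smul_sub_det Q
  rw [hQ, htQ, one_smul, one_smul] at cQ
  obtain ⟨w, hw0, hPw⟩ : ∃ w : Fin 2 → ℂ, w ≠ 0 ∧ P *ᵥ w = (-Complex.I) • w := by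
    have hdet : (P + Complex.I • (1 : Matrix (Fin 2) (Fin 2) ℂ)).det = 0 := by
      rw [Matrix.det_fin_two] at hP ⊢
      rw [Matrix.trace_fin_two] at htP
      simp
      linear_combination hP + Complex.I * htP + Complex.I_sq
    obtain ⟨w, hw0, hw⟩ := Matrix.exists_mulVec_eq_zero_iff.mpr hdet
    refine ⟨w, hw0, ?_⟩
    rw [Matrix.add_mulVec, Matrix.smul_mulVec, Matrix.one_mulVec] at hw
    rw [neg_smul, eq_neg_of_add_eq_zero_left hw]
  obtain ⟨u, hQw⟩ : ∃ u : Fin 2 → ℂ, Q *ᵥ w = (1 - eta - eta) • u + (1 - eta) • w :=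
    ⟨(1 - eta - eta)⁻¹ • (Q *ᵥ w - (1 - eta) • w), by rw [smul_inv_smul₀ hd]; abel⟩
  have hQu : Q *ᵥ u = eta • u := by
    have h1 : Q *ᵥ (Q *ᵥ w) = Q *ᵥ w - w := by
      rw [Matrix.mulVec_mulVec, ← sq, cQ, Matrix.sub_mulVec, Matrix.one_mulVec]
    rw [hQw, Matrix.mulVec_add, Matrix.mulVec_smul, Matrix.mulVec_smul, hQw] at h1
    apply smul_right_injective _ hd
    ext i
    have h2 := congrFun h1 i
    simp only [Pi.add_apply, Pi.sub_apply, Pi.smul_apply, smul_eq_mul] at h2 ⊢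
    linear_combination h2 - w i * eta_sq
  have hu0 : u ≠ 0 := by
    rintro rfl
    exact hne w hw0 _ (1 - eta) hPw (by simpa using hQw)
  have hdet : u 0 * w 1 - w 0 * u 1 ≠ 0 := by
    intro h
    have h' : (!![u 0, w 0; u 1, w 1]).det = 0 := by rw [Matrix.det_fin_two_of, h]
    obtain ⟨c, hc0, hc⟩ := Matrix.exists_mulVec_eq_zero_iff.mpr h'
    have hcw : c 0 • u + c 1 • w = 0 := by
      ext i
      have := congrFun hc i
      fin_cases i <;> simp [Matrix.mulVec, dotProduct, Fin.sum_univ_two] at this ⊢ <;>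
        linear_combination this
    have hc1 : c 1 ≠ 0 := by
      intro h1
      rw [h1, zero_smul, add_zero, smul_eq_zero_iff_left hu0] at hcw
      exact hc0 (by ext i; fin_cases i <;> simp [h1, hcw])
    refine hne w hw0 _ eta hPw ?_
    apply smul_right_injective _ hc1
    have h2 : c 1 • w = -(c 0 • u) := eq_neg_of_add_eq_zero_right hcw
    simp only
    rw [← Matrix.mulVec_smul, smul_comm, h2, Matrix.mulVec_neg, Matrix.mulVec_smul, hQu, smul_neg,
      smul_comm]
  obtain ⟨c, hc⟩ := IsAlgClosed.exists_pow_nat_eq (u 0 * w 1 - w 0 * u 1)⁻¹ (n := 2) (by norm_num)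
  have hgdet : (!![c * u 0, c * w 0; c * u 1, c * w 1]).det = 1 := by
    rw [Matrix.det_fin_two_of]
    linear_combination (u 0 * w 1 - w 0 * u 1) * hc + inv_mul_cancel₀ hdet
  set g : Matrix.SpecialLinearGroup (Fin 2) ℂ := ⟨_, hgdet⟩ with hg
  have hPw0 := congrFun hPw 0
  have hPw1 := congrFun hPw 1
  have hQw0 := congrFun hQw 0
  have hQw1 := congrFun hQw 1
  have hQu0 := congrFun hQu 0
  have hQu1 := congrFun hQu 1
  simp only [Matrix.mulVec, dotProduct, Fin.sum_univ_two, Pi.add_apply, Pi.smul_apply,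
    smul_eq_mul] at hPw0 hPw1 hQw0 hQw1 hQu0 hQu1
  rw [Matrix.trace_fin_two] at htP
  obtain ⟨s, hs⟩ : ∃ s : ℂ, (u 0 * w 1 - w 0 * u 1) * s =
      u 0 * (P 1 0 * u 0 + P 1 1 * u 1) - u 1 * (P 0 0 * u 0 + P 0 1 * u 1) :=
    ⟨_, mul_div_cancel₀ _ hdet⟩
  have hPu0 : P 0 0 * u 0 + P 0 1 * u 1 = Complex.I * u 0 + s * w 0 := by
    apply mul_left_cancel₀ hdet
    linear_combination u 0 * (u 0 * w 1 - w 0 * u 1) * htP - u 0 * (u 0 * hPw1 - u 1 * hPw0)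
      - w 0 * hs
  have hPu1 : P 1 0 * u 0 + P 1 1 * u 1 = Complex.I * u 1 + s * w 1 := by
    apply mul_left_cancel₀ hdet
    linear_combination u 1 * (u 0 * w 1 - w 0 * u 1) * htP - u 1 * (u 0 * hPw1 - u 1 * hPw0)
      - w 1 * hs
  refine ⟨s, g, ?_, ?_⟩
  · ext i j
    fin_cases i <;> fin_cases j <;> simp [hg, Matrix.mul_apply, Fin.sum_univ_two]
    · linear_combination c * hPu0
    · linear_combination c * hPw0
    · linear_combination c * hPu1
    · linear_combination c * hPw1
  · ext i j
    fin_cases i <;> fin_cases j <;> simp [hg, Matrix.mul_apply, Fin.sum_univ_two]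
    · linear_combination c * hQu0
    · linear_combination c * hQw0
    · linear_combination c * hQu1
    · linear_combination c * hQw1

/-- **Lemma 9.1 (classification part).** Let `α_s : Γ → SL₂(ℂ)` be the family of
representations of the trefoil knot group with `α_s(x) = [[i, 0], [s, -i]]` and
`α_s(y) = [[η, η̄ - η], [0, η̄]]`.  Then every irreducible representation
`ρ : Γ → SL₂(ℂ)` is conjugate in `SL₂(ℂ)` to `α_s` for a unique `s ∈ ℂ`. -/
theorem trefoil_SL2_irreducible_classification
    (A : ℂ → TrefoilGroup →* Matrix.SpecialLinearGroup (Fin 2) ℂ)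
    (hA : ∀ s : ℂ,
      ((A s trefX : Matrix (Fin 2) (Fin 2) ℂ) = !![Complex.I, 0; s, -Complex.I]) ∧
      ((A s trefY : Matrix (Fin 2) (Fin 2) ℂ) =
        !![eta, (starRingEnd ℂ) eta - eta; 0, (starRingEnd ℂ) eta]))
    (ρ : TrefoilGroup →* Matrix.SpecialLinearGroup (Fin 2) ℂ)
    (hirr : ∀ W : Submodule ℂ (Fin 2 → ℂ),
      (∀ γ : TrefoilGroup, ∀ v ∈ W, (ρ γ : Matrix (Fin 2) (Fin 2) ℂ).mulVec v ∈ W) →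
      W = ⊥ ∨ W = ⊤) :
    ∃! s : ℂ, ∃ g : Matrix.SpecialLinearGroup (Fin 2) ℂ,
      ∀ γ : TrefoilGroup, ρ γ = g * A s γ * g⁻¹ := by
  have hne := no_common_eigenvector ρ hirr
  have hPQ : (ρ trefX : Matrix (Fin 2) (Fin 2) ℂ) ^ 2 = (ρ trefY : Matrix (Fin 2) (Fin 2) ℂ) ^ 3 := by
    rw [← Matrix.SpecialLinearGroup.coe_pow, ← Matrix.SpecialLinearGroup.coe_pow, ← map_pow,
      ← map_pow, trefX_sq]
  obtain ⟨htP, htQ⟩ := trace_eq_of_sq_eq_cube (ρ trefX).2 (ρ trefY).2 hPQ hne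
  obtain ⟨s, g, hgx, hgy⟩ := exists_normal_form (ρ trefX).2 (ρ trefY).2 htP htQ hne
  have htr : ∀ t : ℂ, (∃ h : Matrix.SpecialLinearGroup (Fin 2) ℂ,
      ∀ γ : TrefoilGroup, ρ γ = h * A t γ * h⁻¹) →
      (ρ (trefX * trefY) : Matrix (Fin 2) (Fin 2) ℂ).trace
        = Complex.I * eta + (t * (1 - eta - eta) - Complex.I * (1 - eta)) := by
    rintro t ⟨h, hh⟩
    rw [hh, Matrix.SpecialLinearGroup.coe_mul, Matrix.trace_mul_comm,
      ← Matrix.SpecialLinearGroup.coe_mul, ← mul_assoc, inv_mul_cancel, one_mul, map_mul,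
      Matrix.SpecialLinearGroup.coe_mul, (hA t).1, (hA t).2, conj_eta, Matrix.trace_fin_two]
    simp [Matrix.mul_apply, Fin.sum_univ_two]
    ring
  have hs : ∃ h : Matrix.SpecialLinearGroup (Fin 2) ℂ,
      ∀ γ : TrefoilGroup, ρ γ = h * A s γ * h⁻¹ := by
    refine ⟨g, fun γ => ?_⟩
    have hhom : ρ = (MulAut.conj g).toMonoidHom.comp (A s) := by
      apply trefoil_hom_ext
      · refine eq_mul_inv_of_mul_eq (Subtype.ext ?_)
        simpa only [Matrix.SpecialLinearGroup.coe_mul, (hA s).1] using hgx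
      · refine eq_mul_inv_of_mul_eq (Subtype.ext ?_)
        simpa only [Matrix.SpecialLinearGroup.coe_mul, (hA s).2, conj_eta] using hgy
    exact DFunLike.congr_fun hhom γ
  refine ⟨s, hs, fun t ht => ?_⟩
  have h := (htr t ht).symm.trans (htr s hs)
  apply mul_right_cancel₀ one_sub_eta_sub_eta_ne_zero
  linear_combination h
end

section
/- Let Γ = ⟨x, y ∣ x² = y³⟩ be the trefoil knot group, η = e^{iπ/3}, and for s ∈ ℂ let α_s: Γ → SL₂(ℂ) be the representation with α_s(x) = [[i, 0], [s, −i]] and α_s(y) = [[η, η̄ − η], [0, η̄]]. Then α_s is irreducible if and only if s ≠ 0 and s ≠ 2i. -/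
theorem conj_eta_sub_eta_ne_zero : (starRingEnd ℂ) eta - eta ≠ 0 := by
  have him : eta.im = Real.sin (Real.pi / 3) := by
    rw [eta, show (Real.pi * Complex.I / 3 : ℂ) = ((Real.pi / 3 : ℝ) : ℂ) * Complex.I by
      push_cast; ring, Complex.exp_ofReal_mul_I_im]
  have hpos : 0 < eta.im := by
    rw [him]
    exact Real.sin_pos_of_pos_of_lt_pi (by positivity) (by linarith [Real.pi_pos])
  intro h
  exact hpos.ne' (Complex.conj_eq_iff_im.mp (sub_eq_zero.mp h))

/-- The elements of `G` having `v` as an eigenvector. -/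
def eigenvectorStabilizer {G n K : Type*} [Group G] [Fintype n] [DecidableEq n] [Field K]
    (ρ : G →* Matrix.SpecialLinearGroup n K) (v : n → K) : Subgroup G where
  carrier := {g | ∃ c : Kˣ, (ρ g : Matrix n n K).mulVec v = (c : K) • v}
  one_mem' := ⟨1, by simp⟩
  mul_mem' := by
    rintro a b ⟨c, hc⟩ ⟨d, hd⟩
    refine ⟨d * c, ?_⟩
    rw [map_mul, Matrix.SpecialLinearGroup.coe_mul, ← Matrix.mulVec_mulVec, hd,
      Matrix.mulVec_smul, hc, smul_smul, Units.val_mul]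
  inv_mem' := by
    rintro a ⟨c, hc⟩
    refine ⟨c⁻¹, ?_⟩
    have h : (ρ a⁻¹ : Matrix n n K).mulVec ((c : K) • v) = v := by
      rw [← hc, Matrix.mulVec_mulVec, ← Matrix.SpecialLinearGroup.coe_mul, ← map_mul]
      simp
    rw [Matrix.mulVec_smul] at h
    calc (ρ a⁻¹ : Matrix n n K).mulVec v
        = ((c⁻¹ : Kˣ) : K) • ((c : K) • (ρ a⁻¹ : Matrix n n K).mulVec v) := by
          rw [smul_smul, ← Units.val_mul, inv_mul_cancel, Units.val_one, one_smul]
      _ = ((c⁻¹ : Kˣ) : K) • v := by rw [h]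

theorem TrefoilGroup.subgroup_eq_top {H : Subgroup TrefoilGroup} (hx : trefX ∈ H)
    (hy : trefY ∈ H) : H = ⊤ := by
  rw [eq_top_iff, ← PresentedGroup.closure_range_of trefoilRels, Subgroup.closure_le]
  rintro _ ⟨b, rfl⟩
  cases b
  · exact hy
  · exact hx

/-- The line spanned by a common eigenvector of the two generators is a proper nonzero invariant
subspace. -/
theorem TrefoilGroup.exists_invariant_of_eigenvector
    (ρ : TrefoilGroup →* Matrix.SpecialLinearGroup (Fin 2) ℂ) {v : Fin 2 → ℂ} (hv : v ≠ 0)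
    (hx : trefX ∈ eigenvectorStabilizer ρ v) (hy : trefY ∈ eigenvectorStabilizer ρ v) :
    ∃ W : Submodule ℂ (Fin 2 → ℂ),
      (∀ γ : TrefoilGroup, ∀ w ∈ W, (ρ γ : Matrix (Fin 2) (Fin 2) ℂ).mulVec w ∈ W) ∧
      ¬(W = ⊥ ∨ W = ⊤) := by
  refine ⟨Submodule.span ℂ {v}, fun γ w hw => ?_, ?_⟩
  · obtain ⟨a, rfl⟩ := Submodule.mem_span_singleton.mp hw
    have hγ : γ ∈ eigenvectorStabilizer ρ v := by
      rw [TrefoilGroup.subgroup_eq_top hx hy]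
      exact Subgroup.mem_top γ
    obtain ⟨c, hc⟩ := hγ
    rw [Matrix.mulVec_smul, hc]
    exact Submodule.smul_mem _ _ (Submodule.smul_mem _ _ (Submodule.mem_span_singleton_self v))
  · rintro (h | h)
    · exact hv (Submodule.span_singleton_eq_bot.mp h)
    · have h1 := finrank_span_singleton (K := ℂ) hv
      rw [h, finrank_top] at h1
      simp at h1

theorem eq_top_of_basis_vectors_mem {K : Type*} [Field K] {W : Submodule K (Fin 2 → K)}
    (h₀ : ![1, 0] ∈ W) (h₁ : ![0, 1] ∈ W) : W = ⊤ := by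
  refine eq_top_iff.mpr fun v _ => ?_
  have h : v = v 0 • ![1, 0] + v 1 • ![0, 1] := by
    ext i; fin_cases i <;> simp
  rw [h]
  exact W.add_mem (W.smul_mem _ h₀) (W.smul_mem _ h₁)

theorem fin_two_mulVec {K : Type*} [Field K] (a b c d : K) (v : Fin 2 → K) :
    !![a, b; c, d].mulVec v = ![a * v 0 + b * v 1, c * v 0 + d * v 1] := by
  ext i
  fin_cases i <;> simp only [Matrix.mulVec, dotProduct, Fin.sum_univ_two] <;> rfl

/-- A subspace invariant under `[[a, 0], [s, -a]]` and `[[p, q - p], [0, q]]` is trivial, unless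
`s = 0`, `s = 2a` or `p = q`. -/
theorem eq_bot_or_eq_top_of_invariant {K : Type*} [Field K] {a s p q : K} (hpq : q - p ≠ 0)
    (hs : s ≠ 0) (hsa : s ≠ 2 * a) (W : Submodule K (Fin 2 → K))
    (hX : ∀ v ∈ W, !![a, 0; s, -a].mulVec v ∈ W)
    (hY : ∀ v ∈ W, !![p, q - p; 0, q].mulVec v ∈ W) : W = ⊥ ∨ W = ⊤ := by
  simp only [fin_two_mulVec] at hX hY
  refine or_iff_not_imp_left.mpr fun hW => ?_
  obtain ⟨v, hvW, hv⟩ := W.ne_bot_iff.mp hW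
  by_cases h : v 0 = v 1
  · have hv0 : v 0 ≠ 0 := fun h0 => hv (by ext i; fin_cases i <;> simp [← h, h0])
    have h11 : ![1, 1] ∈ W := by
      convert W.smul_mem (v 0)⁻¹ hvW using 1
      ext i; fin_cases i <;> simp [← h, hv0]
    have h01 : ![0, 1] ∈ W := by
      have hd : s - 2 * a ≠ 0 := sub_ne_zero.mpr hsa
      convert W.smul_mem (s - 2 * a)⁻¹ (W.sub_mem (hX _ h11) (W.smul_mem a h11)) using 1
      ext i; fin_cases i
      · simp
      · simp
        field_simp
        ring
    refine eq_top_of_basis_vectors_mem ?_ h01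
    convert W.sub_mem h11 h01 using 1
    ext i; fin_cases i <;> simp
  · have h10 : ![1, 0] ∈ W := by
      have hd : (q - p) * (v 1 - v 0) ≠ 0 := mul_ne_zero hpq (sub_ne_zero.mpr (Ne.symm h))
      convert W.smul_mem ((q - p) * (v 1 - v 0))⁻¹
        (W.sub_mem (hY _ hvW) (W.smul_mem q hvW)) using 1
      ext i; fin_cases i
      · simp only [Pi.smul_apply, Pi.sub_apply, smul_eq_mul, Fin.zero_eta, Matrix.cons_val_zero]
        rw [eq_inv_mul_iff_mul_eq₀ hd]
        ring
      · change 0 = _ * ((0 * v 0 + q * v 1) - q * v 1)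
        ring
    refine eq_top_of_basis_vectors_mem h10 ?_
    convert W.smul_mem s⁻¹ (W.sub_mem (hX _ h10) (W.smul_mem a h10)) using 1
    ext i; fin_cases i <;> simp [hs]

/-- **Lemma 9.1 (irreducibility criterion).** Let `α_s : Γ → SL₂(ℂ)` be the family of
representations of the trefoil knot group with `α_s(x) = [[i, 0], [s, -i]]` and
`α_s(y) = [[η, η̄ - η], [0, η̄]]`.  Then `α_s` is irreducible if and only if
`s ≠ 0` and `s ≠ 2i`. -/
theorem trefoil_SL2_family_irreducible_iff
    (A : ℂ → TrefoilGroup →* Matrix.SpecialLinearGroup (Fin 2) ℂ)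
    (hA : ∀ s : ℂ,
      ((A s trefX : Matrix (Fin 2) (Fin 2) ℂ) = !![Complex.I, 0; s, -Complex.I]) ∧
      ((A s trefY : Matrix (Fin 2) (Fin 2) ℂ) =
        !![eta, (starRingEnd ℂ) eta - eta; 0, (starRingEnd ℂ) eta])) :
    ∀ s : ℂ,
      (∀ W : Submodule ℂ (Fin 2 → ℂ),
        (∀ γ : TrefoilGroup, ∀ v ∈ W, (A s γ : Matrix (Fin 2) (Fin 2) ℂ).mulVec v ∈ W) →
        W = ⊥ ∨ W = ⊤) ↔
      (s ≠ 0 ∧ s ≠ 2 * Complex.I) := by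
  intro s
  obtain ⟨hx, hy⟩ := hA s
  constructor
  · intro hirr
    have no_eigenvector {v : Fin 2 → ℂ} (hv : v ≠ 0)
        (hxv : trefX ∈ eigenvectorStabilizer (A s) v)
        (hyv : trefY ∈ eigenvectorStabilizer (A s) v) : False := by
      obtain ⟨W, hW, hne⟩ := TrefoilGroup.exists_invariant_of_eigenvector (A s) hv hxv hyv
      exact hne (hirr W hW)
    have heta : eta ≠ 0 := Complex.exp_ne_zero _
    constructor
    · rintro rfl
      refine no_eigenvector (v := ![1, 0]) (by simp) ⟨Units.mk0 Complex.I Complex.I_ne_zero, ?_⟩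
        ⟨Units.mk0 eta heta, ?_⟩
      · rw [hx]
        ext i; fin_cases i <;> simp
      · rw [hy]
        ext i; fin_cases i <;> simp
    · rintro rfl
      refine no_eigenvector (v := ![1, 1]) (by simp) ⟨Units.mk0 Complex.I Complex.I_ne_zero, ?_⟩
        ⟨Units.mk0 ((starRingEnd ℂ) eta) (by simpa using heta), ?_⟩
      · rw [hx]
        ext i; fin_cases i <;> simp
        ring
      · rw [hy]
        ext i; fin_cases i <;> simp
  · rintro ⟨hs, hsa⟩ W hW
    exact eq_bot_or_eq_top_of_invariant conj_eta_sub_eta_ne_zero hs hsa W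
      (fun v hv => hx ▸ hW trefX v hv) (fun v hv => hy ▸ hW trefY v hv)
end
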